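/- arXiv:1810.05266 — 3 statements merged into one kernel-verified Lean document; each statement's English description precedes it below -/
import Mathlib

section
/- If P and Q are disjoint distributions on a connected graph with maximum degree at most 2 (a path or cycle), then coop(P,Q) ≤ DC(P,Q): the number of cooperation vertices is at most the number of double covered vertices, where Q = U is a unit with at least two pebbles. -/
open Finset

/-- A pebbling move: remove two pebbles from `src`, add one to `tgt`. -/
structure PMove (V : Type*) where
  src : V
  tgt : V

/-- Result of applying one pebbling move to a distribution. -/
def applyMove {V : Type*} [DecidableEq V] (p : V → ℕ) (m : PMove V) : V → ℕ :=
  fun w => if w = m.src then p w - 2 else if w = m.tgt then p w + 1 else p w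

/-- A list of moves is executable: each move goes along an edge and has
two pebbles available at its source. -/
def Executable {V : Type*} [DecidableEq V] (G : SimpleGraph V) :
    (V → ℕ) → List (PMove V) → Prop
  | _, [] => True
  | p, m :: ms => G.Adj m.src m.tgt ∧ 2 ≤ p m.src ∧ Executable G (applyMove p m) ms

/-- The distribution obtained after applying a sequence of moves. -/
def applySeq {V : Type*} [DecidableEq V] (p : V → ℕ) (σ : List (PMove V)) : V → ℕ :=
  σ.foldl applyMove p

/-- `v` is `k`-reachable under `p`. -/
def KReachable {V : Type*} [DecidableEq V] (G : SimpleGraph V) (p : V → ℕ) (k : ℕ) (v : V) :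
    Prop :=
  ∃ σ : List (PMove V), Executable G p σ ∧ k ≤ applySeq p σ v

/-- `v` is reachable under `p`: some pebbling sequence puts a pebble on `v`. -/
def Reachable' {V : Type*} [DecidableEq V] (G : SimpleGraph V) (p : V → ℕ) (v : V) : Prop :=
  KReachable G p 1 v

/-- The maximal number of pebbles that can be moved to `v`. -/
noncomputable def reach {V : Type*} [DecidableEq V] (G : SimpleGraph V) (p : V → ℕ) (v : V) :
    ℕ :=
  sSup {k | KReachable G p k v}

/-- The excess of `v` under `p`. -/
noncomputable def exc {V : Type*} [DecidableEq V] (G : SimpleGraph V) (p : V → ℕ) (v : V) :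
    ℕ :=
  reach G p v - 1

/-- The total excess of `p`. -/
noncomputable def TE {V : Type*} [Fintype V] [DecidableEq V] (G : SimpleGraph V)
    (p : V → ℕ) : ℕ :=
  ∑ v, exc G p v

/-- `p` is solvable: every vertex is reachable. -/
def Solvable {V : Type*} [DecidableEq V] (G : SimpleGraph V) (p : V → ℕ) : Prop :=
  ∀ v, Reachable' G p v

/-- The number of vertices reachable under `p`. -/
noncomputable def cov {V : Type*} [DecidableEq V] (G : SimpleGraph V) (p : V → ℕ) : ℕ :=
  Set.ncard {v | Reachable' G p v}

/-- The number of cooperation vertices of the pair `(p, q)`. -/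
noncomputable def coop {V : Type*} [DecidableEq V] (G : SimpleGraph V) (p q : V → ℕ) : ℕ :=
  Set.ncard {v | Reachable' G (p + q) v ∧ ¬ Reachable' G p v ∧ ¬ Reachable' G q v}

/-- The number of double covered vertices of the pair `(p, q)`. -/
noncomputable def DC {V : Type*} [DecidableEq V] (G : SimpleGraph V) (p q : V → ℕ) : ℕ :=
  Set.ncard {v | Reachable' G p v ∧ Reachable' G q v}

/-- The cooperation excess between `p` and `q`. -/
noncomputable def CE {V : Type*} [Fintype V] [DecidableEq V] (G : SimpleGraph V)
    (p q : V → ℕ) : ℤ :=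
  (TE G (p + q) : ℤ) - TE G p - TE G q

/-- The effect of a pebble placed at `v`. -/
noncomputable def eff {V : Type*} (G : SimpleGraph V) (v : V) : ℚ :=
  ∑ i ∈ Finset.range (G.diam + 1), (1 / 2 : ℚ) ^ i * (Set.ncard {u | G.dist v u = i})

/-- The optimal pebbling number of `G`. -/
noncomputable def piOpt {V : Type*} [Fintype V] [DecidableEq V] (G : SimpleGraph V) : ℕ :=
  sInf {k | ∃ p : V → ℕ, Solvable G p ∧ ∑ v, p v = k}

/-- One pebbling step. -/
def PStep {V : Type*} [DecidableEq V] (G : SimpleGraph V) (p q : V → ℕ) : Prop :=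
  ∃ m : PMove V, G.Adj m.src m.tgt ∧ 2 ≤ p m.src ∧ q = applyMove p m

theorem exec_iff {V : Type*} [DecidableEq V] (G : SimpleGraph V) (p q : V → ℕ) :
    Relation.ReflTransGen (PStep G) p q ↔ ∃ σ, Executable G p σ ∧ applySeq p σ = q := by
  constructor
  · intro h
    induction h using Relation.ReflTransGen.head_induction_on with
    | refl => exact ⟨[], trivial, rfl⟩
    | head h1 _ ih =>
      obtain ⟨m, h1, h2, rfl⟩ := h1
      obtain ⟨σ, h3, h4⟩ := ih
      exact ⟨m :: σ, ⟨h1, h2, h3⟩, h4⟩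
  · rintro ⟨σ, h, rfl⟩
    induction σ generalizing p with
    | nil => exact .refl
    | cons m σ ih =>
      obtain ⟨h1, h2, h3⟩ := h
      exact .head ⟨m, h1, h2, rfl⟩ (ih _ h3)

theorem reachable_iff {V : Type*} [DecidableEq V] (G : SimpleGraph V) (p : V → ℕ) (v : V) :
    Reachable' G p v ↔ ∃ q, Relation.ReflTransGen (PStep G) p q ∧ 1 ≤ q v := by
  constructor
  · rintro ⟨σ, h, h1⟩
    exact ⟨_, (exec_iff G p _).2 ⟨σ, h, rfl⟩, h1⟩
  · rintro ⟨q, h, h1⟩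
    obtain ⟨σ, h2, rfl⟩ := (exec_iff G p _).1 h
    exact ⟨σ, h2, h1⟩

open Classical in
/-- Number of pebbles that can be pushed into `x j` along `x 0, x 1, …`. -/
noncomputable def casc {V : Type*} (G : SimpleGraph V) (x : ℕ → V) (p : V → ℕ) : ℕ → ℕ
  | 0 => 0
  | j + 1 => if G.Adj (x j) (x (j + 1)) then (casc G x p j + p (x j)) / 2 else 0

theorem casc_congr {V : Type*} (G : SimpleGraph V) (x y : ℕ → V) (p : V → ℕ) (m : ℕ)
    (h : ∀ j ≤ m, x j = y j) : casc G x p m = casc G y p m := by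
  induction m with
  | zero => rfl
  | succ m ih =>
    simp only [casc]
    rw [h m (by omega), h (m + 1) le_rfl, ih (fun j hj => h j (by omega))]

theorem push_many {V : Type*} [DecidableEq V] (G : SimpleGraph V) (a c : V) (h : G.Adj a c)
    (t : ℕ) (p : V → ℕ) (hp : 2 * t ≤ p a) :
    ∃ q, Relation.ReflTransGen (PStep G) p q ∧ q c = p c + t ∧
      ∀ w, w ≠ a → w ≠ c → q w = p w := by
  induction t generalizing p with
  | zero => exact ⟨p, .refl, rfl, fun _ _ _ => rfl⟩
  | succ t ih =>
    have hne : c ≠ a := h.ne'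
    obtain ⟨q, h1, h2, h3⟩ := ih (applyMove p ⟨a, c⟩) (by simp [applyMove]; omega)
    refine ⟨q, .head ⟨⟨a, c⟩, h, by simp; omega, rfl⟩ h1, ?_, ?_⟩
    · rw [h2]; simp [applyMove, hne]; omega
    · intro w ha hc
      rw [h3 w ha hc]; simp [applyMove, ha, hc]

theorem casc_sound {V : Type*} [DecidableEq V] (G : SimpleGraph V) (x : ℕ → V) (p : V → ℕ)
    (m : ℕ) (hinj : ∀ i ≤ m, ∀ j ≤ m, x i = x j → i = j) :
    ∃ q, Relation.ReflTransGen (PStep G) p q ∧ p (x m) + casc G x p m ≤ q (x m) ∧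
      ∀ w, (∀ j ≤ m, w ≠ x j) → q w = p w := by
  induction m with
  | zero => exact ⟨p, .refl, by simp [casc], fun _ _ => rfl⟩
  | succ m ih =>
    obtain ⟨q, h1, h2, h3⟩ := ih (fun i hi j hj => hinj i (by omega) j (by omega))
    have h4 : q (x (m + 1)) = p (x (m + 1)) := h3 _ (fun j hj he => by
      have := hinj _ le_rfl j (by omega) he; omega)
    by_cases hA : G.Adj (x m) (x (m + 1))
    · obtain ⟨r, h5, h6, h7⟩ := push_many G _ _ hA ((casc G x p m + p (x m)) / 2) q (by omega)
      refine ⟨r, h1.trans h5, ?_, ?_⟩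
      · simp only [casc, if_pos hA]; omega
      · intro w hw
        rw [h7 w (hw m (by omega)) (hw _ le_rfl), h3 w (fun j hj => hw j (by omega))]
    · refine ⟨q, h1, ?_, fun w hw => h3 w (fun j hj => hw j (by omega))⟩
      simp only [casc, if_neg hA]; omega

theorem casc_reach {V : Type*} [DecidableEq V] (G : SimpleGraph V) (x : ℕ → V) (p : V → ℕ)
    (m : ℕ) (hinj : ∀ i ≤ m, ∀ j ≤ m, x i = x j → i = j)
    (h : 1 ≤ casc G x p m + p (x m)) : Reachable' G p (x m) := by
  obtain ⟨q, h1, h2, -⟩ := casc_sound G x p m hinj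
  exact (reachable_iff G p _).2 ⟨q, h1, by omega⟩

theorem casc_step {V : Type*} (G : SimpleGraph V) (x : ℕ → V) (p q : V → ℕ) (j : ℕ)
    (h : casc G x q j + q (x j) ≤ casc G x p j + p (x j)) :
    casc G x q (j + 1) ≤ casc G x p (j + 1) := by
  simp only [casc]
  split_ifs
  · exact Nat.div_le_div_right h
  · exact le_rfl

theorem casc_le_of_range {V : Type*} (G : SimpleGraph V) (x : ℕ → V) (p q : V → ℕ) (a m : ℕ)
    (ham : a ≤ m) (ha : casc G x q a ≤ casc G x p a)
    (h : ∀ j, a ≤ j → j < m → q (x j) ≤ p (x j)) : casc G x q m ≤ casc G x p m := by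
  induction m, ham using Nat.le_induction with
  | base => exact ha
  | succ m hm ih =>
    apply casc_step
    have := ih (fun j h1 h2 => h j h1 (by omega))
    have := h m hm (by omega)
    omega

theorem casc_mono {V : Type*} [DecidableEq V] (G : SimpleGraph V) (x : ℕ → V) (p : V → ℕ)
    (m : ℕ) (hinj : ∀ i ≤ m, ∀ j ≤ m, x i = x j → i = j) (mv : PMove V)
    (hadj : G.Adj mv.src mv.tgt) (h2 : 2 ≤ p mv.src) (i : ℕ) (hi : i + 1 < m)
    (hmv : (mv.src = x i ∧ mv.tgt = x (i + 1)) ∨ (mv.src = x (i + 1) ∧ mv.tgt = x i)) :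
    casc G x (applyMove p mv) m ≤ casc G x p m := by
  obtain ⟨s, t⟩ := mv
  simp only at hadj h2 hmv
  have hne : x (i + 1) ≠ x i := fun h => by
    have := hinj _ (by omega) _ (by omega) h; omega
  have hoth : ∀ j, j ≤ m → j ≠ i → j ≠ i + 1 → applyMove p ⟨s, t⟩ (x j) = p (x j) := by
    intro j hj h1 h3
    have e1 : x j ≠ x i := fun h => h1 (hinj _ hj _ (by omega) h)
    have e2 : x j ≠ x (i + 1) := fun h => h3 (hinj _ hj _ (by omega) h)
    rcases hmv with ⟨rfl, rfl⟩ | ⟨rfl, rfl⟩ <;> simp [applyMove, e1, e2]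
  have hI : casc G x (applyMove p ⟨s, t⟩) i ≤ casc G x p i :=
    casc_le_of_range G x p _ 0 i (by omega) le_rfl
      (fun j _ hj => (hoth j (by omega) (by omega) (by omega)).le)
  have hA : G.Adj (x i) (x (i + 1)) := by
    rcases hmv with ⟨rfl, rfl⟩ | ⟨rfl, rfl⟩
    · exact hadj
    · exact hadj.symm
  have hI2 : casc G x (applyMove p ⟨s, t⟩) (i + 2) ≤ casc G x p (i + 2) := by
    apply casc_step
    simp only [casc, if_pos hA]
    rcases hmv with ⟨rfl, rfl⟩ | ⟨rfl, rfl⟩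
    · simp [applyMove, hne]; omega
    · simp [applyMove, hne, hne.symm]; omega
  exact casc_le_of_range G x p _ (i + 2) m (by omega) hI2
      (fun j h1 hj => (hoth j (by omega) (by omega) (by omega)).le)

/-- Completeness: with no pebble on `v = x m` and both cascades zero, `v` is unreachable. -/
theorem casc_complete {V : Type*} [DecidableEq V] (G : SimpleGraph V) (x y : ℕ → V)
    (m : ℕ) (hinj : ∀ i ≤ m, ∀ j ≤ m, x i = x j → i = j)
    (hsurj : ∀ w, ∃ i ≤ m, w = x i)
    (hadj : ∀ i j, i < j → j ≤ m → G.Adj (x i) (x j) → j = i + 1 ∨ (i = 0 ∧ j = m))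
    (hy : ∀ j, j < m → y j = x (m - 1 - j)) (hym : y m = x m)
    (p : V → ℕ) (hp : p (x m) = 0) (hr : Reachable' G p (x m)) :
    1 ≤ casc G x p m ∨ 1 ≤ casc G y p m := by
  by_contra! hcon
  have hyinj : ∀ i ≤ m, ∀ j ≤ m, y i = y j → i = j := by
    intro i hi j hj h
    rcases hi.lt_or_eq with hi | rfl <;> rcases hj.lt_or_eq with hj | rfl
    · rw [hy i hi, hy j hj] at h
      have := hinj _ (by omega) _ (by omega) h; omega
    · rw [hy i hi, hym] at h
      have := hinj _ (by omega) _ (by omega) h; omega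
    · rw [hy j hj, hym] at h
      have := hinj _ (by omega) _ (by omega) h; omega
    · rfl
  obtain ⟨q, hq, hq1⟩ := (reachable_iff G p _).1 hr
  have key : q (x m) = 0 ∧ casc G x q m = 0 ∧ casc G y q m = 0 := by
    clear hq1
    induction hq with
    | refl => exact ⟨hp, by omega, by omega⟩
    | @tail b c _ hs ih =>
      obtain ⟨mv, h1, h2, rfl⟩ := hs
      obtain ⟨i1, i2, i3⟩ := ih
      obtain ⟨s, t⟩ := mv
      simp only at h1 h2
      obtain ⟨i, hi, rfl⟩ := hsurj s
      obtain ⟨j, hj, rfl⟩ := hsurj t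
      have him : i ≠ m := by rintro rfl; omega
      have hij : i ≠ j := by rintro rfl; exact h1.ne rfl
      by_cases hjm : j = m
      · exfalso
        subst hjm
        rcases hadj i j (by omega) le_rfl h1 with rfl | ⟨rfl, -⟩
        · simp only [casc, if_pos h1] at i2; omega
        · obtain ⟨k, rfl⟩ : ∃ k, j = k + 1 := ⟨j - 1, by omega⟩
          have e : y k = x 0 := by rw [hy k (by omega)]; congr 1; omega
          rw [casc, e, hym, if_pos h1] at i3; omega
      · have hmz : applyMove b ⟨x i, x j⟩ (x m) = 0 := by
          have e1 : x m ≠ x i := fun h => him (hinj _ le_rfl _ hi h).symm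
          have e2 : x m ≠ x j := fun h => hjm (hinj _ le_rfl _ hj h).symm
          simp [applyMove, e1, e2, i1]
        have hc : j = i + 1 ∨ i = j + 1 := by
          rcases lt_or_gt_of_ne hij with h | h
          · rcases hadj i j h hj h1 with h | h <;> omega
          · rcases hadj j i h hi h1.symm with h | h <;> omega
        refine ⟨hmz, ?_, ?_⟩
        · rcases hc with rfl | rfl
          · have := casc_mono G x b m hinj ⟨_, _⟩ h1 h2 i (by omega) (Or.inl ⟨rfl, rfl⟩); omega
          · have := casc_mono G x b m hinj ⟨_, _⟩ h1 h2 j (by omega) (Or.inr ⟨rfl, rfl⟩); omega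
        · have f : ∀ k, k < m → x k = y (m - 1 - k) := by
            intro k hk
            rw [hy _ (by omega)]; congr 1; omega
          rcases hc with rfl | rfl
          · have := casc_mono G y b m hyinj ⟨_, _⟩ h1 h2 (m - 1 - (i + 1)) (by omega)
              (Or.inr ⟨(f i (by omega)).trans (congrArg y (by omega)), f _ (by omega)⟩)
            omega
          · have := casc_mono G y b m hyinj ⟨_, _⟩ h1 h2 (m - 1 - (j + 1)) (by omega)
              (Or.inl ⟨f _ (by omega), (f j (by omega)).trans (congrArg y (by omega))⟩)
            omega
  omega

theorem casc_add_le {V : Type*} (G : SimpleGraph V) (x : ℕ → V) (p q : V → ℕ) (m : ℕ) :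
    casc G x (p + q) m ≤ casc G x p m + casc G x q m + 1 := by
  induction m with
  | zero => simp [casc]
  | succ m ih =>
    simp only [casc, Pi.add_apply]
    split_ifs <;> omega

theorem casc_add_eq {V : Type*} (G : SimpleGraph V) (x : ℕ → V) (p q : V → ℕ) (m : ℕ)
    (h : ∀ j < m, casc G x p j + p (x j) = 0 ∨ casc G x q j + q (x j) = 0) :
    casc G x (p + q) m = casc G x p m + casc G x q m := by
  induction m with
  | zero => simp [casc]
  | succ m ih =>
    have h1 := ih (fun j hj => h j (by omega))
    have h2 := h m (by omega)
    simp only [casc, Pi.add_apply]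
    split_ifs <;> omega

/-- Cyclic parametrization of the graph, starting at `u`. -/
structure Cyc {V : Type*} (G : SimpleGraph V) (e : ℤ → V) (n : ℕ) (u : V) : Prop where
  pos : 0 < n
  zero : e 0 = u
  eq_iff : ∀ i j, e i = e j ↔ (n : ℤ) ∣ i - j
  surj : ∀ v, ∃ i : ℤ, 0 ≤ i ∧ i < n ∧ v = e i
  adj : ∀ i j, G.Adj (e i) (e j) → (n : ℤ) ∣ j - i - 1 ∨ (n : ℤ) ∣ i - j - 1

theorem Cyc.neg {V : Type*} {G : SimpleGraph V} {e : ℤ → V} {n : ℕ} {u : V}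
    (h : Cyc G e n u) : Cyc G (fun i => e (-i)) n u where
  pos := h.pos
  zero := by simpa using h.zero
  eq_iff i j := by
    rw [h.eq_iff, ← dvd_neg]; ring_nf
  surj v := by
    obtain ⟨i, h0, h1, rfl⟩ := h.surj v
    by_cases hi : i = 0
    · exact ⟨0, le_rfl, by omega, by simp [hi]⟩
    · exact ⟨n - i, by omega, by omega, by rw [h.eq_iff]; exact ⟨1, by ring⟩⟩
  adj i j hA := by
    have := h.adj _ _ hA
    have e1 : -j - -i - 1 = i - j - 1 := by ring
    have e2 : -i - -j - 1 = j - i - 1 := by ring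
    rw [e1, e2] at this
    exact this.symm

theorem dvd_small {n : ℕ} {a : ℤ} (h : (n : ℤ) ∣ a) (h1 : -(n : ℤ) < a) (h2 : a < n) : a = 0 :=
  Int.eq_zero_of_abs_lt_dvd h (abs_lt.2 ⟨h1, h2⟩)

theorem Cyc.inj {V : Type*} {G : SimpleGraph V} {e : ℤ → V} {n : ℕ} {u : V}
    (h : Cyc G e n u) (a : ℤ) (m : ℕ) (hm : m ≤ n - 1) :
    ∀ i ≤ m, ∀ j ≤ m, (fun j : ℕ => e (a + j)) i = (fun j : ℕ => e (a + j)) j → i = j := by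
  intro i hi j hj hij
  have hp := h.pos
  have := dvd_small ((h.eq_iff _ _).1 hij) (by omega) (by omega)
  omega

/-- The clockwise flow reaches the vertex `e k`. -/
def CW {V : Type*} (G : SimpleGraph V) (e : ℤ → V) (n : ℕ) (p : V → ℕ) (v : V) : Prop :=
  ∃ k : ℕ, 0 < k ∧ k < n ∧ v = e k ∧ 1 ≤ casc G (fun j : ℕ => e (k + 1 + j)) p (n - 1)

theorem Cyc.complete {V : Type*} [DecidableEq V] {G : SimpleGraph V} {e : ℤ → V} {n : ℕ} {u : V}
    (h : Cyc G e n u) (p : V → ℕ) (v : V) (hv : v ≠ u) (hp : p v = 0)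
    (hr : Reachable' G p v) : CW G e n p v ∨ CW G (fun i => e (-i)) n p v := by
  have hpos := h.pos
  obtain ⟨k, h0, h1, rfl⟩ := h.surj v
  lift k to ℕ using h0
  have hk : k ≠ 0 := by
    rintro rfl
    exact hv (by simpa using h.zero)
  have hper : ∀ i j : ℤ, i = j ∨ i = j + n ∨ j = i + n → e i = e j := by
    intro i j hij
    rw [h.eq_iff]
    rcases hij with h | h | h
    · exact ⟨0, by omega⟩
    · exact ⟨1, by omega⟩
    · exact ⟨-1, by omega⟩
  have hx : e ((k : ℤ) + 1 + (n - 1 : ℕ)) = e k := hper _ _ (by omega)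
  have := casc_complete G (fun j : ℕ => e ((k : ℤ) + 1 + j))
    (fun j : ℕ => e (-(((n - k : ℕ) : ℤ) + 1 + j))) (n - 1)
    (h.inj _ _ le_rfl) ?_ ?_ ?_ ?_ p (by simp only [hx]; exact hp) (by simp only [hx]; exact hr)
  · rcases this with this | this
    · exact Or.inl ⟨k, by omega, by omega, rfl, this⟩
    · exact Or.inr ⟨n - k, by omega, by omega, hper _ _ (by omega), this⟩
  · intro w
    obtain ⟨i, i0, i1, rfl⟩ := h.surj w
    by_cases hik : i ≤ k
    · exact ⟨(i - k - 1 + n).toNat, by omega, hper _ _ (by omega)⟩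
    · exact ⟨(i - k - 1).toNat, by omega, hper _ _ (by omega)⟩
  · intro i j hij hj hA
    rcases h.adj _ _ hA with hd | hd
    · have := dvd_small hd (by omega) (by omega)
      omega
    · have hd2 := dvd_add hd (dvd_refl (n : ℤ))
      have := dvd_small hd2 (by omega) (by omega)
      omega
  · intro j hj
    exact (h.eq_iff _ _).2 ⟨-2, by omega⟩
  · exact (h.eq_iff _ _).2 ⟨-3, by omega⟩

/-- On a clockwise cooperation vertex there is a double covered vertex before it. -/
theorem Cyc.dc {V : Type*} [DecidableEq V] {G : SimpleGraph V} {e : ℤ → V} {n : ℕ} {u : V}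
    (h : Cyc G e n u) (P U : V → ℕ) (hU : ∀ w, w ≠ u → U w = 0) (v : V)
    (hP : ¬ Reachable' G P v) (hUv : ¬ Reachable' G U v) (hc : CW G e n (P + U) v) :
    ∃ i : ℕ, i < n ∧ Reachable' G P (e i) ∧ (∀ j : ℕ, j ≤ i → Reachable' G U (e j)) := by
  obtain ⟨k, k0, k1, rfl, hk⟩ := hc
  have hper : ∀ i j : ℤ, i = j ∨ i = j + n ∨ j = i + n → e i = e j := by
    intro i j hij
    rw [h.eq_iff]
    rcases hij with h | h | h
    · exact ⟨0, by omega⟩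
    · exact ⟨1, by omega⟩
    · exact ⟨-1, by omega⟩
  set x : ℕ → V := fun j : ℕ => e ((k : ℤ) + 1 + j) with hxdef
  have hx : x (n - 1) = e k := hper _ _ (by omega)
  have hre : ∀ p : V → ℕ, ∀ j ≤ n - 1, 1 ≤ casc G x p j + p (x j) → Reachable' G p (x j) :=
    fun p j hj => casc_reach G x p j (h.inj _ _ hj)
  have hPz : casc G x P (n - 1) = 0 := by
    by_contra hne
    exact hP (hx ▸ hre P (n - 1) le_rfl (by omega))
  have hUz : casc G x U (n - 1) = 0 := by
    by_contra hne
    exact hUv (hx ▸ hre U (n - 1) le_rfl (by omega))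
  obtain ⟨j, hj, hjP, hjU⟩ : ∃ j < n - 1, 1 ≤ casc G x P j + P (x j) ∧
      1 ≤ casc G x U j + U (x j) := by
    by_contra! hcon
    have := casc_add_eq G x P U (n - 1) (fun j hj => by have := hcon j hj; omega)
    omega
  have hxu : ∀ j, j < n - 1 - k → U (x j) = 0 := by
    intro j hj
    apply hU
    rw [← h.zero]
    intro he
    have := (h.eq_iff _ _).1 he
    have := dvd_small this (by omega) (by omega)
    omega
  have hz : ∀ j, j ≤ n - 1 - k → casc G x U j = 0 := by
    intro j
    induction j with
    | zero => intro _; rfl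
    | succ j ih =>
      intro hj
      simp only [casc, ih (by omega), hxu j (by omega)]
      simp
  have hge : n - 1 - k ≤ j := by
    by_contra hlt
    have := hz j (by omega)
    have := hxu j (by omega)
    omega
  have hback : ∀ t, n - 1 - k ≤ j - t → t ≤ j → 1 ≤ casc G x U (j - t) + U (x (j - t)) := by
    intro t
    induction t with
    | zero => intro _ _; exact hjU
    | succ t ih =>
      intro h1 h2
      have h3 := ih (by omega) (by omega)
      obtain ⟨s, hs⟩ : ∃ s, j - t = s + 1 := ⟨j - (t + 1), by omega⟩
      have hs' : j - (t + 1) = s := by omega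
      rw [hs'] at h1 ⊢
      rw [hs] at h3
      have h4 : U (x (s + 1)) = 0 := by
        apply hU
        rw [← h.zero]
        intro he
        have hd := (h.eq_iff _ _).1 he
        have hd2 := dvd_sub hd (dvd_refl (n : ℤ))
        have := dvd_small hd2 (by omega) (by omega)
        omega
      simp only [casc, h4] at h3
      split_ifs at h3 <;> omega
  have hconv : ∀ i : ℕ, i < k → x (n - 1 - k + i) = e i := fun i hi => hper _ _ (by omega)
  refine ⟨j - (n - 1 - k), by omega, ?_, ?_⟩
  · rw [← hconv _ (by omega)]
    have : n - 1 - k + (j - (n - 1 - k)) = j := by omega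
    rw [this]
    exact hre P j (by omega) hjP
  · intro i hi
    rw [← hconv i (by omega)]
    have := hback (j - (n - 1 - k + i)) (by omega) (by omega)
    have h5 : j - (j - (n - 1 - k + i)) = n - 1 - k + i := by omega
    rw [h5] at this
    exact hre U _ (by omega) this

theorem Cyc.uniq_aux {V : Type*} [DecidableEq V] {G : SimpleGraph V} {e : ℤ → V} {n : ℕ} {u : V}
    (h : Cyc G e n u) (P U : V → ℕ) (hU : ∀ w, w ≠ u → U w = 0) (k l : ℕ) (hk : 0 < k)
    (hkl : k < l) (hl : l < n)
    (hP : ¬ Reachable' G P (e k)) (hUv : ¬ Reachable' G U (e k))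
    (hP' : ¬ Reachable' G P (e l))
    (hc : 1 ≤ casc G (fun j : ℕ => e (l + 1 + j)) (P + U) (n - 1)) : False := by
  have hper : ∀ i j : ℤ, i = j ∨ i = j + n ∨ j = i + n → e i = e j := by
    intro i j hij
    rw [h.eq_iff]
    rcases hij with h | h | h
    · exact ⟨0, by omega⟩
    · exact ⟨1, by omega⟩
    · exact ⟨-1, by omega⟩
  set x : ℕ → V := fun j : ℕ => e ((l : ℤ) + 1 + j) with hxdef
  have hx : x (n - 1) = e l := hper _ _ (by omega)
  obtain ⟨a, ha⟩ : ∃ a, a = n + k - l - 1 := ⟨_, rfl⟩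
  have hxa : x a = e k := hper _ _ (by omega)
  have hre : ∀ p : V → ℕ, ∀ j ≤ n - 1, 1 ≤ casc G x p j + p (x j) → Reachable' G p (x j) :=
    fun p j hj => casc_reach G x p j (h.inj _ _ hj)
  have hPz : casc G x P (n - 1) = 0 := by
    by_contra hne
    exact hP' (hx ▸ hre P (n - 1) le_rfl (by omega))
  have hPa : casc G x P a + P (x a) = 0 := by
    by_contra hne
    exact hP (hxa ▸ hre P a (by omega) (by omega))
  have hUa : casc G x U a + U (x a) = 0 := by
    by_contra hne
    exact hUv (hxa ▸ hre U a (by omega) (by omega))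
  have h1 := casc_add_le G x P U a
  have h2 : casc G x (P + U) (a + 1) = 0 := by
    simp only [casc, Pi.add_apply]
    split_ifs <;> omega
  have h3 := casc_le_of_range G x P (P + U) (a + 1) (n - 1) (by omega) (by omega) (by
    intro j j1 j2
    have : U (x j) = 0 := by
      apply hU
      rw [← h.zero]
      intro he
      have hd := (h.eq_iff _ _).1 he
      have hd2 := dvd_sub hd (dvd_refl (n : ℤ))
      have := dvd_small hd2 (by omega) (by omega)
      omega
    simp [this])
  omega

theorem Cyc.uniq {V : Type*} [DecidableEq V] {G : SimpleGraph V} {e : ℤ → V} {n : ℕ} {u : V}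
    (h : Cyc G e n u) (P U : V → ℕ) (hU : ∀ w, w ≠ u → U w = 0) (v w : V)
    (hP : ¬ Reachable' G P v) (hUv : ¬ Reachable' G U v) (hc : CW G e n (P + U) v)
    (hP' : ¬ Reachable' G P w) (hUv' : ¬ Reachable' G U w) (hc' : CW G e n (P + U) w) :
    v = w := by
  obtain ⟨k, k0, k1, rfl, hk⟩ := hc
  obtain ⟨l, l0, l1, rfl, hl⟩ := hc'
  rcases lt_trichotomy k l with hkl | rfl | hkl
  · exact (h.uniq_aux P U hU k l k0 hkl l1 hP hUv hP' hl).elim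
  · rfl
  · exact (h.uniq_aux P U hU l k l0 hkl k1 hP' hUv' hP hk).elim

theorem degree_two_third {V : Type*} [Fintype V] [DecidableEq V] (G : SimpleGraph V)
    [DecidableRel G.Adj] (hdeg : ∀ v, G.degree v ≤ 2) (v a b c : V) (ha : G.Adj v a)
    (hb : G.Adj v b) (hc : G.Adj v c) (hab : a ≠ b) : c = a ∨ c = b := by
  by_contra! hcon
  have h1 : ({a, b, c} : Finset V) ⊆ G.neighborFinset v := by
    intro w hw
    simp only [Finset.mem_insert, Finset.mem_singleton] at hw
    rw [SimpleGraph.mem_neighborFinset]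
    rcases hw with rfl | rfl | rfl <;> assumption
  have h2 := Finset.card_le_card h1
  rw [Finset.card_eq_three.2 ⟨a, b, c, hab, hcon.1.symm, hcon.2.symm, rfl⟩] at h2
  have := hdeg v
  rw [← SimpleGraph.card_neighborFinset_eq_degree] at this
  omega

theorem exists_ham {V : Type*} [Fintype V] [DecidableEq V] (G : SimpleGraph V)
    [DecidableRel G.Adj] (hconn : G.Connected) (hdeg : ∀ v, G.degree v ≤ 2) :
    ∃ (L : ℕ) (f : ℕ → V), (∀ i ≤ L, ∀ j ≤ L, f i = f j → i = j) ∧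
      (∀ w, ∃ i ≤ L, w = f i) ∧
      (∀ i j, i < j → j ≤ L → G.Adj (f i) (f j) → j = i + 1 ∨ (i = 0 ∧ j = L)) := by
  obtain ⟨v0⟩ := hconn.nonempty
  let S : Set ℕ := {l | ∃ (a b : V) (p : G.Walk a b), p.IsPath ∧ p.length = l}
  have hS : BddAbove S := ⟨Fintype.card V, by
    rintro l ⟨a, b, p, hp, rfl⟩
    exact hp.length_lt.le⟩
  have hSn : S.Nonempty := ⟨0, v0, v0, .nil, by simp, rfl⟩
  obtain ⟨a, b, p, hp, hl⟩ := Nat.sSup_mem hSn hS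
  have hmax : ∀ (c d : V) (q : G.Walk c d), q.IsPath → q.length ≤ p.length := by
    intro c d q hq
    rw [hl]
    exact le_csSup hS ⟨c, d, q, hq, rfl⟩
  have hinj : ∀ i ≤ p.length, ∀ j ≤ p.length, p.getVert i = p.getVert j → i = j :=
    fun i hi j hj hij => hp.getVert_injOn hi hj hij
  have hmid : ∀ i w, 0 < i → i < p.length → G.Adj (p.getVert i) w →
      w = p.getVert (i - 1) ∨ w = p.getVert (i + 1) := by
    intro i w h0 h1 hw
    refine degree_two_third G hdeg (p.getVert i) _ _ w ?_ (p.adj_getVert_succ h1) hw ?_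
    · have := p.adj_getVert_succ (i := i - 1) (by omega)
      rw [Nat.sub_add_cancel h0] at this
      exact this.symm
    · intro he
      have := hinj _ (by omega) _ (by omega) he
      omega
  have hclosed : ∀ v w, v ∈ p.support → G.Adj v w → w ∈ p.support := by
    intro v w hv hw
    obtain ⟨i, rfl, hi⟩ := SimpleGraph.Walk.mem_support_iff_exists_getVert.1 hv
    by_contra hns
    rcases Nat.eq_zero_or_pos i with rfl | hpos
    · rw [SimpleGraph.Walk.getVert_zero] at hw
      have := hmax _ _ (.cons hw.symm p) (hp.cons hns)
      simp at this
    · rcases hi.lt_or_eq with hlt | rfl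
      · rcases hmid i w hpos hlt hw with rfl | rfl <;>
          exact hns (SimpleGraph.Walk.getVert_mem_support _ _)
      · rw [SimpleGraph.Walk.getVert_length] at hw
        have := hmax _ _ (.cons hw.symm p.reverse) (hp.reverse.cons (by simpa using hns))
        simp at this
  have hall : ∀ w, w ∈ p.support := by
    intro w
    obtain ⟨q⟩ := hconn.preconnected a w
    have : ∀ (c d : V) (q : G.Walk c d), c ∈ p.support → d ∈ p.support := by
      intro c d q
      induction q with
      | nil => exact id
      | cons h _ ih => exact fun hc => ih (hclosed _ _ hc h)
    exact this a w q p.start_mem_support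
  refine ⟨p.length, p.getVert, hinj, ?_, ?_⟩
  · intro w
    obtain ⟨i, h1, h2⟩ := SimpleGraph.Walk.mem_support_iff_exists_getVert.1 (hall w)
    exact ⟨i, h2, h1.symm⟩
  · intro i j hij hj hA
    rcases Nat.eq_zero_or_pos i with rfl | hpos
    · rcases hj.lt_or_eq with hlt | rfl
      · rcases hmid j _ hij hlt hA.symm with h | h
        · have := hinj _ (by omega) _ (by omega) h; omega
        · have := hinj _ (by omega) _ (by omega) h; omega
      · exact Or.inr ⟨rfl, rfl⟩
    · rcases hmid i _ hpos (by omega) hA with h | h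
      · have := hinj _ (by omega) _ (by omega) h; omega
      · have := hinj _ (by omega) _ (by omega) h; omega

theorem exists_cyc {V : Type*} [Fintype V] [DecidableEq V] (G : SimpleGraph V)
    [DecidableRel G.Adj] (hconn : G.Connected) (hdeg : ∀ v, G.degree v ≤ 2) (u : V) :
    ∃ (n : ℕ) (e : ℤ → V), Cyc G e n u := by
  obtain ⟨L, f, hinj, hsurj, hadj⟩ := exists_ham G hconn hdeg
  obtain ⟨c, hc, rfl⟩ := hsurj u
  have hn : (0 : ℤ) < ((L + 1 : ℕ) : ℤ) := by omega
  have hb : ∀ i : ℤ, 0 ≤ (i + c) % ((L + 1 : ℕ) : ℤ) ∧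
      (i + c) % ((L + 1 : ℕ) : ℤ) < ((L + 1 : ℕ) : ℤ) :=
    fun i => ⟨Int.emod_nonneg _ hn.ne', Int.emod_lt_of_pos _ hn⟩
  have hd : ∀ i : ℤ, ((L + 1 : ℕ) : ℤ) ∣ (i + c) - (i + c) % ((L + 1 : ℕ) : ℤ) :=
    fun i => Int.dvd_self_sub_emod
  refine ⟨L + 1, fun i => f ((i + c) % ((L + 1 : ℕ) : ℤ)).toNat, by omega, ?_, ?_, ?_, ?_⟩
  · have : ((0 : ℤ) + c) % ((L + 1 : ℕ) : ℤ) = c := by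
      rw [zero_add]; exact Int.emod_eq_of_lt (by omega) (by omega)
    simp only [this, Int.toNat_natCast]
  · intro i j
    have h1 := hb i
    have h2 := hb j
    constructor
    · intro h
      have := hinj _ (by omega) _ (by omega) h
      have h3 : (i + c) % ((L + 1 : ℕ) : ℤ) = (j + c) % ((L + 1 : ℕ) : ℤ) := by omega
      have h4 := (Int.emod_emod_of_dvd (i + c) (dvd_refl ((L + 1 : ℕ) : ℤ)))
      have h5 := dvd_sub (hd i) (hd j)
      rw [h3] at h5
      have h6 : i - j = (i + c) - (j + c) := by ring
      rw [h6]
      rwa [sub_sub_sub_cancel_right] at h5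
    · intro h
      have : (i + c) % ((L + 1 : ℕ) : ℤ) = (j + c) % ((L + 1 : ℕ) : ℤ) := by
        apply Int.emod_emod_of_dvd _ (dvd_refl _) |>.symm.trans
        rw [Int.emod_emod_of_dvd _ (dvd_refl _)]
        apply Int.emod_eq_emod_iff_emod_sub_eq_zero.2
        apply Int.emod_eq_zero_of_dvd
        convert h using 1
        ring
      simp only [this]
  · intro w
    obtain ⟨i, hi, rfl⟩ := hsurj w
    by_cases hic : c ≤ i
    · refine ⟨i - c, by omega, by omega, ?_⟩
      have : ((i : ℤ) - c + c) % ((L + 1 : ℕ) : ℤ) = i := by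
        rw [sub_add_cancel]; exact Int.emod_eq_of_lt (by omega) (by omega)
      simp only [this, Int.toNat_natCast]
    · refine ⟨i - c + (L + 1 : ℕ), by omega, by omega, ?_⟩
      have : ((i : ℤ) - c + (L + 1 : ℕ) + c) % ((L + 1 : ℕ) : ℤ) = i := by
        have e1 : ((i : ℤ) - c + (L + 1 : ℕ) + c) = i + (L + 1 : ℕ) := by ring
        rw [e1, Int.add_emod_right]; exact Int.emod_eq_of_lt (by omega) (by omega)
      simp only [this, Int.toNat_natCast]
  · intro i j hA
    have h1 := hb i
    have h2 := hb j
    have h3 := hd i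
    have h4 := hd j
    have key : ∀ s t : ℤ, ((L + 1 : ℕ) : ℤ) ∣ (s + c) - (s + c) % ((L + 1 : ℕ) : ℤ) →
        ((L + 1 : ℕ) : ℤ) ∣ (t + c) - (t + c) % ((L + 1 : ℕ) : ℤ) →
        ((t + c) % ((L + 1 : ℕ) : ℤ) = (s + c) % ((L + 1 : ℕ) : ℤ) + 1 ∨
        ((s + c) % ((L + 1 : ℕ) : ℤ) = (t + c) % ((L + 1 : ℕ) : ℤ) + L)) →
        ((L + 1 : ℕ) : ℤ) ∣ t - s - 1 := by
      rintro s t ⟨x, hx⟩ ⟨y, hy⟩ (h | h)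
      · refine ⟨y - x, ?_⟩
        rw [mul_sub]; omega
      · refine ⟨y - x - 1, ?_⟩
        rw [mul_sub, mul_sub]; omega
    have hne := hA.ne
    rcases lt_trichotomy ((i + c) % ((L + 1 : ℕ) : ℤ)).toNat
      ((j + c) % ((L + 1 : ℕ) : ℤ)).toNat with hlt | heq | hlt
    · rcases hadj _ _ hlt (by omega) hA with h | h
      · exact Or.inl (key i j h3 h4 (by omega))
      · exact Or.inr (key j i h4 h3 (by omega))
    · exact (hne (by simp only [heq])).elim
    · rcases hadj _ _ hlt (by omega) hA.symm with h | h
      · exact Or.inr (key j i h4 h3 (by omega))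
      · exact Or.inl (key i j h3 h4 (by omega))

/-- A reachable empty vertex has a reachable neighbour. -/
theorem reach_neighbor {V : Type*} [DecidableEq V] (G : SimpleGraph V) (P : V → ℕ) (u : V)
    (hPu : P u = 0) (hr : Reachable' G P u) : ∃ y, G.Adj y u ∧ Reachable' G P y := by
  by_contra! hcon
  obtain ⟨q, hq, hq1⟩ := (reachable_iff G P u).1 hr
  have : q u = 0 := by
    clear hq1
    induction hq with
    | refl => exact hPu
    | tail hpre hs ih =>
      rename_i b c
      obtain ⟨⟨s, t⟩, h1, h2, rfl⟩ := hs
      simp only at h1 h2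
      have hs : u ≠ s := by rintro rfl; omega
      have ht : u ≠ t := by
        rintro rfl
        exact hcon s h1 ((reachable_iff G P s).2 ⟨b, hpre, by omega⟩)
      simp [applyMove, hs, ht, ih]
  omega

/-- On a connected graph with maximum degree at most 2 (a path or a cycle),
for `U` a unit with at least two pebbles and `P u = 0`, `coop(P,U) ≤ DC(P,U)`. -/
theorem stmt7 {V : Type*} [Fintype V] [DecidableEq V] (G : SimpleGraph V)
    [DecidableRel G.Adj] (hconn : G.Connected) (hdeg : ∀ v, G.degree v ≤ 2)
    (P : V → ℕ) (u : V) (b : ℕ) (hb : 2 ≤ b)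
    (U : V → ℕ) (hU : U = fun w => if w = u then b else 0) (hPu : P u = 0) :
    coop G P U ≤ DC G P U := by
  obtain ⟨n, e, hcyc⟩ := exists_cyc G hconn hdeg u
  have hU0 : ∀ w, w ≠ u → U w = 0 := fun w hw => by simp [hU, hw]
  have hUu : U u = b := by simp [hU]
  have hself : ∀ (p : V → ℕ) w, 1 ≤ p w → Reachable' G p w :=
    fun p w hw => ⟨[], trivial, hw⟩
  have hru : Reachable' G U u := hself U u (by omega)
  have hrn : ∀ y, G.Adj y u → Reachable' G U y := fun y hy =>
    ⟨[⟨u, y⟩], ⟨hy.symm, by simp; omega, trivial⟩, by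
      simp [applySeq, applyMove, hy.ne]⟩
  unfold coop DC
  set C := {v | Reachable' G (P + U) v ∧ ¬ Reachable' G P v ∧ ¬ Reachable' G U v}
  set D := {v | Reachable' G P v ∧ Reachable' G U v}
  have hone : ∀ x, x ∈ D → 1 ≤ D.ncard := fun x hx =>
    (Set.ncard_pos (Set.toFinite D)).2 ⟨x, hx⟩
  have htwo : ∀ x y, x ∈ D → y ∈ D → x ≠ y → 2 ≤ D.ncard := fun x y hx hy hxy =>
    (Set.one_lt_ncard (Set.toFinite D)).2 ⟨x, hx, y, hy, hxy⟩
  let A : Set V := {v | v ∈ C ∧ CW G e n (P + U) v}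
  let B : Set V := {v | v ∈ C ∧ CW G (fun i => e (-i)) n (P + U) v}
  have hCAB : C ⊆ A ∪ B := by
    intro v hv
    have hvu : v ≠ u := by rintro rfl; exact hv.2.2 hru
    have hz : (P + U) v = 0 := by
      have h1 : ¬ 1 ≤ P v := fun h => hv.2.1 (hself P v h)
      have h2 := hU0 v hvu
      simp only [Pi.add_apply]; omega
    rcases hcyc.complete (P + U) v hvu hz hv.1 with h | h
    · exact Or.inl ⟨hv, h⟩
    · exact Or.inr ⟨hv, h⟩
  have hA1 : A.ncard ≤ 1 := (Set.ncard_le_one (Set.toFinite A)).2 fun v hv w hw =>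
    hcyc.uniq P U hU0 v w hv.1.2.1 hv.1.2.2 hv.2 hw.1.2.1 hw.1.2.2 hw.2
  have hB1 : B.ncard ≤ 1 := (Set.ncard_le_one (Set.toFinite B)).2 fun v hv w hw =>
    hcyc.neg.uniq P U hU0 v w hv.1.2.1 hv.1.2.2 hv.2 hw.1.2.1 hw.1.2.2 hw.2
  have hle : C.ncard ≤ A.ncard + B.ncard :=
    (Set.ncard_le_ncard hCAB (Set.toFinite _)).trans (Set.ncard_union_le A B)
  rcases A.eq_empty_or_nonempty with hA | ⟨v, hv⟩
  · rcases B.eq_empty_or_nonempty with hB | ⟨w, hw⟩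
    · rw [hA, hB] at hle
      simp at hle
      omega
    · obtain ⟨i, -, h1, h2⟩ := hcyc.neg.dc P U hU0 w hw.1.2.1 hw.1.2.2 hw.2
      have := hone _ ⟨h1, h2 i le_rfl⟩
      rw [hA, Set.ncard_empty] at hle
      omega
  · obtain ⟨i, hin, h1, h2⟩ := hcyc.dc P U hU0 v hv.1.2.1 hv.1.2.2 hv.2
    rcases B.eq_empty_or_nonempty with hB | ⟨w, hw⟩
    · have := hone _ ⟨h1, h2 i le_rfl⟩
      rw [hB, Set.ncard_empty] at hle
      omega
    · obtain ⟨j, hjn, h3, h4⟩ := hcyc.neg.dc P U hU0 w hw.1.2.1 hw.1.2.2 hw.2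
      suffices 2 ≤ D.ncard by omega
      by_cases hij : e i = e (-j)
      · by_cases hi : i = 0
        · subst hi
          have h5 : e ((0 : ℕ) : ℤ) = u := by simpa using hcyc.zero
          rw [h5] at h1
          obtain ⟨y, hy, hyr⟩ := reach_neighbor G P u hPu h1
          exact htwo u y ⟨h1, hru⟩ ⟨hyr, hrn y hy⟩ hy.ne'
        · exfalso
          have hd := (hcyc.eq_iff _ _).1 hij
          have hd2 := dvd_sub hd (dvd_refl (n : ℤ))
          have h6 := dvd_small hd2 (by omega) (by omega)
          obtain ⟨k, k0, k1, rfl⟩ := hcyc.surj v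
          by_cases hki : k ≤ i
          · have := h2 k.toNat (by omega)
            rw [Int.toNat_of_nonneg k0] at this
            exact hv.1.2.2 this
          · have := h4 (n - k).toNat (by omega)
            have h7 : e (-((n - k).toNat : ℤ)) = e k := by
              rw [hcyc.eq_iff]; exact ⟨-1, by omega⟩
            rw [h7] at this
            exact hv.1.2.2 this
      · exact htwo _ _ ⟨h1, h2 i le_rfl⟩ ⟨h3, h4 j le_rfl⟩ hij
end

section
/- Key Lemma: Let G be a graph with maximum degree Δ, P a pebble distribution, and U a unit distribution with |U| ≥ 2 placed on a vertex u with P(u)=0. Then coop(P,U) − DC(P,U) ≤ (Δ−2)·CE(P,U). -/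
open Finset

namespace Peb

set_option linter.unusedSectionVars false

section basics
variable {V : Type*} [DecidableEq V] {G : SimpleGraph V}

theorem applyMove_add (p r : V → ℕ) (m : PMove V) (h : 2 ≤ p m.src) :
    applyMove (p + r) m = applyMove p m + r := by
  funext w
  simp only [applyMove, Pi.add_apply]
  split_ifs with h1 h2
  · subst h1; omega
  · omega
  · rfl

theorem exec_add {p : V → ℕ} (r : V → ℕ) {σ : List (PMove V)} (h : Executable G p σ) :
    Executable G (p + r) σ ∧ applySeq (p + r) σ = applySeq p σ + r := by
  induction σ generalizing p with
  | nil => exact ⟨trivial, rfl⟩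
  | cons m ms ih =>
    obtain ⟨h1, h2, h3⟩ := h
    have := ih h3
    rw [← applyMove_add p r m h2] at this
    exact ⟨⟨h1, by simp only [Pi.add_apply]; omega, this.1⟩, this.2⟩

theorem applySeq_append (p : V → ℕ) (σ τ : List (PMove V)) :
    applySeq p (σ ++ τ) = applySeq (applySeq p σ) τ := by
  simp [applySeq, List.foldl_append]

theorem exec_append {p : V → ℕ} {σ τ : List (PMove V)} :
    Executable G p (σ ++ τ) ↔ Executable G p σ ∧ Executable G (applySeq p σ) τ := by
  induction σ generalizing p with
  | nil => simp [Executable, applySeq]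
  | cons m ms ih =>
    simp only [List.cons_append, Executable, ih, applySeq, List.foldl_cons]
    tauto

theorem exec_mono {p q : V → ℕ} (hpq : p ≤ q) {σ : List (PMove V)} (h : Executable G p σ) :
    Executable G q σ ∧ applySeq p σ ≤ applySeq q σ := by
  have e : q = p + (q - p) := by funext v; have : p v ≤ q v := hpq v; simp; omega
  have := exec_add (q - p) h
  rw [← e] at this
  refine ⟨this.1, ?_⟩
  rw [this.2]
  intro v; simp

theorem kr_trans {p q : V → ℕ} {σ : List (PMove V)} (h : Executable G p σ)
    (hq : q ≤ applySeq p σ) {k : ℕ} {v : V} (hk : KReachable G q k v) : KReachable G p k v := by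
  obtain ⟨τ, h1, h2⟩ := hk
  have := exec_mono hq h1
  exact ⟨σ ++ τ, exec_append.2 ⟨h, this.1⟩, by
    rw [applySeq_append]; exact h2.trans (this.2 v)⟩

theorem kr_mono {p q : V → ℕ} (hpq : p ≤ q) {k : ℕ} {v : V} (hk : KReachable G p k v) :
    KReachable G q k v := kr_trans (σ := []) trivial hpq hk

theorem kr_le {p : V → ℕ} {k l : ℕ} (hkl : k ≤ l) {v : V} (hk : KReachable G p l v) :
    KReachable G p k v := by
  obtain ⟨τ, h1, h2⟩ := hk
  exact ⟨τ, h1, hkl.trans h2⟩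

theorem applyMove_pt (p : V → ℕ) (m : PMove V) (hne : m.src ≠ m.tgt) (h : 2 ≤ p m.src) (v : V) :
    applyMove p m v + (if v = m.src then 2 else 0) = p v + (if v = m.tgt then 1 else 0) := by
  simp only [applyMove]
  split_ifs with h1 h2
  · exact absurd (h1.symm.trans h2) hne
  · subst h1; omega
  · rfl
  · rfl

theorem sender_early {p : V → ℕ} {σ : List (PMove V)} (h : Executable G p σ) {m : PMove V}
    (hm : m ∈ σ) : ∃ σ₁, Executable G p σ₁ ∧ 2 ≤ applySeq p σ₁ m.src ∧ σ₁.length < σ.length ∧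
      (∀ m' ∈ σ₁, m' ∈ σ) ∧ G.Adj m.src m.tgt := by
  obtain ⟨s, t, rfl⟩ := List.append_of_mem hm
  obtain ⟨h1, h2, h3, h4⟩ := exec_append.1 h
  exact ⟨s, h1, h3, by simp, fun m' hm' => by simp [hm'], h2⟩

theorem loss {p q : V → ℕ} {y : V} {σ : List (PMove V)} (h : Executable G p σ)
    (hpq : ∀ v, p v ≤ q v + if v = y then 1 else 0) :
    ∃ σ' y', Executable G q σ' ∧ σ'.length ≤ σ.length ∧
      ∀ v, applySeq p σ v ≤ applySeq q σ' v + if v = y' then 1 else 0 := by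
  induction σ generalizing p q y with
  | nil => exact ⟨[], y, trivial, le_rfl, hpq⟩
  | cons m ms ih =>
    obtain ⟨h1, h2, h3⟩ := h
    by_cases hq : 2 ≤ q m.src
    · have : ∀ v, applyMove p m v ≤ applyMove q m v + if v = y then 1 else 0 := by
        intro v
        have a := applyMove_pt p m h1.ne h2 v
        have b := applyMove_pt q m h1.ne hq v
        have c := hpq v
        omega
      obtain ⟨σ', y', a, b, c⟩ := ih h3 this
      exact ⟨m :: σ', y', ⟨h1, hq, a⟩, by simpa using b, c⟩
    · have : ∀ v, applyMove p m v ≤ q v + if v = m.tgt then 1 else 0 := by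
        intro v
        have a := applyMove_pt p m h1.ne h2 v
        have c := hpq v
        have d := hpq m.src
        by_cases e : v = m.src
        · rw [e] at a ⊢
          rw [if_pos rfl, if_neg h1.ne] at a
          split_ifs at d ⊢ <;> omega
        · have : v ≠ y := by
            rintro rfl
            have : m.src ≠ v := Ne.symm e
            simp [this] at d; omega
          simp [e, this] at *
          omega
      obtain ⟨σ', y', a, b, c⟩ := ih h3 this
      exact ⟨σ', y', a, by simp; omega, c⟩

/-- the target need not send pebbles. -/
theorem no_send {p : V → ℕ} {k : ℕ} {u : V} : ∀ (n : ℕ) (σ : List (PMove V)), σ.length ≤ n →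
    Executable G p σ → k ≤ applySeq p σ u →
    ∃ σ', Executable G p σ' ∧ k ≤ applySeq p σ' u ∧ ∀ m ∈ σ', m.src ≠ u := by
  intro n
  induction n with
  | zero =>
    intro σ hl h hk
    have : σ = [] := List.eq_nil_of_length_eq_zero (by omega)
    subst this
    exact ⟨[], h, hk, by simp⟩
  | succ n ih =>
    intro σ hl h hk
    by_cases hs : ∀ m ∈ σ, m.src ≠ u
    · exact ⟨σ, h, hk, hs⟩
    push Not at hs
    obtain ⟨m, hm, hmu⟩ := hs
    obtain ⟨s, t, rfl⟩ := List.append_of_mem hm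
    obtain ⟨h1, h2, h3, h4⟩ := exec_append.1 h
    set p1 := applySeq p s with hp1
    let q : V → ℕ := fun v => p1 v - if v = u then 2 else 0
    have hq : ∀ v, applyMove p1 m v ≤ q v + if v = m.tgt then 1 else 0 := by
      intro v
      have a := applyMove_pt p1 m h2.ne h3 v
      simp only [q, ← hmu]
      split_ifs at * <;> omega
    obtain ⟨t', y', a, b, c⟩ := loss h4 hq
    let r : V → ℕ := fun v => if v = u then 2 else 0
    have hqr : q + r = p1 := by
      funext v
      simp only [q, r, Pi.add_apply]
      split_ifs with hv
      · subst hv; subst hmu; omega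
      · rfl
    have := exec_add r a
    rw [hqr] at this
    apply ih (s ++ t')
    · simp at hl ⊢; omega
    · exact exec_append.2 ⟨h1, this.1⟩
    · rw [applySeq_append, ← hp1, this.2]
      have c' := c u
      have hk' : k ≤ applySeq (applyMove p1 m) t u := by
        rw [applySeq_append] at hk; exact hk
      simp only [Pi.add_apply, r, if_true]
      split_ifs at c' <;> omega

theorem exec_congr_src {p q : V → ℕ} {u : V} (hpq : ∀ v, v ≠ u → p v = q v)
    {σ : List (PMove V)} (hs : ∀ m ∈ σ, m.src ≠ u) (h : Executable G p σ) :
    Executable G q σ ∧ applySeq p σ u + q u = applySeq q σ u + p u := by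
  induction σ generalizing p q with
  | nil => exact ⟨trivial, by simp [applySeq]; omega⟩
  | cons m ms ih =>
    obtain ⟨h1, h2, h3⟩ := h
    have hmu := hs m (by simp)
    have e : ∀ v, v ≠ u → applyMove p m v = applyMove q m v := by
      intro v hv; simp [applyMove, hpq v hv]
    obtain ⟨a, b⟩ := ih e (fun m' hm' => hs m' (by simp [hm'])) h3
    have hu1 := applyMove_pt p m h1.ne h2 u
    have hq2 : 2 ≤ q m.src := by rw [← hpq _ hmu]; exact h2
    have hu2 := applyMove_pt q m h1.ne hq2 u
    refine ⟨⟨h1, hq2, a⟩, ?_⟩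
    change applySeq (applyMove p m) ms u + q u = applySeq (applyMove q m) ms u + p u
    omega

/-- pure decomposition of a sequence when no sender is reachable under both parts. -/
theorem purity {σ : List (PMove V)} {p q : V → ℕ} (h : Executable G (p + q) σ)
    (hs : ∀ m ∈ σ, ¬ (Reachable' G p m.src ∧ Reachable' G q m.src)) :
    ∃ σ₁ σ₂, Executable G p σ₁ ∧ Executable G q σ₂ ∧
      applySeq (p + q) σ = applySeq p σ₁ + applySeq q σ₂ := by
  induction σ generalizing p q with
  | nil => exact ⟨[], [], trivial, trivial, rfl⟩
  | cons m ms ih =>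
    obtain ⟨h1, h2, h3⟩ := h
    have hm := hs m (by simp)
    have key : 2 ≤ p m.src ∨ 2 ≤ q m.src := by
      by_contra hc
      push Not at hc
      simp only [Pi.add_apply] at h2
      exact hm ⟨⟨[], trivial, by simp [applySeq]; omega⟩, ⟨[], trivial, by simp [applySeq]; omega⟩⟩
    rcases key with hp | hq
    · have e := applyMove_add p q m hp
      rw [e] at h3
      obtain ⟨s1, s2, a, b, c⟩ := ih h3 (fun m' hm' hh => hs m' (by simp [hm'])
        ⟨kr_trans (σ := [m]) ⟨h1, hp, trivial⟩ le_rfl hh.1, hh.2⟩)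
      refine ⟨m :: s1, s2, ⟨h1, hp, a⟩, b, ?_⟩
      change applySeq (applyMove (p+q) m) ms = _
      rw [e, c]; rfl
    · have e := applyMove_add q p m hq
      have e' : applyMove (p + q) m = p + applyMove q m := by rw [add_comm p q, e, add_comm]
      rw [e'] at h3
      obtain ⟨s1, s2, a, b, c⟩ := ih h3 (fun m' hm' hh => hs m' (by simp [hm'])
        ⟨hh.1, kr_trans (σ := [m]) ⟨h1, hq, trivial⟩ le_rfl hh.2⟩)
      refine ⟨s1, m :: s2, a, ⟨h1, hq, b⟩, ?_⟩
      change applySeq (applyMove (p+q) m) ms = _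
      rw [e', c]; rfl

end basics

section flows
variable {V : Type*} [Fintype V] [DecidableEq V] {G : SimpleGraph V}

theorem sum_applySeq {p : V → ℕ} {σ : List (PMove V)} (h : Executable G p σ) :
    ∑ v, applySeq p σ v ≤ ∑ v, p v := by
  induction σ generalizing p with
  | nil => exact le_rfl
  | cons m ms ih =>
    obtain ⟨h1, h2, h3⟩ := h
    refine (ih h3).trans ?_
    have := Finset.sum_congr rfl (fun v (_ : v ∈ Finset.univ) => applyMove_pt p m h1.ne h2 v)
    simp only [Finset.sum_add_distrib, Finset.sum_ite_eq', Finset.mem_univ, if_true] at this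
    omega

theorem kr_iff {p : V → ℕ} {k : ℕ} {v : V} : KReachable G p k v ↔ k ≤ reach G p v := by
  have hb : BddAbove {k | KReachable G p k v} := by
    refine ⟨∑ v, p v, ?_⟩
    rintro k ⟨σ, h1, h2⟩
    exact h2.trans ((Finset.single_le_sum (f := applySeq p σ) (fun _ _ => Nat.zero_le _)
      (Finset.mem_univ v)).trans (sum_applySeq h1))
  have hn : {k | KReachable G p k v}.Nonempty := ⟨0, [], trivial, Nat.zero_le _⟩
  constructor
  · intro h; exact le_csSup hb h
  · intro h
    have : KReachable G p (reach G p v) v := Nat.sSup_mem hn hb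
    exact kr_le h this

theorem reach_iff {p : V → ℕ} {v : V} : Reachable' G p v ↔ 1 ≤ reach G p v := kr_iff

theorem le_reach {p : V → ℕ} {σ : List (PMove V)} (h : Executable G p σ) (v : V) :
    applySeq p σ v ≤ reach G p v := kr_iff.1 ⟨σ, h, le_rfl⟩

theorem self_le_reach (p : V → ℕ) (v : V) : p v ≤ reach G p v :=
  le_reach (G := G) (p := p) (σ := []) trivial v

theorem exists_reach (G : SimpleGraph V) (p : V → ℕ) (v : V) :
    ∃ σ, Executable G p σ ∧ reach G p v ≤ applySeq p σ v := kr_iff.2 le_rfl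

theorem reach_mono {p q : V → ℕ} (h : p ≤ q) (v : V) : reach G p v ≤ reach G q v :=
  kr_iff.1 (kr_mono h (kr_iff.2 le_rfl))

theorem reach_super (p q : V → ℕ) (v : V) :
    reach G p v + reach G q v ≤ reach G (p + q) v := by
  obtain ⟨s, h1, h2⟩ := exists_reach G p v
  obtain ⟨t, h3, h4⟩ := exists_reach G q v
  have a := exec_add q h1
  have b := exec_add (applySeq p s) h3
  have := le_reach (G := G) (p := p + q) (σ := s ++ t) (exec_append.2 ⟨a.1, by
    rw [a.2, add_comm]; exact b.1⟩) v
  rw [applySeq_append, a.2, add_comm (applySeq p s), b.2] at this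
  simp only [Pi.add_apply] at this
  omega

/-- inflow and outflow of a matrix of moves -/
def fin' (M : V → V → ℕ) (v : V) : ℕ := ∑ a, M a v
def fout (M : V → V → ℕ) (v : V) : ℕ := ∑ b, M v b

theorem sum_fin (M : V → V → ℕ) : ∑ v, fin' M v = ∑ v, fout M v := Finset.sum_comm

theorem le_fout (M : V → V → ℕ) (a b : V) : M a b ≤ fout M a :=
  Finset.single_le_sum (f := fun b => M a b) (fun _ _ => Nat.zero_le _) (Finset.mem_univ b)
theorem le_fin (M : V → V → ℕ) (a b : V) : M a b ≤ fin' M b :=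
  Finset.single_le_sum (f := fun a => M a b) (fun _ _ => Nat.zero_le _) (Finset.mem_univ a)

def unitM (s t : V) (k : ℕ) : V → V → ℕ := fun a b => if a = s ∧ b = t then k else 0

theorem fin_unit (s t : V) (k : ℕ) (v : V) : fin' (unitM s t k) v = if v = t then k else 0 := by
  simp only [fin', unitM, ite_and]
  simp
theorem fout_unit (s t : V) (k : ℕ) (v : V) : fout (unitM s t k) v = if v = s then k else 0 := by
  simp only [fout, unitM, ite_and]
  split_ifs <;> simp
theorem fin_add (M N : V → V → ℕ) (v : V) : fin' (M + N) v = fin' M v + fin' N v := by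
  simp [fin', Finset.sum_add_distrib]
theorem fout_add (M N : V → V → ℕ) (v : V) : fout (M + N) v = fout M v + fout N v := by
  simp [fout, Finset.sum_add_distrib]

/-- order-free version of executability (no-cycle lemma) -/
theorem flow_exec : ∀ (n : ℕ) (p : V → ℕ) (M : V → V → ℕ), ∑ v, fout M v = n →
    (∀ a b, 0 < M a b → G.Adj a b) → (∀ v, 2 * fout M v ≤ p v + fin' M v) →
    ∃ σ, Executable G p σ ∧ (∀ m ∈ σ, 0 < M m.src m.tgt) ∧
      ∀ v, p v + fin' M v ≤ applySeq p σ v + 2 * fout M v := by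
  intro n
  induction n with
  | zero =>
    intro p M hn hs hb
    refine ⟨[], trivial, by simp, ?_⟩
    have h1 := sum_fin M
    rw [hn] at h1
    intro v
    have := (Finset.sum_eq_zero_iff.1 h1) v (Finset.mem_univ v)
    simp [applySeq]; omega
  | succ n ih =>
    intro p M hn hs hb
    by_cases hc : ∃ s t, 0 < M s t ∧ 2 ≤ p s
    · obtain ⟨s, t, hst, hp⟩ := hc
      have hadj := hs s t hst
      obtain ⟨M', hM'⟩ : ∃ M', M = M' + unitM s t 1 := by
        refine ⟨fun a b => M a b - unitM s t 1 a b, ?_⟩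
        funext a b
        simp only [unitM, Pi.add_apply]
        split_ifs with h
        · obtain ⟨rfl, rfl⟩ := h; omega
        · rfl
      have ho : ∀ v, fout M v = fout M' v + if v = s then 1 else 0 := by
        intro v; rw [hM', fout_add, fout_unit]
      have hi : ∀ v, fin' M v = fin' M' v + if v = t then 1 else 0 := by
        intro v; rw [hM', fin_add, fin_unit]
      have hle : ∀ a b, 0 < M' a b → 0 < M a b := by
        intro a b h; rw [hM']; simp only [Pi.add_apply]; omega
      have hpt := applyMove_pt p ⟨s, t⟩ hadj.ne hp
      obtain ⟨σ, a, b, c⟩ := ih (applyMove p ⟨s, t⟩) M' (by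
          have : ∑ v, fout M v = ∑ v, (fout M' v + if v = s then 1 else 0) :=
            Finset.sum_congr rfl (fun v _ => ho v)
          rw [Finset.sum_add_distrib] at this
          simp at this; omega) (fun a b h => hs a b (hle a b h)) (by
          intro v
          have := hpt v
          have := hb v
          have := ho v
          have := hi v
          simp only at *
          split_ifs at * <;> omega)
      refine ⟨⟨s, t⟩ :: σ, ⟨hadj, hp, a⟩, ?_, ?_⟩
      · intro m hm
        rcases List.mem_cons.1 hm with rfl | hm
        · exact hst
        · exact hle _ _ (b m hm)
      · intro v
        have := hpt v
        have := ho v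
        have := hi v
        have := c v
        change _ ≤ applySeq (applyMove p ⟨s, t⟩) σ v + _
        simp only at *
        split_ifs at * <;> omega
    · refine ⟨[], trivial, by simp, ?_⟩
      have hle : ∀ v ∈ Finset.univ, fout M v ≤ fin' M v := by
        intro v _
        rcases Nat.eq_zero_or_pos (fout M v) with h0 | h0
        · omega
        · obtain ⟨t, _, ht⟩ := Finset.sum_pos_iff.1 (show 0 < ∑ b, M v b from h0)
          have hp : ¬ 2 ≤ p v := fun hp => hc ⟨v, t, ht, hp⟩
          have := hb v
          omega
      have heq := (Finset.sum_eq_sum_iff_of_le hle).1 (sum_fin M).symm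
      intro v
      have := heq v (Finset.mem_univ v)
      simp [applySeq]; omega

theorem flow_reach {p : V → ℕ} {M : V → V → ℕ} (hs : ∀ a b, 0 < M a b → G.Adj a b)
    (hb : ∀ v, 2 * fout M v ≤ p v + fin' M v) (v : V) :
    p v + fin' M v ≤ reach G p v + 2 * fout M v := by
  obtain ⟨σ, a, _, c⟩ := flow_exec _ p M rfl hs hb
  have := c v
  have := le_reach a v
  omega

theorem exec_flow {p : V → ℕ} {σ : List (PMove V)} (h : Executable G p σ) :
    ∃ M : V → V → ℕ, (∀ a b, 0 < M a b → (⟨a, b⟩ : PMove V) ∈ σ) ∧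
      (∀ v, p v + fin' M v = applySeq p σ v + 2 * fout M v) := by
  induction σ generalizing p with
  | nil => exact ⟨fun _ _ => 0, by simp, by simp [fin', fout, applySeq]⟩
  | cons m ms ih =>
    obtain ⟨h1, h2, h3⟩ := h
    obtain ⟨M, a, b⟩ := ih h3
    refine ⟨M + unitM m.src m.tgt 1, ?_, ?_⟩
    · intro x y hxy
      simp only [Pi.add_apply, unitM] at hxy
      split_ifs at hxy with hh
      · obtain ⟨rfl, rfl⟩ := hh; simp
      · exact List.mem_cons_of_mem _ (a x y (by omega))
    · intro v
      rw [fin_add, fout_add, fin_unit, fout_unit]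
      have := b v
      have := applyMove_pt p m h1.ne h2 v
      change _ = applySeq (applyMove p m) ms v + _
      split_ifs at * <;> omega

/-- antisymmetric version -/
theorem exec_flow' {p : V → ℕ} {σ : List (PMove V)} (h : Executable G p σ) :
    ∃ M : V → V → ℕ, (∀ a b, 0 < M a b → (⟨a, b⟩ : PMove V) ∈ σ) ∧
      (∀ a b, M a b = 0 ∨ M b a = 0) ∧
      (∀ v, applySeq p σ v + 2 * fout M v ≤ p v + fin' M v) := by
  obtain ⟨M, a, b⟩ := exec_flow h
  refine ⟨fun x y => M x y - M y x, fun x y hxy => a x y (by simp only at hxy; omega),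
    fun x y => by simp only; omega, ?_⟩
  intro v
  have e1 : fin' M v = fin' (fun x y => M x y - M y x) v + ∑ x, min (M x v) (M v x) := by
    simp only [fin', ← Finset.sum_add_distrib]
    refine Finset.sum_congr rfl fun x _ => ?_
    omega
  have e2 : fout M v = fout (fun x y => M x y - M y x) v + ∑ x, min (M x v) (M v x) := by
    simp only [fout, ← Finset.sum_add_distrib]
    refine Finset.sum_congr rfl fun x _ => ?_
    omega
  have := b v
  omega

theorem exec_adj {p : V → ℕ} {σ : List (PMove V)} (h : Executable G p σ) {a b : V}
    (hm : (⟨a, b⟩ : PMove V) ∈ σ) : G.Adj a b ∧ 2 ≤ reach G p a := by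
  obtain ⟨s, h1, h2, _, _, h5⟩ := sender_early h hm
  exact ⟨h5, h2.trans (le_reach h1 a)⟩

/-- move pebbles along an edge -/
theorem reach_edge {p : V → ℕ} {a b : V} (h : G.Adj a b) {m : ℕ} (hm : 2 * m ≤ reach G p a) :
    m ≤ reach G p b := by
  obtain ⟨σ, h1, h2⟩ := exists_reach G p a
  have := flow_reach (G := G) (p := applySeq p σ) (M := unitM a b m) (by
    intro x y hxy
    simp only [unitM] at hxy
    split_ifs at hxy with hh
    · rw [hh.1, hh.2]; exact h
    · omega) (by
    intro v
    rw [fin_unit, fout_unit]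
    split_ifs with e1 e2 <;> (try subst e1) <;> omega) b
  rw [fin_unit, fout_unit, if_pos rfl, if_neg h.ne'] at this
  exact kr_iff.1 (kr_trans h1 le_rfl (kr_iff.2 (by omega)))

end flows

section core
variable {V : Type*} [Fintype V] [DecidableEq V]

open Classical in
/-- restriction of a flow to sources in `S` -/
noncomputable def res (S : V → Prop) (M : V → V → ℕ) : V → V → ℕ :=
  fun a b => if S a then M a b else 0

theorem res_le (S : V → Prop) (M : V → V → ℕ) (a b : V) : res S M a b ≤ M a b := by
  unfold res; split_ifs <;> omega

theorem fout_res_pos {S : V → Prop} {M : V → V → ℕ} {v : V} (h : S v) :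
    fout (res S M) v = fout M v := by simp [fout, res, h]

theorem fout_res_neg {S : V → Prop} {M : V → V → ℕ} {v : V} (h : ¬ S v) :
    fout (res S M) v = 0 := by simp [fout, res, h]

theorem fin_res_eq {S : V → Prop} {M : V → V → ℕ} {v : V} (h : ∀ a, ¬ S a → M a v = 0) :
    fin' (res S M) v = fin' M v := by
  unfold fin' res
  refine Finset.sum_congr rfl fun a _ => ?_
  split_ifs with ha
  · rfl
  · exact (h a ha).symm

/-- delete the moves `x → w` -/
def del (x w : V) (M : V → V → ℕ) : V → V → ℕ :=
  fun a b => if a = x ∧ b = w then 0 else M a b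

theorem del_add (x w : V) (M : V → V → ℕ) : M = del x w M + unitM x w (M x w) := by
  funext a b
  simp only [del, unitM, Pi.add_apply]
  split_ifs with h
  · rw [h.1, h.2]; omega
  · omega

theorem fout_del (x w : V) (M : V → V → ℕ) (v : V) :
    fout M v = fout (del x w M) v + if v = x then M x w else 0 := by
  conv_lhs => rw [del_add x w M]
  rw [fout_add, fout_unit]

theorem fin_del (x w : V) (M : V → V → ℕ) (v : V) :
    fin' M v = fin' (del x w M) v + if v = w then M x w else 0 := by
  conv_lhs => rw [del_add x w M]
  rw [fin_add, fin_unit]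

theorem del_le (x w : V) (M : V → V → ℕ) (a b : V) : del x w M a b ≤ M a b := by
  unfold del; split_ifs <;> omega

variable (G : SimpleGraph V) (P U : V → ℕ)

def isC (v : V) : Prop := 1 ≤ reach G (P + U) v ∧ reach G P v = 0 ∧ reach G U v = 0
def isD (v : V) : Prop := 1 ≤ reach G P v ∧ 1 ≤ reach G U v
noncomputable def cc (v : V) : ℕ :=
  (reach G (P + U) v - 1) - (reach G P v - 1) - (reach G U v - 1)
def isW (v : V) : Prop := 1 ≤ cc G P U v
def isN (v : V) : Prop := isW G P U v ∧ ¬ isC G P U v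

variable {G P U}

theorem isD.isW {v : V} (h : isD G P U v) : isW G P U v := by
  have := reach_super (G := G) P U v
  unfold Peb.isW cc
  obtain ⟨h1, h2⟩ := h
  omega

theorem isD.notC {v : V} (h : isD G P U v) : ¬ isC G P U v := by
  rintro ⟨_, h2, _⟩
  have := h.1
  omega

theorem isW.gt {v : V} (h : isW G P U v) : max (reach G P v) (reach G U v) < reach G (P + U) v := by
  unfold isW cc at h
  omega

theorem isC.isW {v : V} (h : isC G P U v) (h2 : 2 ≤ reach G (P + U) v) : isW G P U v := by
  unfold Peb.isW cc
  obtain ⟨_, h3, h4⟩ := h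
  omega

theorem notWC {v : V} (h : ¬ isW G P U v) (hC : ¬ isC G P U v) (h2 : 1 ≤ reach G (P + U) v) :
    (reach G P v = reach G (P + U) v ∧ reach G U v = 0) ∨
    (reach G U v = reach G (P + U) v ∧ reach G P v = 0) := by
  have := reach_super (G := G) P U v
  unfold isW cc at h
  unfold isC at hC
  omega

/-- no moves enter `K`: then only the pebbles of `P` matter -/
theorem noentry {K : V → Prop} {p : V → ℕ} {M : V → V → ℕ} (hpK : ∀ v, K v → p v = P v)
    (hs : ∀ a b, 0 < M a b → G.Adj a b) (hb : ∀ v, 2 * fout M v ≤ p v + fin' M v)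
    (hent : ∀ s t, ¬ K s → K t → M s t = 0) :
    (∀ v, 2 * fout (res K M) v ≤ P v + fin' (res K M) v) ∧
    ∀ y, K y → p y + fin' M y ≤ reach G P y + 2 * fout M y := by
  have hb' : ∀ v, 2 * fout (res K M) v ≤ P v + fin' (res K M) v := by
    intro v
    by_cases hv : K v
    · rw [fout_res_pos hv, fin_res_eq (fun a ha => hent a v ha hv), ← hpK v hv]
      exact hb v
    · rw [fout_res_neg hv]; omega
  refine ⟨hb', fun y hy => ?_⟩
  have := flow_reach (G := G) (M := res K M)
    (fun a b h => hs a b (lt_of_lt_of_le h (res_le _ _ _ _))) hb' y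
  rw [fout_res_pos hy, fin_res_eq (fun a ha => hent a y ha hy), ← hpK y hy] at this
  exact this

theorem key {K : V → Prop} (hKN : ∀ v, K v → isN G P U v)
    (hcl : ∀ a b, K a → isN G P U b → G.Adj a b → K b)
    (hUK : ∀ v, K v → U v = 0)
    (hbad : ∀ t s, K t → G.Adj t s → ¬ isW G P U s → ¬ isC G P U s →
      (∀ t' s', K t' → G.Adj t' s' → ¬ isW G P U s' → ¬ isC G P U s' → t' = t ∧ s' = s) ∧
      ∀ k, K k → ¬ isD G P U k)
    {σ : List (PMove V)} (hex : Executable G (P + U) σ)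
    (hσ : ∀ m ∈ σ, isC G P U m.src → ∀ k, K k → ¬ G.Adj m.src k) (y : V) (hy : K y) :
    applySeq (P + U) σ y ≤ max (reach G P y) (reach G U y) := by
  obtain ⟨M, hM1, hM2, hM3⟩ := exec_flow' hex
  have hMadj : ∀ a b, 0 < M a b → G.Adj a b := fun a b h => (exec_adj hex (hM1 a b h)).1
  have hMb : ∀ v, 2 * fout M v ≤ (P + U) v + fin' M v := fun v => by have := hM3 v; omega
  have hpK : ∀ v, K v → (P + U) v = P v := fun v hv => by simp [hUK v hv]
  by_cases hent : ∀ s t, ¬ K s → K t → M s t = 0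
  · have := (noentry hpK hMadj hMb hent).2 y hy
    have := hM3 y
    omega
  -- a vertex outside `K` adjacent to `K` which sends pebbles is an outer vertex
  have hout : ∀ z t k, 0 < M z t → ¬ K z → K k → G.Adj z k →
      ¬ isW G P U z ∧ ¬ isC G P U z := by
    intro z t k h1 h2 h3 h4
    have hm := hM1 z t h1
    have hC : ¬ isC G P U z := fun hC => hσ _ hm hC k h3 h4
    exact ⟨fun hW => h2 (hcl k z h3 ⟨hW, hC⟩ h4.symm), hC⟩
  push Not at hent
  obtain ⟨x, w, hxK, hwK, hxw0⟩ := hent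
  have hm : 0 < M x w := Nat.pos_of_ne_zero hxw0
  have hxw : G.Adj x w := hMadj x w hm
  obtain ⟨hxW, hxC⟩ := hout x w w hm hxK hwK hxw
  obtain ⟨huniq, hnoD⟩ := hbad w x hwK hxw.symm hxW hxC
  have hRx : 2 ≤ reach G (P + U) x := (exec_adj hex (hM1 x w hm)).2
  have hwx : M w x = 0 := by have := hM2 x w; omega
  have hxK' : ∀ k, K k → k ≠ w → ∀ N : V → V → ℕ, (∀ a b, 0 < N a b → G.Adj a b) → N k x = 0 := by
    intro k hk hkw N hN
    by_contra h0
    exact hkw (huniq k x hk (hN k x (Nat.pos_of_ne_zero h0)) hxW hxC).1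
  have hentM : ∀ s t, ¬ K s → K t → 0 < M s t → s = x ∧ t = w := by
    intro s t h1 h2 h3
    obtain ⟨a, b⟩ := hout s t t h3 h1 h2 (hMadj s t h3)
    have := huniq t s h2 (hMadj s t h3).symm a b
    exact ⟨this.2, this.1⟩
  have hextM : ∀ k z, K k → ¬ K z → 0 < fout M z → M k z = 0 := by
    intro k z h1 h2 h3
    by_contra h0
    have h0' := Nat.pos_of_ne_zero h0
    obtain ⟨t, _, ht⟩ := Finset.sum_pos_iff.1 (show 0 < ∑ b, M z b from h3)
    obtain ⟨a, b⟩ := hout z t k ht h2 h1 (hMadj k z h0').symm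
    obtain ⟨rfl, rfl⟩ := huniq k z h1 (hMadj k z h0') a b
    omega
  have hxnw : x ≠ w := hxw.ne
  -- the part of `M` outside `K`
  set Mo := res (fun v => ¬ K v) (del x w M) with hMo
  have hMoadj : ∀ a b, 0 < Mo a b → G.Adj a b := fun a b h => hMadj a b
    (lt_of_lt_of_le h ((res_le _ _ _ _).trans (del_le _ _ _ _ _)))
  have hMoK : ∀ v, K v → fout Mo v = 0 := fun v hv => fout_res_neg (by simpa using hv)
  have hMon : ∀ v, ¬ K v → fout Mo v + (if v = x then M x w else 0) = fout M v := fun v hv => by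
    rw [hMo, fout_res_pos (S := fun v => ¬ K v) hv, fout_del x w M v]
  have hMoi : ∀ v, ¬ K v → 0 < fout M v → fin' Mo v = fin' M v := by
    intro v hv hs
    rw [hMo, fin_res_eq, fin_del x w M v, if_neg (by rintro rfl; exact hv hwK)]
    · rfl
    · intro a ha
      have := hextM a v (by simpa using ha) hv hs
      have := del_le x w M a v
      omega
  have hMob : ∀ v, 2 * fout Mo v ≤ (P + U) v + fin' Mo v := by
    intro v
    by_cases hv : K v
    · rw [hMoK v hv]; omega
    · have h1 := hMon v hv
      rcases Nat.eq_zero_or_pos (fout M v) with h0 | h0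
      · omega
      · rw [hMoi v hv h0]
        have := hMb v
        omega
  have hMox : 2 * M x w + 2 * fout Mo x ≤ (P + U) x + fin' Mo x := by
    have h1 := hMon x hxK
    rw [if_pos rfl] at h1
    have h0 : 0 < fout M x := lt_of_lt_of_le hm (le_fout M x w)
    rw [hMoi x hxK h0]
    have := hMb x
    omega
  have hR2m : 2 * M x w ≤ reach G (P + U) x := by
    have := flow_reach hMoadj hMob x
    omega
  -- inflow of `M` into vertices of `K`
  have hKin : ∀ v, K v → fin' M v = fin' (res K M) v + if v = w then M x w else 0 := by
    intro v hv
    have h1 : fin' (res K (del x w M)) v = fin' (del x w M) v := fin_res_eq (by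
      intro a ha
      by_contra h0
      have h0' := Nat.pos_of_ne_zero h0
      have := hentM a v ha hv (lt_of_lt_of_le h0' (del_le _ _ _ _ _))
      simp [del, this] at h0)
    have h2 : res K (del x w M) = res K M := by
      funext a b
      simp only [res, del]
      split_ifs with h3 h4
      · exact absurd (h4.1 ▸ h3) hxK
      · rfl
      · rfl
    rw [fin_del x w M v, ← h1, h2]
  rcases notWC hxW hxC (by omega) with ⟨hP, hU0⟩ | ⟨hU1, hP0⟩
  · -- type P
    obtain ⟨σ', hex', hσ'⟩ := exists_reach G P x
    obtain ⟨N, hN1, hN2, hN3⟩ := exec_flow' hex'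
    have hNadj : ∀ a b, 0 < N a b → G.Adj a b := fun a b h => (exec_adj hex' (hN1 a b h)).1
    have hNr : ∀ a b, 0 < N a b → 2 ≤ reach G P a := fun a b h => (exec_adj hex' (hN1 a b h)).2
    have hNb : ∀ v, 2 * fout N v ≤ P v + fin' N v := fun v => by have := hN3 v; omega
    have houtN : ∀ z t k, 0 < N z t → ¬ K z → K k → G.Adj z k → z = x ∧ k = w := by
      intro z t k h1 h2 h3 h4
      have hC : ¬ isC G P U z := by
        rintro ⟨_, h5, _⟩
        have := hNr z t h1
        omega
      have := huniq k z h3 h4.symm (fun hW => h2 (hcl k z h3 ⟨hW, hC⟩ h4.symm)) hC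
      exact ⟨this.2, this.1⟩
    have h2mj : 2 * M x w + N w x ≤ reach G P x := by
      rcases Nat.eq_zero_or_pos (N w x) with h0 | h0
      · omega
      have hxw0 : N x w = 0 := by have := hN2 x w; omega
      have hentN : ∀ s t, ¬ K s → K t → N s t = 0 := by
        intro s t h1 h2
        by_contra h3
        have h3' := Nat.pos_of_ne_zero h3
        obtain ⟨rfl, rfl⟩ := houtN s t t h3' h1 h2 (hNadj s t h3')
        omega
      have hNK := (noentry (p := P) (fun _ _ => rfl) hNadj hNb hentN).1
      have := flow_reach (G := G) (p := P + U) (M := Mo + res K N) (by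
          intro a b h
          simp only [Pi.add_apply] at h
          rcases Nat.eq_zero_or_pos (Mo a b) with h1 | h1
          · exact hNadj a b (lt_of_lt_of_le (by omega) (res_le K N a b))
          · exact hMoadj a b h1) (by
          intro v
          rw [fin_add, fout_add]
          have h1 := hNK v
          have h2 := hMob v
          simp only [Pi.add_apply] at h2 ⊢
          by_cases hv : K v
          · have := hMoK v hv; omega
          · rw [fout_res_neg hv]; omega) x
      rw [fin_add, fout_add, fout_res_neg hxK] at this
      have h5 := le_fin (res K N) w x
      have h6 : res K N w x = N w x := by simp [res, hwK]
      omega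
    set E := res (fun v => ¬ K v) (del x w N) with hE
    have hEadj : ∀ a b, 0 < E a b → G.Adj a b := fun a b h => hNadj a b
      (lt_of_lt_of_le h ((res_le _ _ _ _).trans (del_le _ _ _ _ _)))
    have hEK : ∀ v, K v → fout E v = 0 := fun v hv => fout_res_neg (by simpa using hv)
    have hEn : ∀ v, ¬ K v → fout E v + (if v = x then N x w else 0) = fout N v := fun v hv => by
      rw [hE, fout_res_pos (S := fun v => ¬ K v) hv, fout_del x w N v]
    have hEi : ∀ v, ¬ K v → v ≠ x → 0 < fout N v → fin' E v = fin' N v := by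
      intro v hv hvx hs
      obtain ⟨t, _, ht⟩ := Finset.sum_pos_iff.1 (show 0 < ∑ b, N v b from hs)
      rw [hE, fin_res_eq, fin_del x w N v, if_neg (by rintro rfl; exact hv hwK)]
      · rfl
      · intro a ha
        by_contra h0
        have h0' := lt_of_lt_of_le (Nat.pos_of_ne_zero h0) (del_le x w N a v)
        exact hvx (houtN v t a ht hv (by simpa using ha) (hNadj a v h0').symm).1
    have hEx : fin' N x = fin' E x + N w x := by
      have h1 : fin' (res (fun v => ¬ K v) (del w x N)) x = fin' (del w x N) x := by
        apply fin_res_eq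
        intro a ha
        by_cases haw : a = w
        · simp [del, haw]
        · have := hxK' a (by simpa using ha) haw N hNadj
          have := del_le w x N a x
          omega
      have h2 : fin' (res (fun v => ¬ K v) (del w x N)) x = fin' E x := by
        unfold fin'
        refine Finset.sum_congr rfl fun a _ => ?_
        simp only [hE, res, del]
        by_cases h3 : K a
        · simp [h3]
        · have h4 : a ≠ w := by rintro rfl; exact h3 hwK
          simp [h3, h4, hxnw]
      rw [fin_del w x N x, if_pos rfl, ← h1, h2]
    have hEx2 : 2 * M x w + 2 * fout E x ≤ P x + fin' E x := by
      have h1 := hEn x hxK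
      have h2 := hN3 x
      omega
    have := flow_reach (G := G) (p := P) (M := E + unitM x w (M x w) + res K M) (by
        intro a b h
        simp only [Pi.add_apply] at h
        rcases Nat.eq_zero_or_pos (E a b) with h1 | h1
        · rcases Nat.eq_zero_or_pos (unitM x w (M x w) a b) with h2 | h2
          · exact hMadj a b (lt_of_lt_of_le (by omega) (res_le K M a b))
          · simp only [unitM] at h2
            split_ifs at h2 with h3
            · rw [h3.1, h3.2]; exact hxw
            · omega
        · exact hEadj a b h1) (by
        intro v
        rw [fin_add, fout_add, fin_add, fout_add, fin_unit, fout_unit]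
        by_cases hv : K v
        · have hvx : v ≠ x := by rintro rfl; exact hxK hv
          rw [hEK v hv, if_neg hvx, fout_res_pos hv]
          have := hMb v
          rw [hKin v hv, hpK v hv] at this
          omega
        · rw [fout_res_neg hv]
          by_cases hvx : v = x
          · subst hvx
            rw [if_pos rfl]; omega
          · rw [if_neg hvx]
            have h1 := hEn v hv
            rw [if_neg hvx] at h1
            rcases Nat.eq_zero_or_pos (fout N v) with h0 | h0
            · omega
            · rw [hEi v hv hvx h0]
              have := hNb v
              omega) y
    rw [fin_add, fout_add, fin_add, fout_add, fin_unit, fout_unit] at this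
    have hyx : y ≠ x := by rintro rfl; exact hxK hy
    rw [hEK y hy, if_neg hyx, fout_res_pos hy] at this
    have h9 := hM3 y
    rw [hKin y hy, hpK y hy] at h9
    omega
  · -- type U
    let q : V → ℕ := fun v => if v = w then M x w else 0
    have hUw : M x w ≤ reach G U w := reach_edge hxw (by omega)
    obtain ⟨σU, hσU1, hσU2⟩ := exists_reach G U w
    have hqU : q ≤ applySeq U σU := by
      intro v
      simp only [q]
      split_ifs with h
      · subst h; omega
      · omega
    obtain ⟨τ, hτ1, hτ2, hτ3⟩ := flow_exec (G := G) _ (P + q) (res K M) rfl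
      (fun a b h => hMadj a b (lt_of_lt_of_le h (res_le _ _ _ _))) (by
        intro v
        by_cases hv : K v
        · rw [fout_res_pos hv]
          have := hMb v
          rw [hKin v hv, hpK v hv] at this
          simp only [Pi.add_apply, q]
          omega
        · rw [fout_res_neg hv]; omega)
    have hD : ∀ k, K k → ¬ (Reachable' G P k ∧ Reachable' G q k) := by
      rintro k hk ⟨h1, h2⟩
      exact hnoD k hk ⟨reach_iff.1 h1, reach_iff.1 (kr_trans hσU1 hqU h2)⟩
    obtain ⟨s1, s2, h1, h2, h3⟩ := purity hτ1 (by
      intro m hm'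
      apply hD
      by_contra hc
      have := hτ2 m hm'
      simp [res, hc] at this)
    have h4 := hτ3 y
    rw [h3, fout_res_pos hy] at h4
    have h5 := hM3 y
    rw [hKin y hy, hpK y hy] at h5
    have hq : q y = if y = w then M x w else 0 := rfl
    simp only [Pi.add_apply] at h4
    rw [hq] at h4
    have h6 := le_reach h1 y
    have h7 := le_reach h2 y
    have h8 : reach G q y ≤ reach G U y := kr_iff.1 (kr_trans hσU1 hqU (kr_iff.2 le_rfl))
    have h9 := hD y hy
    rw [reach_iff, reach_iff] at h9
    omega

end core

section taus
variable {V : Type*} [Fintype V] [DecidableEq V] {G : SimpleGraph V} {P U : V → ℕ}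

variable (G) in
/-- minimal length of a sequence putting two pebbles on `v` -/
noncomputable def tau (p : V → ℕ) (v : V) : ℕ :=
  sInf {n | ∃ σ, Executable G p σ ∧ σ.length = n ∧ 2 ≤ applySeq p σ v}

theorem tau_le {p : V → ℕ} {σ : List (PMove V)} {v : V} (h : Executable G p σ)
    (h2 : 2 ≤ applySeq p σ v) : tau G p v ≤ σ.length :=
  Nat.sInf_le ⟨σ, h, rfl, h2⟩

theorem tau_spec {p : V → ℕ} {v : V} (h : 2 ≤ reach G p v) :
    ∃ σ, Executable G p σ ∧ σ.length = tau G p v ∧ 2 ≤ applySeq p σ v := by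
  obtain ⟨σ, h1, h2⟩ := kr_iff.2 h
  exact Nat.sInf_mem (s := {n | ∃ σ, Executable G p σ ∧ σ.length = n ∧ 2 ≤ applySeq p σ v})
    ⟨_, σ, h1, rfl, h2⟩

theorem tau_lt {p : V → ℕ} {σ : List (PMove V)} (h : Executable G p σ) {m : PMove V}
    (hm : m ∈ σ) : tau G p m.src < σ.length := by
  obtain ⟨s, h1, h2, h3, _⟩ := sender_early h hm
  exact lt_of_le_of_lt (tau_le h1 h2) h3

theorem nb_le {v y : V} (hv : isC G P U v) (h : G.Adj y v) :
    reach G P y ≤ 1 ∧ reach G U y ≤ 1 := by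
  obtain ⟨_, h1, h2⟩ := hv
  constructor
  · by_contra hc
    have := reach_edge h (m := 1) (p := P) (by omega)
    omega
  · by_contra hc
    have := reach_edge h (m := 1) (p := U) (by omega)
    omega

theorem isW_of {y : V} (h1 : reach G P y ≤ 1) (h2 : reach G U y ≤ 1)
    (h : 2 ≤ reach G (P + U) y) : isW G P U y := by
  unfold isW cc
  omega

/-- the flow of a shortest sequence -/
theorem min_flow {p : V → ℕ} {v : V} (h : 2 ≤ reach G p v) (hp : p v ≤ 1) :
    ∃ M : V → V → ℕ, (∀ a b, 0 < M a b → G.Adj a b ∧ 2 ≤ reach G p a ∧ tau G p a < tau G p v) ∧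
      (∀ a b, M a b = 0 ∨ M b a = 0) ∧ (∀ w, 2 * fout M w ≤ p w + fin' M w) ∧
      fout M v = 0 ∧ 2 ≤ p v + fin' M v := by
  obtain ⟨σ, h1, h2, h3⟩ := tau_spec h
  obtain ⟨M, hM1, hM2, hM3⟩ := exec_flow' h1
  have hA : ∀ a b, 0 < M a b → G.Adj a b ∧ 2 ≤ reach G p a ∧ tau G p a < tau G p v := by
    intro a b hab
    have h4 := hM1 a b hab
    obtain ⟨h5, h6⟩ := exec_adj h1 h4
    have := tau_lt h1 h4
    exact ⟨h5, h6, by rw [h2] at this; exact this⟩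
  have h0 : fout M v = 0 := by
    by_contra hc
    obtain ⟨t, _, ht⟩ := Finset.sum_pos_iff.1 (show 0 < ∑ b, M v b from Nat.pos_of_ne_zero hc)
    exact absurd (hA v t ht).2.2 (lt_irrefl _)
  refine ⟨M, hA, hM2, fun w => ?_, h0, ?_⟩
  · have := hM3 w; omega
  · have := hM3 v; omega

theorem exists_pred {p : V → ℕ} {v : V} (h : 2 ≤ reach G p v) (hp : p v ≤ 1) :
    ∃ z, G.Adj z v ∧ 2 ≤ reach G p z ∧ tau G p z < tau G p v := by
  obtain ⟨M, h1, _, _, h4, h5⟩ := min_flow h hp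
  obtain ⟨z, _, hz⟩ := Finset.sum_pos_iff.1 (show 0 < ∑ a, M a v by
    change 0 < fin' M v; omega)
  exact ⟨z, h1 z v hz⟩

/-- every cooperation vertex has a heavy neighbour -/
theorem coop_nb {v : V} (hv : isC G P U v) : ∃ y, isW G P U y ∧ G.Adj y v := by
  obtain ⟨σ, h1, h2⟩ := kr_iff.2 hv.1
  obtain ⟨M, hM1, hM2, hM3⟩ := exec_flow' h1
  have hp1 := self_le_reach (G := G) P v
  have hp2 := self_le_reach (G := G) U v
  have h3 := hM3 v
  have h4 := hv.2
  simp only [Pi.add_apply] at h3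
  obtain ⟨z, _, hz⟩ := Finset.sum_pos_iff.1 (show 0 < ∑ a, M a v by
    change 0 < fin' M v; omega)
  obtain ⟨h5, h6⟩ := exec_adj h1 (hM1 z v hz)
  obtain ⟨h7, h8⟩ := nb_le hv h5
  exact ⟨z, isW_of h7 h8 h6, h5⟩

theorem deg2 (hdeg : ∀ y a b c, G.Adj y a → G.Adj y b → G.Adj y c → a = b ∨ a = c ∨ b = c) :
    ∀ (n : ℕ) (M : V → V → ℕ), ∑ v, fout M v = n → (∀ a b, 0 < M a b → G.Adj a b) →
    (∀ a b, M a b = 0 ∨ M b a = 0) → (∀ w, 2 * fout M w ≤ P w + U w + fin' M w) →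
    ∀ y v, 0 < M y v → fout M v = 0 →
    ∃ MP MU : V → V → ℕ, (∀ a b, 0 < MP a b → 0 < M a b) ∧ (∀ a b, 0 < MU a b → 0 < M a b) ∧
      (∀ w, 2 * fout MP w ≤ P w + fin' MP w) ∧ (∀ w, 2 * fout MU w ≤ U w + fin' MU w) ∧
      M y v ≤ MP y v + MU y v + 1 := by
  intro n
  induction n using Nat.strong_induction_on with
  | _ n ih =>
  intro M hn hadj hanti hbal y v hyv hv
  have hne : y ≠ v := (hadj y v hyv).ne
  have hvy : M v y = 0 := by have := hanti v y; omega
  -- adding the moves `y → v` to flows of a smaller support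
  have step : ∀ (p : V → ℕ) (N : V → V → ℕ) (k : ℕ), (∀ a b, 0 < N a b → 0 < M a b) →
      (∀ w, 2 * fout N w ≤ p w + fin' N w) → fout N y = 0 → 2 * k ≤ p y + fin' N y →
      ∀ w, 2 * fout (N + unitM y v k) w ≤ p w + fin' (N + unitM y v k) w := by
    intro p N k h1 h2 h3 h4 w
    rw [fout_add, fin_add, fout_unit, fin_unit]
    have := h2 w
    split_ifs with h5 h6
    · exact absurd (h5.symm.trans h6) hne
    · subst h5; omega
    · omega
    · omega
  have supp : ∀ (N : V → V → ℕ) (k : ℕ), (∀ a b, 0 < N a b → 0 < M a b) →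
      ∀ a b, 0 < (N + unitM y v k) a b → 0 < M a b := by
    intro N k h1 a b h2
    simp only [Pi.add_apply, unitM] at h2
    split_ifs at h2 with h3
    · rw [h3.1, h3.2]; exact hyv
    · exact h1 a b (by omega)
  have val : ∀ (N : V → V → ℕ) (k : ℕ), k ≤ (N + unitM y v k) y v := by
    intro N k
    simp [unitM]
  have hby := hbal y
  have hle := le_fout M y v
  by_cases hz : ∃ z, 0 < M z y
  · obtain ⟨z, hz⟩ := hz
    have hzv : z ≠ v := by rintro rfl; omega
    have hfin : fin' M y = M z y := by
      refine Finset.sum_eq_single z (fun b _ hb => ?_) (by simp)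
      by_contra h0
      have h0' := Nat.pos_of_ne_zero h0
      rcases hdeg y v z b (hadj y v hyv) (hadj z y hz).symm (hadj b y h0').symm with h | h | h
      · exact hzv h.symm
      · subst h; omega
      · exact hb h.symm
    have hfy : fout (del y v M) y = 0 := by
      refine Finset.sum_eq_zero fun b _ => ?_
      by_contra h0
      have h0' := lt_of_lt_of_le (Nat.pos_of_ne_zero h0) (del_le y v M y b)
      rcases hdeg y v z b (hadj y v hyv) (hadj z y hz).symm (hadj y b h0') with h | h | h
      · exact hzv h.symm
      · subst h; simp [del] at h0
      · subst h; have := hanti z y; omega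
    have htot : ∑ w, fout M w = ∑ w, fout (del y v M) w + M y v := by
      rw [Finset.sum_congr rfl fun w _ => fout_del y v M w, Finset.sum_add_distrib]
      simp
    have hdz : del y v M z y = M z y := by
      have : y ≠ v := hne
      simp [del, this]
    obtain ⟨MP, MU, h1, h2, h3, h4, h5⟩ := ih _ (by omega) (del y v M) rfl
      (fun a b h => hadj a b (lt_of_lt_of_le h (del_le _ _ _ _ _)))
      (fun a b => by
        have := hanti a b
        have := del_le y v M a b
        have := del_le y v M b a
        omega)
      (fun w => by
        have h1 := fout_del y v M w
        have h2 := fin_del y v M w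
        have h3 := hbal w
        by_cases hwv : w = v
        · subst hwv
          omega
        · rw [if_neg hwv] at h2
          omega) z y (by omega) hfy
    have hd : ∀ a b, 0 < del y v M a b → 0 < M a b := fun a b h =>
      lt_of_lt_of_le h (del_le _ _ _ _ _)
    have hf0 : ∀ N : V → V → ℕ, (∀ a b, 0 < N a b → 0 < del y v M a b) → fout N y = 0 := by
      intro N hN
      refine Finset.sum_eq_zero fun b _ => ?_
      by_contra h0
      have h6 := hN y b (Nat.pos_of_ne_zero h0)
      have h7 := le_fout (del y v M) y b
      omega
    have hk1 := le_fin MP z y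
    have hk2 := le_fin MU z y
    refine ⟨MP + unitM y v ((P y + MP z y) / 2), MU + unitM y v ((U y + MU z y) / 2),
      supp _ _ fun a b h => hd a b (h1 a b h), supp _ _ fun a b h => hd a b (h2 a b h),
      step P _ _ (fun a b h => hd a b (h1 a b h)) h3 (hf0 _ h1) (by omega),
      step U _ _ (fun a b h => hd a b (h2 a b h)) h4 (hf0 _ h2) (by omega), ?_⟩
    have := val MP ((P y + MP z y) / 2)
    have := val MU ((U y + MU z y) / 2)
    omega
  · push Not at hz
    have hfin : fin' M y = 0 := Finset.sum_eq_zero fun a _ => by have := hz a; omega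
    have z1 : ∀ a b, 0 < (fun _ _ => 0 : V → V → ℕ) a b → 0 < M a b := by simp
    have z2 : ∀ w, fout (fun _ _ => 0 : V → V → ℕ) w = 0 := by simp [fout]
    refine ⟨(fun _ _ => 0) + unitM y v (P y / 2), (fun _ _ => 0) + unitM y v (U y / 2),
      supp _ _ z1, supp _ _ z1, step P _ _ z1 (fun w => by rw [z2]; omega) (z2 y) (by omega),
      step U _ _ z1 (fun w => by rw [z2]; omega) (z2 y) (by omega), ?_⟩
    have := val (fun _ _ => 0) (P y / 2)
    have := val (fun _ _ => 0) (U y / 2)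
    omega

theorem coop_two {v : V} (hv : isC G P U v) (h2 : 2 ≤ reach G (P + U) v) :
    (∃ y z, y ≠ z ∧ G.Adj y v ∧ 2 ≤ reach G (P + U) y ∧ tau G (P + U) y < tau G (P + U) v ∧
      G.Adj z v ∧ 2 ≤ reach G (P + U) z ∧ tau G (P + U) z < tau G (P + U) v) ∨
    ((∃ y, G.Adj y v ∧ 4 ≤ reach G (P + U) y ∧ tau G (P + U) y < tau G (P + U) v) ∧
      ¬ ∀ y a b c, G.Adj y a → G.Adj y b → G.Adj y c → a = b ∨ a = c ∨ b = c) := by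
  have hp1 := self_le_reach (G := G) P v
  have hp2 := self_le_reach (G := G) U v
  have hv2 := hv.2
  have hpv : (P + U) v = 0 := by simp only [Pi.add_apply]; omega
  obtain ⟨M, h1, h3, h4, h5, h6⟩ := min_flow h2 (by omega)
  have h7 : 0 < fin' M v := by omega
  obtain ⟨y, _, hy⟩ := Finset.sum_pos_iff.1 (show 0 < ∑ a, M a v from h7)
  obtain ⟨hy1, hy2, hy3⟩ := h1 y v hy
  by_cases hz : ∃ z, z ≠ y ∧ 0 < M z v
  · obtain ⟨z, hzy, hz⟩ := hz
    exact Or.inl ⟨y, z, hzy.symm, hy1, hy2, hy3, h1 z v hz⟩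
  right
  push Not at hz
  have hfin : fin' M v = M y v := Finset.sum_eq_single y
    (fun b _ hb => by have := hz b hb; omega) (by simp)
  refine ⟨⟨y, hy1, ?_, hy3⟩, ?_⟩
  · have := flow_reach (G := G) (p := P + U) (M := del y v M)
      (fun a b h => (h1 a b (lt_of_lt_of_le h (del_le _ _ _ _ _))).1) (fun w => by
        have e1 := fout_del y v M w
        have e2 := fin_del y v M w
        have e3 := h4 w
        by_cases hwv : w = v
        · subst hwv; omega
        · rw [if_neg hwv] at e2; omega) y
    have e1 := fout_del y v M y
    have e2 := fin_del y v M y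
    rw [if_pos rfl] at e1
    rw [if_neg hy1.ne] at e2
    have := h4 y
    omega
  · intro hdeg
    obtain ⟨MP, MU, e1, e2, e3, e4, e5⟩ := deg2 (P := P) (U := U) hdeg _ M rfl
      (fun a b h => (h1 a b h).1) h3 h4 y v hy h5
    have hf0 : ∀ N : V → V → ℕ, (∀ a b, 0 < N a b → 0 < M a b) → fout N v = 0 := by
      intro N hN
      refine Finset.sum_eq_zero fun b _ => ?_
      by_contra h0
      have h6 := hN v b (Nat.pos_of_ne_zero h0)
      have h7 := le_fout M v b
      omega
    have a1 := flow_reach (G := G) (fun a b h => (h1 a b (e1 a b h)).1) e3 v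
    have a2 := flow_reach (G := G) (fun a b h => (h1 a b (e2 a b h)).1) e4 v
    rw [hf0 MP e1] at a1
    rw [hf0 MU e2] at a2
    have := le_fin MP y v
    have := le_fin MU y v
    omega

end taus

section comps
variable {V : Type*} [Fintype V] [DecidableEq V] {G : SimpleGraph V} {P U : V → ℕ}

theorem unit_double {u : V} {b : ℕ} (hb : 2 ≤ b) (hU : U = fun w => if w = u then b else 0)
    (hPu : P u = 0) (hu : isW G P U u) : isD G P U u ∧ ∃ y, isD G P U y ∧ G.Adj u y := by
  have hUu : U u = b := by simp [hU]
  have h1 := isW.gt hu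
  have h2 := self_le_reach (G := G) U u
  obtain ⟨σ, h3, h4⟩ := exists_reach G (P + U) u
  obtain ⟨σ', h5, h6, h7⟩ := no_send _ σ le_rfl h3 h4
  obtain ⟨h8, h9⟩ := exec_congr_src (q := P) (fun v hv => by simp [hU, hv]) h7 h5
  simp only [Pi.add_apply] at h9
  have h10 := le_reach h8 u
  obtain ⟨M, hM1, hM2, hM3⟩ := exec_flow' h8
  have h11 := hM3 u
  obtain ⟨y, _, hy⟩ := Finset.sum_pos_iff.1 (show 0 < ∑ a, M a u by
    change 0 < fin' M u; omega)
  obtain ⟨h12, h13⟩ := exec_adj h8 (hM1 y u hy)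
  refine ⟨⟨by omega, by omega⟩, y, ⟨by omega, ?_⟩, h12.symm⟩
  exact reach_edge h12.symm (by omega)

variable (G P U)

/-- the graph induced on the `N` vertices -/
def HG : SimpleGraph V where
  Adj a b := G.Adj a b ∧ isN G P U a ∧ isN G P U b
  symm := ⟨fun _ _ h => ⟨h.1.symm, h.2.2, h.2.1⟩⟩
  loopless := ⟨fun _ h => h.1.ne rfl⟩

/-- the component of a vertex -/
def comp (v : V) : (HG G P U).ConnectedComponent := (HG G P U).connectedComponentMk v

def KK (κ : (HG G P U).ConnectedComponent) (v : V) : Prop := isN G P U v ∧ comp G P U v = κ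

def outer (s : V) : Prop := ¬ isW G P U s ∧ ¬ isC G P U s

open Classical in
def good (κ : (HG G P U).ConnectedComponent) : Prop :=
  2 ≤ #{x | isD G P U x ∧ comp G P U x = κ} +
    #{q : V × V | KK G P U κ q.1 ∧ G.Adj q.1 q.2 ∧ outer G P U q.2}

variable {G P U}

theorem isD.isN {v : V} (h : isD G P U v) : isN G P U v := ⟨h.isW, h.notC⟩

theorem comp_eq {a b : V} (ha : isN G P U a) (hb : isN G P U b) (h : G.Adj a b) :
    comp G P U a = comp G P U b :=
  SimpleGraph.ConnectedComponent.sound (SimpleGraph.Adj.reachable (G := HG G P U) ⟨h, ha, hb⟩)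

theorem bad_key {u : V} {b : ℕ} (hb : 2 ≤ b) (hU : U = fun w => if w = u then b else 0)
    (hPu : P u = 0) {κ : (HG G P U).ConnectedComponent} (hκ : ¬ good G P U κ)
    {σ : List (PMove V)} (hex : Executable G (P + U) σ) {y : V} (hy : KK G P U κ y)
    (hlt : max (reach G P y) (reach G U y) < applySeq (P + U) σ y) :
    ∃ m ∈ σ, isC G P U m.src ∧ ∃ k, KK G P U κ k ∧ G.Adj m.src k := by
  classical
  by_contra hcon
  push Not at hcon
  apply hlt.not_ge
  have hκ' : #{x | isD G P U x ∧ comp G P U x = κ} +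
    #{q : V × V | KK G P U κ q.1 ∧ G.Adj q.1 q.2 ∧ outer G P U q.2} < 2 := by
    unfold good at hκ
    push Not at hκ
    convert hκ
  refine key (K := KK G P U κ) (fun v hv => hv.1) (fun a b ha hb hab =>
    ⟨hb, by rw [← comp_eq ha.1 hb hab]; exact ha.2⟩) (fun v hv => ?_) ?_ hex
    (fun m hm hC k hk => hcon m hm hC k hk) y hy
  · by_contra h0
    have hvu : v = u := by
      by_contra h1
      exact h0 (by simp [hU, h1])
    subst hvu
    obtain ⟨h1, z, h2, h3⟩ := unit_double hb hU hPu hv.1.1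
    have h4 : comp G P U z = κ := by rw [← comp_eq hv.1 h2.isN h3]; exact hv.2
    have h5 : 1 < #{x | isD G P U x ∧ comp G P U x = κ} := Finset.one_lt_card.2
      ⟨v, by simp [h1, hv.2], z, by simp [h2, h4], h3.ne⟩
    omega
  · intro t s ht hts hW hC
    have hmem : (t, s) ∈ ({q : V × V | KK G P U κ q.1 ∧ G.Adj q.1 q.2 ∧ outer G P U q.2} :
        Finset (V × V)) := Finset.mem_filter.2 ⟨Finset.mem_univ _, ht, hts, hW, hC⟩
    constructor
    · intro t' s' ht' hts' hW' hC'
      have hmem' : (t', s') ∈ ({q : V × V | KK G P U κ q.1 ∧ G.Adj q.1 q.2 ∧ outer G P U q.2} :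
        Finset (V × V)) := 
        Finset.mem_filter.2 ⟨Finset.mem_univ _, ht', hts', hW', hC'⟩
      have := Finset.card_le_one.1 (by omega) _ hmem' _ hmem
      simpa using this
    · intro k hk hD
      have h1 := Finset.card_pos.2 ⟨_, hmem⟩
      have h2 : 0 < #{x | isD G P U x ∧ comp G P U x = κ} := Finset.card_pos.2
        ⟨k, by simp [hD, hk.2]⟩
      omega

variable (G P U) in
/-- cooperation vertices with two pebbles adjacent to a component -/
def SS (κ : (HG G P U).ConnectedComponent) (c : V) : Prop :=
  isC G P U c ∧ 2 ≤ reach G (P + U) c ∧ ∃ k, KK G P U κ k ∧ G.Adj c k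

theorem bad_nonempty {u : V} {b : ℕ} (hb : 2 ≤ b) (hU : U = fun w => if w = u then b else 0)
    (hPu : P u = 0) {κ : (HG G P U).ConnectedComponent} (hκ : ¬ good G P U κ)
    {y : V} (hy : KK G P U κ y) : ∃ c, SS G P U κ c := by
  obtain ⟨σ, h1, h2⟩ := exists_reach G (P + U) y
  have := isW.gt hy.1.1
  obtain ⟨m, hm, h3, h4⟩ := bad_key hb hU hPu hκ h1 hy (by omega)
  exact ⟨m.src, h3, (exec_adj (a := m.src) (b := m.tgt) h1 hm).2, h4⟩

theorem bad_tau {u : V} {b : ℕ} (hb : 2 ≤ b) (hU : U = fun w => if w = u then b else 0)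
    (hPu : P u = 0) {κ : (HG G P U).ConnectedComponent} (hκ : ¬ good G P U κ)
    {y : V} (hy : KK G P U κ y) (hy1 : reach G P y ≤ 1) (hy2 : reach G U y ≤ 1)
    (hy3 : 2 ≤ reach G (P + U) y) :
    ∃ c, SS G P U κ c ∧ tau G (P + U) c < tau G (P + U) y := by
  obtain ⟨σ, h1, h0, h2⟩ := tau_spec hy3
  obtain ⟨m, hm, h3, h4⟩ := bad_key hb hU hPu hκ h1 hy (by omega)
  exact ⟨m.src, ⟨h3, (exec_adj (a := m.src) (b := m.tgt) h1 hm).2, h4⟩, h0 ▸ tau_lt h1 hm⟩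

/-- roots -/
theorem exists_roots {u : V} {b : ℕ} (hb : 2 ≤ b) (hU : U = fun w => if w = u then b else 0)
    (hPu : P u = 0) (κ : (HG G P U).ConnectedComponent) :
    ∃ r c : V, (∃ y, KK G P U κ y) → KK G P U κ r ∧ (¬ good G P U κ →
      SS G P U κ c ∧ G.Adj c r ∧ ∀ c', SS G P U κ c' → tau G (P + U) c ≤ tau G (P + U) c') := by
  by_cases h : ∃ y, KK G P U κ y
  · obtain ⟨y, hy⟩ := h
    by_cases hg : good G P U κ
    · exact ⟨y, y, fun _ => ⟨hy, fun h => absurd hg h⟩⟩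
    · obtain ⟨c, hc, hmin⟩ := WellFounded.has_min
        (InvImage.wf (tau G (P + U)) wellFounded_lt) {c | SS G P U κ c}
        (bad_nonempty hb hU hPu hg hy)
      obtain ⟨r, hr1, hr2⟩ := hc.2.2
      exact ⟨r, c, fun _ => ⟨hr1, fun _ => ⟨hc, hr2, fun c' hc' => not_lt.1 (hmin c' hc')⟩⟩⟩
  · exact ⟨u, u, fun h' => absurd h' h⟩

theorem dist_step {H : SimpleGraph V} {a b : V} (h : H.Reachable a b) (hne : a ≠ b) :
    ∃ w, H.Adj a w ∧ H.dist w b < H.dist a b := by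
  obtain ⟨p, hp⟩ := h.exists_walk_length_eq_dist
  cases p with
  | nil => exact absurd rfl hne
  | @cons _ w _ hvw q =>
    refine ⟨w, hvw, ?_⟩
    have := SimpleGraph.dist_le q
    rw [SimpleGraph.Walk.length_cons] at hp
    omega

/-- the ordering -/
theorem exists_rank {u : V} {b : ℕ} (hb : 2 ≤ b) (hU : U = fun w => if w = u then b else 0)
    (hPu : P u = 0) : ∃ prec : V → V → Prop, (∀ a b, prec a b → ¬ prec b a) ∧
      (∀ v y, isC G P U v → 2 ≤ reach G (P + U) v → G.Adj y v → 2 ≤ reach G (P + U) y →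
        tau G (P + U) y < tau G (P + U) v → prec y v) ∧
      ∃ r : (HG G P U).ConnectedComponent → V, ∀ v, isN G P U v →
        (∃ y, isW G P U y ∧ G.Adj y v ∧ prec y v) ∨
        (v = r (comp G P U v) ∧ good G P U (comp G P U v)) := by
  classical
  choose r c hrc using exists_roots (G := G) hb hU hPu
  let r1 : V → ℕ := fun v => if isN G P U v then
    (if good G P U (comp G P U v) then 0 else 2 * tau G (P + U) (c (comp G P U v)) + 3)
    else 2 * tau G (P + U) v + 2
  let r2 : V → ℕ := fun v => if isN G P U v then (HG G P U).dist v (r (comp G P U v)) else 0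
  refine ⟨fun a b => r1 a < r1 b ∨ (r1 a = r1 b ∧ r2 a < r2 b), ?_, ?_, r, ?_⟩
  · intro a b; omega
  · intro v y hv hv2 hyv hy2 ht
    left
    have hvN : ¬ isN G P U v := fun h => h.2 hv
    obtain ⟨h1, h2⟩ := nb_le hv hyv
    simp only [r1, if_neg hvN]
    split_ifs with h3 h4
    · omega
    · obtain ⟨c', hc', hlt⟩ := bad_tau hb hU hPu h4 ⟨h3, rfl⟩ h1 h2 hy2
      have := ((hrc _ ⟨y, h3, rfl⟩).2 h4).2.2 c' hc'
      omega
    · omega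
  · intro v hv
    obtain ⟨hr1, hr2⟩ := hrc _ ⟨v, hv, rfl⟩
    by_cases hvr : v = r (comp G P U v)
    · by_cases hg : good G P U (comp G P U v)
      · exact Or.inr ⟨hvr, hg⟩
      · left
        obtain ⟨h1, h2, h3⟩ := hr2 hg
        refine ⟨c (comp G P U v), h1.1.isW h1.2.1, by rw [← hvr] at h2; exact h2, Or.inl ?_⟩
        have hcN : ¬ isN G P U (c (comp G P U v)) := fun h => h.2 h1.1
        simp only [r1, if_neg hcN, if_pos hv, if_neg hg]
        omega
    · left
      have hreach : (HG G P U).Reachable v (r (comp G P U v)) :=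
        (SimpleGraph.ConnectedComponent.exact hr1.2).symm
      obtain ⟨w, hvw, hd⟩ := dist_step hreach hvr
      have hvw' : G.Adj v w ∧ isN G P U v ∧ isN G P U w := hvw
      have hcomp : comp G P U w = comp G P U v := comp_eq hvw'.2.2 hv hvw'.1.symm
      refine ⟨w, hvw'.2.2.1, hvw'.1.symm, Or.inr ⟨?_, ?_⟩⟩
      · simp only [r1, if_pos hv, if_pos hvw'.2.2, hcomp]
      · simp only [r2, if_pos hv, if_pos hvw'.2.2, hcomp]
        exact hd

end comps

section counting
variable {V : Type*} [Fintype V] [DecidableEq V]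

theorem fib_sum {α β γ : Type*} [DecidableEq α] [DecidableEq γ] (s : Finset α) (E : Finset β)
    (f : α → γ) (g : β → γ) (hg : Set.InjOn g E) : ∑ v ∈ E, #{x ∈ s | f x = g v} ≤ #s := by
  rw [← Finset.card_biUnion]
  · refine Finset.card_le_card ?_
    intro x hx
    simp only [Finset.mem_biUnion, Finset.mem_filter] at hx
    obtain ⟨_, _, h, _⟩ := hx
    exact h
  · intro a ha b hb hab
    refine Finset.disjoint_left.2 fun x hx hx' => hab (hg ha hb ?_)
    exact (Finset.mem_filter.1 hx).2.symm.trans (Finset.mem_filter.1 hx').2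

theorem count (G : SimpleGraph V) [DecidableRel G.Adj] (W C : Finset V) (prec : V → V → Prop)
    [DecidableRel prec] (hasym : ∀ a b, prec a b → ¬ prec b a)
    (hC : ∀ v ∈ C \ W, ∃ w ∈ W, G.Adj w v) :
    #(C \ W) + #{q : V × V | q.1 ∈ W ∧ G.Adj q.1 q.2 ∧ q.2 ∉ W ∧ q.2 ∉ C} +
      2 * #{q : V × V | q.1 ∈ W ∧ q.2 ∈ W ∧ G.Adj q.1 q.2 ∧ prec q.2 q.1} ≤
    G.maxDegree * #W := by
  have hA : #{q : V × V | q.1 ∈ W ∧ G.Adj q.1 q.2} ≤ G.maxDegree * #W := by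
    refine Finset.card_le_mul_card_image_of_maps_to (f := Prod.fst) (by simp; tauto) _ fun w hw => ?_
    refine le_trans ?_ (G.degree_le_maxDegree w)
    rw [← SimpleGraph.card_neighborFinset_eq_degree]
    refine Finset.card_le_card_of_injOn Prod.snd ?_ ?_
    · rintro ⟨a, c⟩ h
      simp at h
      simp [← h.2, h.1.2]
    · rintro ⟨a, c⟩ h ⟨a', c'⟩ h' e
      simp at h h' e
      simp [h.2, h'.2, e]
  have h1 : #(C \ W) ≤ #{q : V × V | q.1 ∈ W ∧ G.Adj q.1 q.2 ∧ q.2 ∉ W ∧ q.2 ∈ C} := by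
    refine Finset.card_le_card_of_surjOn Prod.snd ?_
    intro v hv
    obtain ⟨w, hw, hwv⟩ := hC v hv
    simp only [Finset.coe_sdiff, Set.mem_sdiff, Finset.mem_coe] at hv
    exact ⟨(w, v), by simp [hw, hwv, hv], rfl⟩
  have h2 : #{q : V × V | q.1 ∈ W ∧ q.2 ∈ W ∧ G.Adj q.1 q.2 ∧ prec q.2 q.1} =
      #{q : V × V | q.1 ∈ W ∧ q.2 ∈ W ∧ G.Adj q.1 q.2 ∧ prec q.1 q.2} := by
    refine Finset.card_bij' (fun q _ => q.swap) (fun q _ => q.swap) ?_ ?_ ?_ ?_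
    · rintro ⟨a, c⟩ h
      simp at h ⊢
      exact ⟨h.2.1, h.1, h.2.2.1.symm, h.2.2.2⟩
    · rintro ⟨a, c⟩ h
      simp at h ⊢
      exact ⟨h.2.1, h.1, h.2.2.1.symm, h.2.2.2⟩
    · simp
    · simp
  have h3 : #{q : V × V | q.1 ∈ W ∧ G.Adj q.1 q.2 ∧ q.2 ∉ W ∧ q.2 ∈ C} +
      #{q : V × V | q.1 ∈ W ∧ G.Adj q.1 q.2 ∧ q.2 ∉ W ∧ q.2 ∉ C} +
      #{q : V × V | q.1 ∈ W ∧ q.2 ∈ W ∧ G.Adj q.1 q.2 ∧ prec q.2 q.1} +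
      #{q : V × V | q.1 ∈ W ∧ q.2 ∈ W ∧ G.Adj q.1 q.2 ∧ prec q.1 q.2} ≤
      #{q : V × V | q.1 ∈ W ∧ G.Adj q.1 q.2} := by
    simp only [Finset.card_filter]
    rw [← Finset.sum_add_distrib, ← Finset.sum_add_distrib, ← Finset.sum_add_distrib]
    refine Finset.sum_le_sum fun q _ => ?_
    have := hasym q.1 q.2
    by_cases a1 : q.1 ∈ W <;> by_cases a2 : q.2 ∈ W <;> by_cases a3 : q.2 ∈ C <;>
      by_cases a4 : G.Adj q.1 q.2 <;> by_cases a5 : prec q.1 q.2 <;>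
      by_cases a6 : prec q.2 q.1 <;> simp [a1, a2, a3, a4, a5, a6] <;> tauto
  omega

variable {G : SimpleGraph V} {P U : V → ℕ}

open Classical in
theorem main2 [DecidableRel G.Adj] {u : V} {b : ℕ} (hb : 2 ≤ b)
    (hU : U = fun w => if w = u then b else 0)
    (hPu : P u = 0) {d : ℕ} (hd : G.maxDegree = d + 2) :
    #{v | isC G P U v} ≤ d * ∑ v, cc G P U v + #{v | isD G P U v} := by
  obtain ⟨prec, hasym, hprec, r, hr⟩ := exists_rank (G := G) hb hU hPu
  set W : Finset V := {v | isW G P U v} with hW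
  set C : Finset V := {v | isC G P U v} with hC
  have mW : ∀ v, v ∈ W ↔ isW G P U v := by simp [hW]
  have mC : ∀ v, v ∈ C ↔ isC G P U v := by simp [hC]
  have hcount := count G W C prec hasym (fun v hv => by
    rw [Finset.mem_sdiff, mC] at hv
    obtain ⟨y, h1, h2⟩ := coop_nb hv.1
    exact ⟨y, (mW y).2 h1, h2⟩)
  rw [hd] at hcount
  set A : Finset (V × V) := {q : V × V | q.1 ∈ W ∧ q.2 ∈ W ∧ G.Adj q.1 q.2 ∧ prec q.2 q.1} with hA
  set B : Finset (V × V) := {q : V × V | q.1 ∈ W ∧ G.Adj q.1 q.2 ∧ q.2 ∉ W ∧ q.2 ∉ C} with hB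
  let fb : V → ℕ := fun w => #{q ∈ A | q.1 = w}
  have hfb1 : ∀ w y, isW G P U w → isW G P U y → G.Adj y w → prec y w → 1 ≤ fb w := by
    intro w y h1 h2 h3 h4
    refine Finset.card_pos.2 ⟨(w, y), ?_⟩
    simp [hA, mW, h1, h2, h3.symm, h4]
  have hfb2 : ∀ w y z, isW G P U w → isW G P U y → G.Adj y w → prec y w → isW G P U z →
      G.Adj z w → prec z w → y ≠ z → 2 ≤ fb w := by
    intro w y z h1 h2 h3 h4 h5 h6 h7 hne
    refine Finset.one_lt_card.2 ⟨(w, y), ?_, (w, z), ?_, ?_⟩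
    · simp [hA, mW, h1, h2, h3.symm, h4]
    · simp [hA, mW, h1, h5, h6.symm, h7]
    · simpa using hne
  set E : Finset V := {w ∈ W | w ∉ C ∧ fb w = 0} with hE
  set O : Finset V := {w ∈ W | w ∈ C ∧ fb w ≤ 1} with hO
  -- cooperation vertices of weight
  have hCW : ∀ w, isW G P U w → isC G P U w → 2 ≤ reach G (P + U) w := by
    intro w h1 h2
    have h3 := h2.2
    unfold isW cc at h1
    omega
  have hpos : ∀ w ∈ W, w ∈ C → 1 ≤ fb w := by
    intro w h1 h2
    rw [mW] at h1
    rw [mC] at h2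
    have h3 := hCW w h1 h2
    rcases coop_two h2 h3 with ⟨y, z, hne, a1, a2, a3, a4, a5, a6⟩ | ⟨⟨y, a1, a2, a3⟩, _⟩
    · obtain ⟨e1, e2⟩ := nb_le h2 a1
      exact hfb1 w y h1 (isW_of e1 e2 a2) a1 (hprec w y h2 h3 a1 a2 a3)
    · obtain ⟨e1, e2⟩ := nb_le h2 a1
      exact hfb1 w y h1 (isW_of e1 e2 (by omega)) a1 (hprec w y h2 h3 a1 (by omega) a3)
  have hOy : ∀ v ∈ O, (∃ y, G.Adj y v ∧ 4 ≤ reach G (P + U) y ∧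
      tau G (P + U) y < tau G (P + U) v) ∧
      ¬ ∀ y a b c, G.Adj y a → G.Adj y b → G.Adj y c → a = b ∨ a = c ∨ b = c := by
    intro w hw
    simp only [hO, Finset.mem_filter, mW, mC] at hw
    obtain ⟨h1, h2, h4⟩ := hw
    have h3 := hCW w h1 h2
    rcases coop_two h2 h3 with ⟨y, z, hne, a1, a2, a3, a4, a5, a6⟩ | h5
    · obtain ⟨e1, e2⟩ := nb_le h2 a1
      obtain ⟨e3, e4⟩ := nb_le h2 a4
      have := hfb2 w y z h1 (isW_of e1 e2 a2) a1 (hprec w y h2 h3 a1 a2 a3)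
        (isW_of e3 e4 a5) a4 (hprec w z h2 h3 a4 a5 a6) hne
      omega
    · exact h5
  have hAsum : #A = ∑ w ∈ W, fb w := Finset.card_eq_sum_card_fiberwise (by
    intro q hq
    simp only [hA, Finset.coe_filter, Set.mem_ofPred_eq] at hq
    exact hq.2.1)
  have hcardf : ∀ (p : V → Prop) [DecidablePred p],
      #{w ∈ W | p w} = ∑ w ∈ W, if p w then 1 else 0 := fun p _ => Finset.card_filter _ _
  have hsum : #W + #{w ∈ W | w ∈ C} ≤ #A + #E + #O := by
    rw [hAsum, hE, hO, hcardf, hcardf, hcardf, Finset.card_eq_sum_ones,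
      ← Finset.sum_add_distrib, ← Finset.sum_add_distrib, ← Finset.sum_add_distrib]
    refine Finset.sum_le_sum fun w hw => ?_
    by_cases h1 : w ∈ C
    · have := hpos w hw h1
      simp only [h1, if_true, not_true, false_and, if_false, true_and]
      split_ifs <;> omega
    · simp only [h1, if_false, not_false_eq_true, true_and, false_and]
      split_ifs <;> omega
  have hOC : #O ≤ #{w ∈ W | w ∈ C} := Finset.card_le_card (by
    intro w hw
    simp only [hO, Finset.mem_filter] at hw ⊢
    exact ⟨hw.1, hw.2.1⟩)
  have hCsplit : #C = #(C \ W) + #{w ∈ W | w ∈ C} := by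
    have e : ({w ∈ W | w ∈ C} : Finset V) = C ∩ W := by ext; simp [and_comm]
    rw [e, Finset.card_sdiff_add_card_inter]
  -- good components
  have hE2 : ∀ v ∈ E, v = r (comp G P U v) ∧ good G P U (comp G P U v) := by
    intro v hv
    simp only [hE, Finset.mem_filter, mW, mC] at hv
    obtain ⟨h1, h2, h3⟩ := hv
    rcases hr v ⟨h1, h2⟩ with ⟨y, a1, a2, a3⟩ | h
    · have := hfb1 v y h1 a1 a2 a3
      omega
    · exact h
  have hinj : Set.InjOn (comp G P U) E := by
    intro a ha b hb hab
    rw [(hE2 a ha).1, (hE2 b hb).1, hab]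
  have hEg : 2 * #E ≤ #{v | isD G P U v} + #B := by
    have e1 := fib_sum ({v | isD G P U v} : Finset V) E (comp G P U) (comp G P U) hinj
    have e2 := fib_sum ({q : V × V | isN G P U q.1 ∧ G.Adj q.1 q.2 ∧ outer G P U q.2}) E
      (fun q => comp G P U q.1) (comp G P U) hinj
    have e3 : #{q : V × V | isN G P U q.1 ∧ G.Adj q.1 q.2 ∧ outer G P U q.2} ≤ #B := by
      refine Finset.card_le_card ?_
      intro q hq
      simp only [Finset.mem_filter, Finset.mem_univ, true_and] at hq
      simp only [hB, Finset.mem_filter, Finset.mem_univ, true_and, mW, mC]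
      exact ⟨hq.1.1, hq.2.1, hq.2.2⟩
    have e4 : ∑ v ∈ E, 2 ≤ ∑ v ∈ E, (#{x ∈ ({v | isD G P U v} : Finset V) |
        comp G P U x = comp G P U v} +
        #{q ∈ ({q : V × V | isN G P U q.1 ∧ G.Adj q.1 q.2 ∧ outer G P U q.2} : Finset (V × V)) |
        comp G P U q.1 = comp G P U v}) := by
      refine Finset.sum_le_sum fun v hv => ?_
      have this : 2 ≤ #{x | isD G P U x ∧ comp G P U x = comp G P U v} +
          #{q : V × V | KK G P U (comp G P U v) q.1 ∧ G.Adj q.1 q.2 ∧ outer G P U q.2} := by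
        have h0 := (hE2 v hv).2
        unfold good at h0
        convert h0
      refine this.trans (add_le_add (Finset.card_le_card ?_) (Finset.card_le_card ?_))
      · intro x hx
        simpa using hx
      · intro q hq
        rw [Finset.mem_filter] at hq
        obtain ⟨-, a1, a2, a3⟩ := hq
        exact Finset.mem_filter.2 ⟨Finset.mem_filter.2 ⟨Finset.mem_univ _, a1.1, a2, a3⟩, a1.2⟩
    rw [Finset.sum_add_distrib, Finset.sum_const, smul_eq_mul] at e4
    omega
  -- the exceptional vertices
  set Y : Finset V := {y ∈ W | 4 ≤ reach G (P + U) y ∧ reach G P y ≤ 1 ∧ reach G U y ≤ 1} with hY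
  have hOY : #O ≤ d * (2 * #Y) := by
    rcases Nat.eq_zero_or_pos d with rfl | hd0
    · have : O = ∅ := by
        by_contra hne
        obtain ⟨v, hv⟩ := Finset.nonempty_iff_ne_empty.2 hne
        refine (hOy v hv).2 fun y a b c ha hb hc => ?_
        by_contra hcon
        push Not at hcon
        have h3 : 2 < #(G.neighborFinset y) := Finset.two_lt_card.2
          ⟨a, by simpa, b, by simpa, c, by simpa, hcon⟩
        rw [SimpleGraph.card_neighborFinset_eq_degree] at h3
        have := G.degree_le_maxDegree y
        omega
      simp [this]
    · have hch : ∀ v, ∃ y, v ∈ O → G.Adj y v ∧ 4 ≤ reach G (P + U) y ∧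
          tau G (P + U) y < tau G (P + U) v := by
        intro v
        by_cases hv : v ∈ O
        · obtain ⟨y, hy⟩ := (hOy v hv).1
          exact ⟨y, fun _ => hy⟩
        · exact ⟨v, fun h => absurd h hv⟩
      choose f hf using hch
      have h1 : #O ≤ (d + 1) * #Y := by
        refine Finset.card_le_mul_card_image_of_maps_to (f := f) ?_ _ fun y hy => ?_
        · intro v hv
          obtain ⟨a1, a2, a3⟩ := hf v hv
          rw [hO, Finset.mem_filter, mC] at hv
          obtain ⟨e1, e2⟩ := nb_le hv.2.1 a1
          simp only [hY, Finset.mem_filter, mW]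
          exact ⟨isW_of e1 e2 (by omega), a2, e1, e2⟩
        · simp only [hY, Finset.mem_filter, mW] at hy
          obtain ⟨b1, b2, b3, b4⟩ := hy
          have hyu : y ≠ u := by
            rintro rfl
            have := self_le_reach (G := G) U y
            have e : U y = b := by simp [hU]
            omega
          have hUy : U y = 0 := by simp [hU, hyu]
          have hPy := self_le_reach (G := G) P y
          obtain ⟨z, z1, z2, z3⟩ := exists_pred (G := G) (p := P + U) (v := y) (by omega)
            (by simp only [Pi.add_apply]; omega)
          have hsub : ({v ∈ O | f v = y} : Finset V) ⊆ (G.neighborFinset y).erase z := by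
            intro v hv
            rw [Finset.mem_filter] at hv
            obtain ⟨a1, a2, a3⟩ := hf v hv.1
            rw [hv.2] at a1 a3
            rw [Finset.mem_erase, SimpleGraph.mem_neighborFinset]
            refine ⟨?_, a1⟩
            rintro rfl
            omega
          have h4 := Finset.card_le_card hsub
          rw [Finset.card_erase_of_mem (by simpa using z1.symm),
            SimpleGraph.card_neighborFinset_eq_degree] at h4
          have := G.degree_le_maxDegree y
          omega
      nlinarith [Nat.zero_le (#Y)]
  have hcc : #W + 2 * #Y ≤ ∑ v, cc G P U v := by
    have h1 : ∑ v ∈ W, cc G P U v ≤ ∑ v, cc G P U v :=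
      Finset.sum_le_sum_of_subset (Finset.subset_univ _)
    refine le_trans ?_ h1
    rw [hY, hcardf, Finset.card_eq_sum_ones, Finset.mul_sum, ← Finset.sum_add_distrib]
    refine Finset.sum_le_sum fun w hw => ?_
    rw [mW] at hw
    unfold isW at hw
    split_ifs with h2
    · unfold cc; omega
    · omega
  have hfin := Nat.mul_le_mul_left d hcc
  rw [Nat.mul_add] at hfin
  rw [Nat.add_mul] at hcount
  omega

theorem reach_deg0 {p : V → ℕ} {v : V} (h : ∀ w, ¬ G.Adj v w) : reach G p v = p v := by
  refine le_antisymm ?_ (self_le_reach p v)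
  obtain ⟨σ, h1, h2⟩ := exists_reach G p v
  obtain ⟨M, hM1, hM2, hM3⟩ := exec_flow' h1
  have h0 : fin' M v = 0 := Finset.sum_eq_zero fun a _ => by
    by_contra hc
    exact h a (exec_adj h1 (hM1 a v (Nat.pos_of_ne_zero hc))).1.symm
  have := hM3 v
  omega

theorem reach_deg1 {p : V → ℕ} {v w : V} (hdeg : ∀ a b c, G.Adj a b → G.Adj a c → b = c)
    (h : G.Adj v w) : reach G p v = p v + p w / 2 := by
  apply le_antisymm
  · obtain ⟨σ, h1, h2⟩ := exists_reach G p v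
    obtain ⟨M, hM1, hM2, hM3⟩ := exec_flow' h1
    have hadj : ∀ a b, 0 < M a b → G.Adj a b := fun a b h => (exec_adj h1 (hM1 a b h)).1
    have e1 : fin' M v = M w v := Finset.sum_eq_single w (fun b _ hb => by
      by_contra h0
      exact hb (hdeg v b w (hadj b v (Nat.pos_of_ne_zero h0)).symm h)) (by simp)
    have e2 : fin' M w = M v w := Finset.sum_eq_single v (fun b _ hb => by
      by_contra h0
      exact hb (hdeg w b v (hadj b w (Nat.pos_of_ne_zero h0)).symm h.symm)) (by simp)
    have e3 := le_fout M v w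
    have e4 := le_fout M w v
    have := hM3 v
    have := hM3 w
    have := hM2 v w
    omega
  · have := flow_reach (G := G) (p := p) (M := unitM w v (p w / 2)) (by
      intro a b hab
      simp only [unitM] at hab
      split_ifs at hab with hc
      · rw [hc.1, hc.2]; exact h.symm
      · omega) (by
      intro x
      rw [fout_unit, fin_unit]
      split_ifs with hx hx2
      · exact absurd (hx2.symm.trans hx) h.ne
      · subst hx; omega
      · omega
      · omega) v
    rw [fout_unit, fin_unit, if_pos rfl, if_neg h.ne] at this
    omega

open Classical in
theorem main1 [DecidableRel G.Adj] {u : V} {b : ℕ} (hU : U = fun w => if w = u then b else 0)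
    (hPu : P u = 0) (hd : G.maxDegree ≤ 1) :
    #{v | isC G P U v} = 0 ∧ ∑ v, cc G P U v = #{v | isD G P U v} ∧
    (G.maxDegree = 0 → #{v | isD G P U v} = 0) := by
  have h0 : ∀ v, P v = 0 ∨ U v = 0 := by
    intro v
    by_cases hv : v = u
    · left; rw [hv]; exact hPu
    · right; simp [hU, hv]
  have hdeg : ∀ a b c, G.Adj a b → G.Adj a c → b = c := by
    intro x y z hy hz
    have h1 : #(G.neighborFinset x) ≤ 1 := by
      rw [SimpleGraph.card_neighborFinset_eq_degree]
      exact (G.degree_le_maxDegree x).trans hd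
    exact Finset.card_le_one.1 h1 _ (by simpa using hy) _ (by simpa using hz)
  have hadd : ∀ v, reach G (P + U) v = reach G P v + reach G U v := by
    intro v
    by_cases hv : ∃ w, G.Adj v w
    · obtain ⟨w, hw⟩ := hv
      rw [reach_deg1 hdeg hw, reach_deg1 hdeg hw, reach_deg1 hdeg hw]
      have := h0 w
      simp only [Pi.add_apply]
      omega
    · push Not at hv
      rw [reach_deg0 hv, reach_deg0 hv, reach_deg0 hv]
      rfl
  refine ⟨?_, ?_, ?_⟩
  · rw [Finset.card_eq_zero, Finset.filter_eq_empty_iff]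
    rintro v - ⟨h1, h2, h3⟩
    have := hadd v
    omega
  · rw [Finset.card_filter]
    refine Finset.sum_congr rfl fun v _ => ?_
    have := hadd v
    unfold cc isD
    split_ifs <;> omega
  · intro hz
    rw [Finset.card_eq_zero, Finset.filter_eq_empty_iff]
    rintro v - ⟨h1, h2⟩
    have hv : ∀ w, ¬ G.Adj v w := by
      intro w hw
      have h3 : 0 < #(G.neighborFinset v) := Finset.card_pos.2 ⟨w, by simpa using hw⟩
      rw [SimpleGraph.card_neighborFinset_eq_degree] at h3
      have := G.degree_le_maxDegree v
      omega
    rw [reach_deg0 hv] at h1 h2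
    have := h0 v
    omega

theorem CE_eq (G : SimpleGraph V) (P U : V → ℕ) : CE G P U = ((∑ v, cc G P U v : ℕ) : ℤ) := by
  have h : TE G (P + U) = TE G P + TE G U + ∑ v, cc G P U v := by
    unfold TE exc
    rw [← Finset.sum_add_distrib, ← Finset.sum_add_distrib]
    refine Finset.sum_congr rfl fun v _ => ?_
    have := reach_super (G := G) P U v
    unfold cc
    omega
  unfold CE
  rw [h]
  push_cast
  ring

open Classical in
theorem coop_eq (G : SimpleGraph V) (P U : V → ℕ) : coop G P U = #{v | isC G P U v} := by
  unfold coop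
  rw [← Set.ncard_coe_finset]
  congr 1
  ext v
  rw [Finset.mem_coe, Finset.mem_filter]
  simp only [Set.mem_ofPred_eq, Finset.mem_univ, true_and, isC, reach_iff]
  omega

open Classical in
theorem DC_eq (G : SimpleGraph V) (P U : V → ℕ) : DC G P U = #{v | isD G P U v} := by
  unfold DC
  rw [← Set.ncard_coe_finset]
  congr 1
  ext v
  rw [Finset.mem_coe, Finset.mem_filter]
  simp only [Set.mem_ofPred_eq, Finset.mem_univ, true_and, isD, reach_iff]

end counting

end Peb

/-- Key Lemma: for `U` a unit with at least two pebbles at `u` and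
`P u = 0`, `coop(P,U) − DC(P,U) ≤ (Δ−2)·CE(P,U)`. -/
theorem stmt10 {V : Type*} [Fintype V] [DecidableEq V] (G : SimpleGraph V)
    [DecidableRel G.Adj]
    (P : V → ℕ) (u : V) (b : ℕ) (hb : 2 ≤ b)
    (U : V → ℕ) (hU : U = fun w => if w = u then b else 0) (hPu : P u = 0) :
    (coop G P U : ℤ) - (DC G P U : ℤ) ≤ ((G.maxDegree : ℤ) - 2) * CE G P U := by
  classical
  rw [Peb.CE_eq, Peb.coop_eq, Peb.DC_eq]
  by_cases hd : G.maxDegree ≤ 1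
  · obtain ⟨h1, h2, h3⟩ := Peb.main1 (G := G) hU hPu hd
    rw [h1, h2]
    rcases Nat.le_one_iff_eq_zero_or_eq_one.1 hd with h | h
    · rw [h3 h, h]; simp
    · rw [h]; push_cast; linarith
  · obtain ⟨d, hd'⟩ : ∃ d, G.maxDegree = d + 2 := ⟨G.maxDegree - 2, by omega⟩
    have h := Peb.main2 (G := G) hb hU hPu hd'
    rw [hd']
    have h' : ((#{v | Peb.isC G P U v} : ℕ) : ℤ) ≤
        (d : ℤ) * ((∑ v, Peb.cc G P U v : ℕ) : ℤ) + ((#{v | Peb.isD G P U v} : ℕ) : ℤ) := by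
      exact_mod_cast h
    have e : ((d + 2 : ℕ) : ℤ) - 2 = d := by push_cast; ring
    rw [e]
    linarith
end

section
/- Let P be a solvable distribution on a graph G with maximum degree Δ ≥ 3, decomposed as a sum of disjoint units U_1,…,U_t (ordered by nondecreasing size). Then Σ_{i=1}^t CE(Σ_{k<i} U_k, U_i) ≥ (|V(G)| − Σ_{i=1}^t cov(U_i)) / (Δ−2). -/
open Finset

section Flow

variable {V : Type*} [Fintype V] [DecidableEq V]

/-- A balanced flow delivering `k` pebbles to `t`. -/
def Bal (G : SimpleGraph V) (p : V → ℕ) (k : ℕ) (t : V) (f : V → V → ℕ) : Prop :=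
  (∀ x y, f x y ≠ 0 → G.Adj x y) ∧
    ∀ v, 2 * ∑ y, f v y + (if v = t then k else 0) ≤ p v + ∑ x, f x v

def fsize (f : V → V → ℕ) : ℕ := ∑ x, ∑ y, f x y

def fedge (a b : V) (x y : V) : ℕ := if x = a ∧ y = b then 1 else 0

lemma fedge_out (a b v : V) : ∑ y, fedge a b v y = if v = a then 1 else 0 := by
  unfold fedge
  by_cases h : v = a <;> simp [h]

lemma fedge_in (a b v : V) : ∑ x, fedge a b x v = if v = b then 1 else 0 := by
  unfold fedge
  by_cases h : v = b <;> simp [h]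

lemma fedge_size (a b : V) : fsize (fedge a b) = 1 := by
  unfold fsize
  simp [fedge_out]

/-- Modify a flow: remove `j` units of `x → t` and add `a` units of `t → x`. -/
lemma Bal.modify {G : SimpleGraph V} {p : V → ℕ} {k : ℕ} {t x : V} {f : V → V → ℕ}
    (h : Bal G p k t f) (hx : f x t ≠ 0) (j a : ℕ) (hj : j ≤ f x t) (hk : j + 2 * a ≤ k) :
    ∃ f', Bal G p (2 * j + a) x f' ∧ fsize f' + j = fsize f + a := by
  have hadj := h.1 x t hx
  have hne : x ≠ t := hadj.ne
  let f' : V → V → ℕ := fun y z => f y z - j * fedge x t y z + a * fedge t x y z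
  have hpt : ∀ y z, f' y z + j * fedge x t y z = f y z + a * fedge t x y z := by
    intro y z
    have : j * fedge x t y z ≤ f y z := by
      unfold fedge
      split_ifs with hc
      · obtain ⟨rfl, rfl⟩ := hc
        simpa using hj
      · simp
    simp only [f']
    omega
  have hout : ∀ v, ∑ z, f' v z + j * (if v = x then 1 else 0) =
      ∑ z, f v z + a * (if v = t then 1 else 0) := by
    intro v
    rw [← fedge_out x t v, ← fedge_out t x v, Finset.mul_sum, Finset.mul_sum,
      ← Finset.sum_add_distrib, ← Finset.sum_add_distrib]
    exact Finset.sum_congr rfl (fun z _ => hpt v z)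
  have hin : ∀ v, ∑ z, f' z v + j * (if v = t then 1 else 0) =
      ∑ z, f z v + a * (if v = x then 1 else 0) := by
    intro v
    rw [← fedge_in x t v, ← fedge_in t x v, Finset.mul_sum, Finset.mul_sum,
      ← Finset.sum_add_distrib, ← Finset.sum_add_distrib]
    exact Finset.sum_congr rfl (fun z _ => hpt z v)
  refine ⟨f', ⟨?_, ?_⟩, ?_⟩
  · intro y z hyz
    by_cases hf : f y z ≠ 0
    · exact h.1 y z hf
    · by_cases hc : y = t ∧ z = x
      · rw [hc.1, hc.2]; exact hadj.symm
      · exfalso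
        apply hyz
        simp only [f', fedge, if_neg hc]
        omega
  · intro v
    have h1 := hout v
    have h2 := hin v
    have h3 := h.2 v
    by_cases hvx : v = x
    · have hvt : v ≠ t := by rw [hvx]; exact hne
      simp only [if_pos hvx, if_neg hvt] at h1 h2 h3 ⊢
      omega
    · by_cases hvt : v = t
      · simp only [if_neg hvx, if_pos hvt] at h1 h2 h3 ⊢
        omega
      · simp only [if_neg hvx, if_neg hvt] at h1 h2 h3 ⊢
        omega
  · have h1 : ∑ v, (∑ z, f' v z + j * (if v = x then 1 else 0)) =
      ∑ v, (∑ z, f v z + a * (if v = t then 1 else 0)) :=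
      Finset.sum_congr rfl (fun v _ => hout v)
    simp only [Finset.sum_add_distrib, ← Finset.mul_sum] at h1
    simpa [fsize] using h1

lemma Bal.add {G : SimpleGraph V} {p p' : V → ℕ} {k k' : ℕ} {t : V} {f f' : V → V → ℕ}
    (h : Bal G p k t f) (h' : Bal G p' k' t f') :
    Bal G (p + p') (k + k') t (fun x y => f x y + f' x y) := by
  refine ⟨?_, ?_⟩
  · intro x y hxy
    by_cases hf : f x y ≠ 0
    · exact h.1 x y hf
    · exact h'.1 x y (fun h0 => hxy (by simp only [h0]; omega))
  · intro v
    have h1 := h.2 v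
    have h2 := h'.2 v
    simp only [Finset.sum_add_distrib, Pi.add_apply]
    split_ifs at * <;> omega

lemma Bal.total {G : SimpleGraph V} {p : V → ℕ} {k : ℕ} {t : V} {f : V → V → ℕ}
    (h : Bal G p k t f) : k ≤ ∑ v, p v := by
  have h1 := Finset.sum_le_sum (fun v (_ : v ∈ (univ : Finset V)) => h.2 v)
  simp only [Finset.sum_add_distrib, ← Finset.mul_sum] at h1
  rw [Finset.sum_comm (f := fun v x => f x v)] at h1
  simp only [Finset.sum_ite_eq', Finset.mem_univ, if_true] at h1
  omega

lemma bal_of_exec {G : SimpleGraph V} (σ : List (PMove V)) : ∀ (p : V → ℕ) (k : ℕ) (t : V),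
    Executable G p σ → k ≤ applySeq p σ t → ∃ f, Bal G p k t f := by
  induction σ with
  | nil =>
    intro p k t _ hk
    refine ⟨fun _ _ => 0, by simp, ?_⟩
    intro v
    simp only [applySeq, List.foldl_nil] at hk
    split_ifs with hv
    · subst hv; simpa using hk
    · simp
  | cons m ms ih =>
    intro p k t hE hk
    obtain ⟨hadj, h2, hE⟩ := hE
    obtain ⟨f, hf⟩ := ih (applyMove p m) k t hE hk
    refine ⟨fun x y => f x y + fedge m.src m.tgt x y, ?_, ?_⟩
    · intro x y hxy
      by_cases hfx : f x y ≠ 0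
      · exact hf.1 x y hfx
      · by_cases hc : x = m.src ∧ y = m.tgt
        · rw [hc.1, hc.2]; exact hadj
        · exfalso; apply hxy
          simp only [fedge, if_neg hc]
          omega
    · intro v
      have h3 := hf.2 v
      have hne := hadj.ne
      simp only [Finset.sum_add_distrib, fedge_out, fedge_in]
      unfold applyMove at h3
      by_cases hv : v = m.src
      · have hv2 : v ≠ m.tgt := by rw [hv]; exact hne
        rw [← hv] at h2
        simp only [if_pos hv, if_neg hv2] at h3 ⊢
        omega
      · by_cases hv2 : v = m.tgt
        · simp only [if_neg hv, if_pos hv2] at h3 ⊢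
          omega
        · simp only [if_neg hv, if_neg hv2] at h3 ⊢
          omega

lemma exec_of_bal {G : SimpleGraph V} (n : ℕ) : ∀ (p : V → ℕ) (k : ℕ) (t : V) (f : V → V → ℕ),
    fsize f = n → Bal G p k t f → KReachable G p k t := by
  induction n with
  | zero =>
    intro p k t f hs hf
    refine ⟨[], trivial, ?_⟩
    have h0 : ∀ x y, f x y = 0 := by
      intro x y
      unfold fsize at hs
      simp only [Finset.sum_eq_zero_iff, Finset.mem_univ, true_imp_iff] at hs
      exact hs x y
    have := hf.2 t
    simpa [h0, applySeq] using this
  | succ n ih =>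
    intro p k t f hs hf
    by_cases hex : ∃ x y, f x y ≠ 0 ∧ 2 ≤ p x
    · obtain ⟨x, y, hxy, hp⟩ := hex
      have hadj := hf.1 x y hxy
      have hne := hadj.ne
      let f' : V → V → ℕ := fun a b => f a b - fedge x y a b
      have hpt : ∀ a b, f' a b + fedge x y a b = f a b := by
        intro a b
        have : fedge x y a b ≤ f a b := by
          unfold fedge
          split_ifs with hc
          · rw [hc.1, hc.2]; omega
          · simp
        simp only [f']
        omega
      have hout : ∀ v, ∑ z, f' v z + (if v = x then 1 else 0) = ∑ z, f v z := by
        intro v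
        rw [← fedge_out x y v, ← Finset.sum_add_distrib]
        exact Finset.sum_congr rfl (fun z _ => hpt v z)
      have hin : ∀ v, ∑ z, f' z v + (if v = y then 1 else 0) = ∑ z, f z v := by
        intro v
        rw [← fedge_in x y v, ← Finset.sum_add_distrib]
        exact Finset.sum_congr rfl (fun z _ => hpt z v)
      have hsz : fsize f' = n := by
        have h1 : ∑ v, (∑ z, f' v z + (if v = x then 1 else 0)) = ∑ v, ∑ z, f v z :=
          Finset.sum_congr rfl (fun v _ => hout v)
        simp only [Finset.sum_add_distrib] at h1
        unfold fsize at hs ⊢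
        simp at h1
        omega
      have hb : Bal G (applyMove p ⟨x, y⟩) k t f' := by
        refine ⟨?_, ?_⟩
        · intro a b hab
          apply hf.1
          have := hpt a b
          omega
        · intro v
          have h1 := hout v
          have h2 := hin v
          have h3 := hf.2 v
          unfold applyMove
          by_cases hv : v = x
          · have hv2 : v ≠ y := by rw [hv]; exact hne
            rw [← hv] at hp
            simp only [if_pos hv, if_neg hv2] at h1 h2 ⊢
            omega
          · by_cases hv2 : v = y
            · simp only [if_neg hv, if_pos hv2] at h1 h2 ⊢
              omega
            · simp only [if_neg hv, if_neg hv2] at h1 h2 ⊢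
              omega
      obtain ⟨σ, hσ, hk⟩ := ih _ k t f' hsz hb
      exact ⟨⟨x, y⟩ :: σ, ⟨hadj, hp, hσ⟩, hk⟩
    · push Not at hex
      -- no move is possible: the flow is a circulation
      have hle : ∀ v, ∑ y, f v y ≤ ∑ x, f x v := by
        intro v
        rcases Nat.eq_zero_or_pos (∑ y, f v y) with h0 | h0
        · omega
        · have : ∃ y, f v y ≠ 0 := by
            by_contra hc
            push Not at hc
            simp [hc] at h0
          obtain ⟨y, hy⟩ := this
          have h1 := hex v y hy
          have h2 := hf.2 v
          omega
      have heq : ∑ v, ∑ y, f v y = ∑ v, ∑ x, f x v := Finset.sum_comm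
      have hpt := (Finset.sum_eq_sum_iff_of_le (fun v _ => hle v)).1 heq t (Finset.mem_univ t)
      refine ⟨[], trivial, ?_⟩
      have := hf.2 t
      simp only [if_true] at this
      simp only [applySeq, List.foldl_nil]
      omega

lemma kreach_iff {G : SimpleGraph V} {p : V → ℕ} {k : ℕ} {t : V} :
    KReachable G p k t ↔ ∃ f, Bal G p k t f :=
  ⟨fun ⟨σ, h1, h2⟩ => bal_of_exec σ p k t h1 h2, fun ⟨f, hf⟩ => exec_of_bal _ p k t f rfl hf⟩

lemma le_reach_iff {G : SimpleGraph V} {p : V → ℕ} {k : ℕ} {t : V} :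
    k ≤ reach G p t ↔ KReachable G p k t := by
  have hbdd : BddAbove {k | KReachable G p k t} := by
    refine ⟨∑ v, p v, ?_⟩
    rintro k hk
    obtain ⟨f, hf⟩ := kreach_iff.1 hk
    exact hf.total
  constructor
  · intro h
    have hne : {k | KReachable G p k t}.Nonempty := ⟨0, [], trivial, Nat.zero_le _⟩
    obtain ⟨σ, h1, h2⟩ := Nat.sSup_mem hne hbdd
    exact ⟨σ, h1, h.trans h2⟩
  · intro h
    exact le_csSup hbdd h

lemma le_reach_bal {G : SimpleGraph V} {p : V → ℕ} {k : ℕ} {t : V} :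
    k ≤ reach G p t ↔ ∃ f, Bal G p k t f := le_reach_iff.trans kreach_iff

lemma reach_ge_self (G : SimpleGraph V) (p : V → ℕ) (t : V) : p t ≤ reach G p t :=
  le_reach_iff.2 ⟨[], trivial, le_rfl⟩

lemma reach_le_total (G : SimpleGraph V) (p : V → ℕ) (t : V) : reach G p t ≤ ∑ v, p v := by
  obtain ⟨f, hf⟩ := le_reach_bal.1 (le_refl (reach G p t))
  exact hf.total

lemma reach_sum {ι : Type*} (G : SimpleGraph V) (U : ι → V → ℕ) (t : V) (s : Finset ι) :
    ∑ i ∈ s, reach G (U i) t ≤ reach G (∑ i ∈ s, U i) t := by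
  classical
  induction s using Finset.induction_on with
  | empty => simp
  | insert a s ha ih =>
    rw [Finset.sum_insert ha, Finset.sum_insert ha]
    obtain ⟨f, hf⟩ := le_reach_bal.1 (le_refl (reach G (U a) t))
    obtain ⟨f', hf'⟩ := le_reach_bal.1 (le_refl (reach G (∑ i ∈ s, U i) t))
    have := le_reach_bal.2 ⟨_, hf.add hf'⟩
    omega

/-- Moving half of the pebbles to a neighbour. -/
lemma reach_adj {G : SimpleGraph V} {p : V → ℕ} {x z : V} (h : G.Adj z x) :
    reach G p z / 2 ≤ reach G p x := by
  obtain ⟨f, hf⟩ := le_reach_bal.1 (le_refl (reach G p z))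
  refine le_reach_bal.2 ⟨fun a b => f a b + (reach G p z / 2) * fedge z x a b, ?_, ?_⟩
  · intro a b hab
    by_cases hfx : f a b ≠ 0
    · exact hf.1 a b hfx
    · by_cases hc : a = z ∧ b = x
      · rw [hc.1, hc.2]; exact h
      · exfalso; apply hab
        simp only [fedge, if_neg hc]
        omega
  · intro v
    have h3 := hf.2 v
    have hne := h.ne
    simp only [Finset.sum_add_distrib, ← Finset.mul_sum, fedge_out, fedge_in]
    by_cases hv : v = z
    · have hv2 : v ≠ x := by rw [hv]; exact hne
      simp only [if_pos hv, if_neg hv2] at h3 ⊢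
      omega
    · by_cases hv2 : v = x
      · simp only [if_neg hv, if_pos hv2] at h3 ⊢
        omega
      · simp only [if_neg hv, if_neg hv2] at h3 ⊢
        omega

/-- Unit distribution. -/
def unitD (u : V) (s : ℕ) : V → ℕ := fun w => if w = u then s else 0

open Classical in
/-- Weight of a vertex with respect to a target. -/
noncomputable def wt (G : SimpleGraph V) (t v : V) : ℚ :=
  if G.Reachable v t then (1 / 2 : ℚ) ^ (G.dist v t) else 0

lemma wt_nonneg (G : SimpleGraph V) (t v : V) : 0 ≤ wt G t v := by
  unfold wt; split_ifs <;> positivity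

lemma wt_adj {G : SimpleGraph V} {t x y : V} (h : G.Adj x y) : wt G t y ≤ 2 * wt G t x := by
  unfold wt
  by_cases hy : G.Reachable y t
  · have hx : G.Reachable x t := h.reachable.trans hy
    rw [if_pos hy, if_pos hx]
    obtain ⟨w, hw⟩ := hy.exists_walk_length_eq_dist
    have hd : G.dist x t ≤ G.dist y t + 1 := by
      rw [← hw]
      exact SimpleGraph.dist_le (SimpleGraph.Walk.cons h w)
    have : (1 / 2 : ℚ) ^ (G.dist y t + 1) ≤ (1 / 2 : ℚ) ^ (G.dist x t) :=
      pow_le_pow_of_le_one (by norm_num) (by norm_num) hd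
    rw [pow_succ] at this
    linarith
  · have hx : ¬ G.Reachable x t := fun hx => hy (h.symm.reachable.trans hx)
    rw [if_neg hy, if_neg hx]; simp

lemma Bal.weight {G : SimpleGraph V} {p : V → ℕ} {k : ℕ} {t : V} {f : V → V → ℕ}
    (h : Bal G p k t f) : (k : ℚ) ≤ ∑ v, (p v : ℚ) * wt G t v := by
  have h1 : ∑ v, (2 * ∑ y, (f v y : ℚ) + (if v = t then (k : ℚ) else 0)) * wt G t v ≤
      ∑ v, ((p v : ℚ) + ∑ x, (f x v : ℚ)) * wt G t v := by
    apply Finset.sum_le_sum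
    intro v _
    apply mul_le_mul_of_nonneg_right _ (wt_nonneg G t v)
    have := h.2 v
    exact_mod_cast this
  simp only [add_mul, Finset.sum_add_distrib, ite_mul, zero_mul, Finset.sum_ite_eq',
    Finset.mem_univ, if_true] at h1
  have hwt : wt G t t = 1 := by simp [wt]
  rw [hwt] at h1
  have h2 : ∑ v, (∑ x, (f x v : ℚ)) * wt G t v ≤ ∑ v, 2 * (∑ y, (f v y : ℚ)) * wt G t v := by
    simp only [Finset.sum_mul, Finset.mul_sum]
    rw [Finset.sum_comm]
    apply Finset.sum_le_sum
    intro x _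
    apply Finset.sum_le_sum
    intro y _
    by_cases hf : f x y = 0
    · simp [hf]
    · have := wt_adj (t := t) (h.1 x y hf)
      have h0 : (0 : ℚ) ≤ f x y := by positivity
      nlinarith
  linarith

lemma unit_reach_walk {G : SimpleGraph V} {u : V} {s : ℕ} {v : V} (w : G.Walk v u) :
    s / 2 ^ w.length ≤ reach G (unitD u s) v := by
  induction w with
  | nil =>
    rename_i a
    have := reach_ge_self G (unitD a s) a
    simpa [unitD] using this
  | cons h w ih =>
    refine le_trans ?_ (reach_adj h.symm)
    rw [SimpleGraph.Walk.length_cons, pow_succ, ← Nat.div_div_eq_div_mul]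
    exact Nat.div_le_div_right ih

lemma unit_reach_self (G : SimpleGraph V) (u : V) (s : ℕ) : reach G (unitD u s) u = s := by
  apply le_antisymm
  · have := reach_le_total G (unitD u s) u
    simpa [unitD] using this
  · have := reach_ge_self G (unitD u s) u
    simpa [unitD] using this

lemma unit_parent {G : SimpleGraph V} {u : V} {s : ℕ} {v : V} (hv : v ≠ u)
    (h1 : 1 ≤ reach G (unitD u s) v) :
    ∃ z, G.Adj v z ∧ 2 * reach G (unitD u s) v ≤ reach G (unitD u s) z := by
  obtain ⟨f, hf⟩ := le_reach_bal.1 (le_refl (reach G (unitD u s) v))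
  have hw := hf.weight
  have hsum : ∑ x, ((unitD u s x : ℕ) : ℚ) * wt G v x = s * wt G v u := by
    simp [unitD]
  rw [hsum] at hw
  have hr : G.Reachable u v := by
    by_contra hr
    rw [wt, if_neg hr] at hw
    simp at hw
    omega
  rw [wt, if_pos hr] at hw
  obtain ⟨w, hwl⟩ := hr.symm.exists_walk_length_eq_dist
  rw [SimpleGraph.dist_comm] at hwl
  cases w with
  | nil => exact absurd rfl hv
  | cons h w =>
    refine ⟨_, h, le_trans ?_ (unit_reach_walk w)⟩
    rw [SimpleGraph.Walk.length_cons] at hwl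
    rw [← hwl, pow_succ, one_div, inv_pow] at hw
    rw [Nat.le_div_iff_mul_le (by positivity)]
    have hpos : (0 : ℚ) < 2 ^ w.length := by positivity
    have : (reach G (unitD u s) v : ℚ) * (2 * 2 ^ w.length) ≤ s := by
      calc (reach G (unitD u s) v : ℚ) * (2 * 2 ^ w.length)
          ≤ (s * ((2 ^ w.length)⁻¹ * 2⁻¹)) * (2 * 2 ^ w.length) := by
            apply mul_le_mul_of_nonneg_right _ (by positivity)
            simpa using hw
        _ = s := by field_simp
    have h3 : reach G (unitD u s) v * (2 * 2 ^ w.length) ≤ s := by exact_mod_cast this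
    linarith

end Flow

/-- Abstract data for the discharging argument. -/
structure PData (V ι : Type*) [Fintype V] [DecidableEq V] [Fintype ι] where
  N : V → Finset V
  Δ : ℕ
  r : V → ℕ
  P : V → ℕ
  ρ : ι → V → ℕ
  u : ι → V
  c : ℕ → V → ℕ
  I : ℕ → V → Finset V
  hΔ : 3 ≤ Δ
  hN : ∀ v, (N v).card ≤ Δ
  hsymm : ∀ x y, x ∈ N y → y ∈ N x
  hirr : ∀ x, x ∉ N x
  h1 : ∀ v, 1 ≤ r v
  hsup : ∀ v, ∑ i, ρ i v ≤ r v
  hPu : ∀ v, 1 ≤ P v → ∃ i, u i = v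
  hcen : ∀ i, ρ i (u i) = P (u i)
  hadj : ∀ i x z, x ∈ N z → ρ i z / 2 ≤ ρ i x
  hpar : ∀ i v, v ≠ u i → 1 ≤ ρ i v → ∃ z ∈ N v, 2 * ρ i v ≤ ρ i z
  hle : ∀ i v, ρ i v ≤ P (u i)
  hI : ∀ k t, k ≤ r t → P t < k → (I k t).Nonempty
  hIN : ∀ k t x, k ≤ r t → x ∈ I k t → x ∈ N t
  hL : ∀ k t x a, k ≤ r t → x ∈ I k t → 2 * a + 1 ≤ k →
    2 + a ≤ r x ∧ c (2 + a) x + 1 ≤ c k t + a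
  hL3 : ∀ k t x j, k ≤ r t → I k t = {x} → P t + j ≤ k →
    2 * j ≤ r x ∧ c (2 * j) x + j ≤ c k t

namespace PData

variable {V ι : Type*} [Fintype V] [DecidableEq V] [Fintype ι] (S : PData V ι)

def W (v : V) : Prop := 2 ≤ S.r v ∧ ∀ i, S.ρ i v ≤ 1

def K (v : V) : Prop := ∀ i, S.ρ i v = 0

open Classical in
noncomputable def m (v : V) : ℕ := (univ.filter (fun i => 1 ≤ S.ρ i v)).card

noncomputable def ce (v : V) : ℤ := (S.r v : ℤ) - 1 - ∑ i, ((S.ρ i v - 1 : ℕ) : ℤ)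

def DW (v : V) : Prop := S.W v ∧ S.m v ≤ 1 ∧ ∃ z, S.I 2 v = {z}

/-- `v` is hard for unit `i` with unique in-neighbour `z`. -/
def HardAt (v : V) (i : ι) (z : V) : Prop :=
  2 ≤ S.ρ i v ∧ (∀ j, 1 ≤ S.ρ j v → j = i) ∧ S.r v = S.ρ i v + 1 ∧
    S.I (S.r v) v = {z} ∧ (v = S.u i ∨ 2 * S.ρ i v ≤ S.ρ i z)

def Hard (v : V) : Prop := ∃ i z, S.HardAt v i z

def D (v : V) : Prop := S.DW v ∨ S.Hard v

lemma m_eq_zero {v : V} (h : S.K v) : S.m v = 0 := by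
  simp [m, h _]

lemma m_pos {v : V} {i : ι} (h : 1 ≤ S.ρ i v) : 1 ≤ S.m v := by
  unfold m
  exact Finset.card_pos.2 ⟨i, by simpa using h⟩

lemma uniq_of_m {v : V} (h : S.m v ≤ 1) {i j : ι} (hi : 1 ≤ S.ρ i v) (hj : 1 ≤ S.ρ j v) :
    i = j := by
  unfold m at h
  exact Finset.card_le_one.1 h i (by simpa using hi) j (by simpa using hj)

lemma sum_eq (v : V) : ∑ i, (S.ρ i v : ℤ) = ∑ i, ((S.ρ i v - 1 : ℕ) : ℤ) + S.m v := by
  classical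
  unfold m
  rw [Finset.card_filter]
  push_cast
  rw [← Finset.sum_add_distrib]
  apply Finset.sum_congr rfl
  intro i _
  split_ifs <;> omega

lemma ce_ge (v : V) : (S.m v : ℤ) - 1 ≤ S.ce v := by
  have h := S.sum_eq v
  have h2 := S.hsup v
  have h3 : ∑ i, (S.ρ i v : ℤ) ≤ S.r v := by exact_mod_cast h2
  unfold ce
  linarith

lemma ce_W {v : V} (h : ∀ i, S.ρ i v ≤ 1) : S.ce v = S.r v - 1 := by
  unfold ce
  rw [Finset.sum_eq_zero]
  · simp
  · intro i _
    have := h i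
    omega

lemma ce_Z {v : V} {j : ι} (hj : 2 ≤ S.ρ j v) (h : ∀ i, 2 ≤ S.ρ i v → i = j) :
    S.ce v = S.r v - S.ρ j v := by
  unfold ce
  rw [Finset.sum_eq_single j]
  · omega
  · intro i _ hi
    have : ¬ 2 ≤ S.ρ i v := fun h' => hi (h i h')
    omega
  · simp

lemma ce_nonneg (v : V) : 0 ≤ S.ce v := by
  by_cases h : ∃ i, 1 ≤ S.ρ i v
  · obtain ⟨i, hi⟩ := h
    have := S.m_pos hi
    have := S.ce_ge v
    omega
  · push Not at h
    rw [S.ce_W (fun i => by have := h i; omega)]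
    have := S.h1 v
    omega

/-- Neighbours of a vertex with `ρ ≥ 2` are covered. -/
lemma cov_nbr {i : ι} {x z : V} (h : x ∈ S.N z) (hz : 2 ≤ S.ρ i z) : 1 ≤ S.ρ i x := by
  have := S.hadj i x z h
  omega

lemma P_le {v : V} (h : 1 ≤ S.P v) : ∃ i, S.u i = v ∧ S.ρ i v = S.P v := by
  obtain ⟨i, rfl⟩ := S.hPu v h
  exact ⟨i, rfl, S.hcen i⟩

lemma W_P {v : V} (h : S.W v) : S.P v ≤ 1 := by
  by_contra hc
  obtain ⟨i, hi, h2⟩ := S.P_le (v := v) (by omega)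
  have := h.2 i
  omega

lemma K_P {v : V} (h : S.K v) : S.P v = 0 := by
  by_contra hc
  obtain ⟨i, hi, h2⟩ := S.P_le (v := v) (by omega)
  have := h i
  omega

lemma I2 {w x : V} (hw : 2 ≤ S.r w) (hx : x ∈ S.I 2 w) : 2 ≤ S.r x ∧ S.c 2 x < S.c 2 w := by
  have := S.hL 2 w x 0 hw hx (by omega)
  simpa using this

lemma K_not_hard {v : V} (h : S.K v) : ¬ S.Hard v := by
  rintro ⟨i, z, h1, _⟩
  have := h i
  omega

lemma W_not_hard {v : V} (h : S.W v) : ¬ S.Hard v := by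
  rintro ⟨i, z, h1, _⟩
  have := h.2 i
  omega

/-- The choice of receivers. -/
structure Recv (p q : V → V) : Prop where
  pK : ∀ v, S.K v → p v ∈ S.N v ∧ 2 ≤ S.r (p v) ∧ (2 ≤ S.r v → p v ∈ S.I 2 v)
  qW : ∀ v, S.DW v → S.I 2 v = {q v}
  qH : ∀ v, S.Hard v → ∃ i, S.HardAt v i (q v)

lemma exists_recv : ∃ p q, S.Recv p q := by
  classical
  have hp : ∀ v, ∃ w, S.K v → w ∈ S.N v ∧ 2 ≤ S.r w ∧ (2 ≤ S.r v → w ∈ S.I 2 v) := by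
    intro v
    by_cases hK : S.K v
    · have hP := S.K_P hK
      by_cases h2 : 2 ≤ S.r v
      · obtain ⟨w, hw⟩ := S.hI 2 v h2 (by omega)
        exact ⟨w, fun _ => ⟨S.hIN _ _ _ h2 hw, (S.I2 h2 hw).1, fun _ => hw⟩⟩
      · have h1 := S.h1 v
        obtain ⟨w, hw⟩ := S.hI 1 v h1 (by omega)
        exact ⟨w, fun _ => ⟨S.hIN _ _ _ h1 hw, (S.hL 1 v w 0 h1 hw (by omega)).1,
          fun h => absurd h h2⟩⟩
    · exact ⟨v, fun h => absurd h hK⟩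
  have hq : ∀ v, ∃ z, (S.DW v → S.I 2 v = {z}) ∧ (S.Hard v → ∃ i, S.HardAt v i z) := by
    intro v
    by_cases hW : S.DW v
    · obtain ⟨z, hz⟩ := hW.2.2
      exact ⟨z, fun _ => hz, fun h => absurd h (S.W_not_hard hW.1)⟩
    · by_cases hH : S.Hard v
      · obtain ⟨i, z, hz⟩ := hH
        exact ⟨z, fun h => absurd h hW, fun _ => ⟨i, hz⟩⟩
      · exact ⟨v, fun h => absurd h hW, fun h => absurd h hH⟩
  choose p hp using hp
  choose q hq using hq
  exact ⟨p, q, hp, fun v => (hq v).1, fun v => (hq v).2⟩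

variable {p q : V → V}

lemma hard_mem {y z : V} {i : ι} (h : S.HardAt y i z) : z ∈ S.I (S.r y) y := by
  rw [h.2.2.2.1]; simp

lemma hard_nbr {y z : V} {i : ι} (h : S.HardAt y i z) : z ∈ S.N y :=
  S.hIN _ _ _ le_rfl (S.hard_mem h)

/-- A hard centre strongly boosts its receiver. -/
lemma hard_center {i : ι} {z : V} (h : S.HardAt (S.u i) i z) :
    S.P (S.u i) / 2 + 2 ≤ S.r z := by
  have h1 := S.hcen i
  have h2 := h.2.2.1
  have := (S.hL _ _ z (S.P (S.u i) / 2) le_rfl (S.hard_mem h) (by omega)).1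
  omega

/-- A hard vertex which sends to a vertex of type W. -/
lemma hard_to_W {i : ι} {y w : V} (h : S.HardAt y i w) (hw : S.W w) :
    y = S.u i ∧ 1 ≤ S.ρ i w ∧ S.r y ≤ 4 ∧ 3 ≤ S.r w := by
  have hn := S.hard_nbr h
  have hw1 := hw.2 i
  have ha := S.hadj i w y (hn |> S.hsymm _ _ |> S.hsymm _ _)
  obtain ⟨h1, h2, h3, h4, h5⟩ := id h
  have hy : y = S.u i := by
    rcases h5 with h5 | h5
    · exact h5
    · omega
  refine ⟨hy, by omega, by omega, ?_⟩
  subst hy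
  have := S.hard_center h
  have := S.hcen i
  omega

open Classical in
noncomputable def A (p : V → V) (v : V) : Finset V := univ.filter (fun x => S.K x ∧ p x = v)

open Classical in
noncomputable def B (q : V → V) (v : V) : Finset V := univ.filter (fun x => S.D x ∧ q x = v)

lemma mem_A {x v : V} : x ∈ S.A p v ↔ S.K x ∧ p x = v := by simp [A]

lemma mem_B {x v : V} : x ∈ S.B q v ↔ S.D x ∧ q x = v := by simp [B]

lemma A_sub (h : S.Recv p q) (v : V) : S.A p v ⊆ S.N v := by
  intro x hx
  obtain ⟨hK, rfl⟩ := S.mem_A.1 hx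
  exact S.hsymm _ _ (h.pK x hK).1

lemma B_sub (h : S.Recv p q) (v : V) : S.B q v ⊆ S.N v := by
  intro x hx
  obtain ⟨hD, rfl⟩ := S.mem_B.1 hx
  apply S.hsymm
  rcases hD with hD | hD
  · exact S.hIN 2 x _ hD.1.1 (by rw [h.qW x hD]; simp)
  · obtain ⟨i, hi⟩ := h.qH x hD
    exact S.hard_nbr hi

lemma A_r (h : S.Recv p q) {x v : V} (hx : x ∈ S.A p v) : 2 ≤ S.r v := by
  obtain ⟨hK, rfl⟩ := S.mem_A.1 hx
  exact (h.pK x hK).2.1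

lemma A_I2 (h : S.Recv p q) {x w : V} (hw : 2 ≤ S.r w) (hx : x ∈ S.A p w) : x ∉ S.I 2 w := by
  intro hI
  obtain ⟨hK, rfl⟩ := S.mem_A.1 hx
  have h1 := S.I2 hw hI
  have h2 := S.I2 h1.1 ((h.pK x hK).2.2 h1.1)
  omega

lemma DW_I2 (h : S.Recv p q) {x w : V} (hw : 2 ≤ S.r w) (hx : S.DW x) (hq : q x = w) :
    x ∉ S.I 2 w := by
  intro hI
  subst hq
  have h1 := S.I2 hw hI
  have h2 := S.I2 h1.1 (x := q x) (by rw [h.qW x hx]; simp)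
  omega

/-- Double senders. -/
lemma double (h : S.Recv p q) {x w : V} (hA : x ∈ S.A p w) (hB : x ∈ S.B q w) :
    4 ≤ S.r w ∧ S.c 4 w + 2 ≤ S.c 2 x := by
  obtain ⟨hK, _⟩ := S.mem_A.1 hA
  obtain ⟨hD, rfl⟩ := S.mem_B.1 hB
  rcases hD with hD | hD
  · have := S.K_P hK
    exact S.hL3 2 x (q x) 2 hD.1.1 (h.qW x hD) (by omega)
  · exact absurd hD (S.K_not_hard hK)

end PData

namespace PData

variable {V ι : Type*} [Fintype V] [DecidableEq V] [Fintype ι] (S : PData V ι)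
variable {p q : V → V}

lemma two_disj {A B N : Finset V} {d : ℕ} (hA : A ⊆ N) (hB : B ⊆ N) (hN : N.card ≤ d)
    (I : Finset V) (hI : I ⊆ N) (hd : ∀ x ∈ I, x ∉ A ∧ x ∉ B) :
    (A ∪ B).card + I.card ≤ d := by
  rw [← Finset.card_union_of_disjoint]
  · exact (Finset.card_le_card (Finset.union_subset (Finset.union_subset hA hB) hI)).trans hN
  · rw [Finset.disjoint_right]
    intro x hx
    simp [hd x hx]

lemma inter_disj {A B N : Finset V} {d : ℕ} (hA : A ⊆ N) (hN : N.card ≤ d)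
    (I : Finset V) (hI : I ⊆ N) (hd : ∀ x ∈ I, ¬ (x ∈ A ∧ x ∈ B)) :
    (A ∩ B).card + I.card ≤ d := by
  rw [← Finset.card_union_of_disjoint]
  · exact (Finset.card_le_card (Finset.union_subset
      (Finset.inter_subset_left.trans hA) hI)).trans hN
  · rw [Finset.disjoint_right]
    intro x hx
    simpa using hd x hx

open Classical in
/-- Local inequality at a vertex of type W. -/
lemma local_W (h : S.Recv p q) {w : V} (hw : S.W w) :
    (((S.A p w).card + (S.B q w).card : ℕ) : ℤ) ≤ ((S.Δ : ℤ) - 2) * S.ce w + S.m w - 1 +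
      (if S.K w then 1 else 0) + (if S.D w then 1 else 0) := by
  have hΔ := S.hΔ
  have hN := S.hN w
  have hA := S.A_sub h w
  have hB := S.B_sub h w
  have hr := hw.1
  have hP := S.W_P hw
  have hIne : (S.I 2 w).Nonempty := S.hI 2 w hr (by omega)
  have hIN : S.I 2 w ⊆ S.N w := fun x hx => S.hIN _ _ _ hr hx
  have hIc : 1 ≤ (S.I 2 w).card := Finset.card_pos.2 hIne
  have hce := S.ce_W hw.2
  -- slack
  obtain ⟨s, hs0, hs1, hs⟩ : ∃ s : ℤ, 0 ≤ s ∧ ((2 ≤ S.m w ∨ (S.I 2 w).card = 1) → 1 ≤ s) ∧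
      s ≤ (S.m w : ℤ) - 1 + (if S.K w then 1 else 0) + (if S.D w then 1 else 0) := by
    have hmu : (if S.K w then (1 : ℤ) else 0) + S.m w ≥ 1 := by
      split_ifs with hK
      · omega
      · unfold K at hK
        push Not at hK
        obtain ⟨i, hi⟩ := hK
        have := S.m_pos (i := i) (v := w) (by omega)
        omega
    have hK0 : (0 : ℤ) ≤ if S.K w then (1 : ℤ) else 0 := by split_ifs <;> simp
    have hD0 : (0 : ℤ) ≤ if S.D w then (1 : ℤ) else 0 := by split_ifs <;> simp
    refine ⟨_, by linarith, ?_, le_rfl⟩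
    intro hc
    by_cases hm : 2 ≤ S.m w
    · omega
    · have hD : S.D w := by
        rcases hc with hc | hc
        · exact absurd hc hm
        · exact Or.inl ⟨hw, by omega, Finset.card_eq_one.1 hc⟩
      rw [if_pos hD]
      linarith
  suffices hmain : (((S.A p w).card + (S.B q w).card : ℕ) : ℤ) ≤
      ((S.Δ : ℤ) - 2) * (S.r w - 1) + s by
    rw [hce]; linarith
  -- hard senders
  set H : Finset V := (S.B q w).filter (fun x => S.Hard x) with hH
  have hHmem : ∀ x ∈ H, ∃ i, S.HardAt x i w := by
    intro x hx
    obtain ⟨hxB, hxH⟩ := Finset.mem_filter.1 hx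
    obtain ⟨hD, rfl⟩ := S.mem_B.1 hxB
    exact h.qH x hxH
  have hH1 : S.m w ≤ 1 → H.card ≤ 1 := by
    intro hm
    rw [Finset.card_le_one]
    intro a ha b hb
    obtain ⟨i, hi⟩ := hHmem a ha
    obtain ⟨j, hj⟩ := hHmem b hb
    have h1 := S.hard_to_W hi hw
    have h2 := S.hard_to_W hj hw
    have := S.uniq_of_m hm h1.2.1 h2.2.1
    rw [h1.1, h2.1, this]
  have hAI : ∀ x ∈ S.I 2 w, x ∉ S.A p w := fun x hx hxA => S.A_I2 h hr hxA hx
  have hBI : ∀ x ∈ S.I 2 w, x ∉ H → x ∉ S.B q w := by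
    intro x hx hxH hxB
    have hxB' := hxB
    obtain ⟨hD, hq⟩ := S.mem_B.1 hxB
    rcases hD with hD | hD
    · exact S.DW_I2 h hr hD hq hx
    · exact hxH (Finset.mem_filter.2 ⟨hxB', hD⟩)
  have hcard : (S.A p w).card + (S.B q w).card =
      (S.A p w ∪ S.B q w).card + (S.A p w ∩ S.B q w).card :=
    (Finset.card_union_add_card_inter _ _).symm
  have hU := two_disj hA hB hN (S.I 2 w \ H) (Finset.sdiff_subset.trans hIN) (by
    intro x hx
    obtain ⟨h1, h2⟩ := Finset.mem_sdiff.1 hx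
    exact ⟨hAI x h1, hBI x h1 h2⟩)
  have hsd : (S.I 2 w).card ≤ (S.I 2 w \ H).card + H.card := by
    have := Finset.le_card_sdiff H (S.I 2 w)
    omega
  by_cases hr4 : 4 ≤ S.r w
  · -- r ≥ 4
    have hI4N : S.I 4 w ⊆ S.N w := fun x hx => S.hIN _ _ _ hr4 hx
    have hX := inter_disj (B := S.B q w) hA hN (S.I 2 w ∪ S.I 4 w)
      (Finset.union_subset hIN hI4N) (by
      rintro x hx ⟨h1, h2⟩
      rcases Finset.mem_union.1 hx with hx | hx
      · exact hAI x hx h1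
      · have h3 := S.double h h1 h2
        have h4 := (S.hL 4 w x 0 hr4 hx (by omega)).2
        simp at h4
        omega)
    have hI4 : (S.I 4 w).Nonempty := S.hI 4 w hr4 (by omega)
    have key : ((S.A p w).card + (S.B q w).card : ℤ) ≤ 3 * ((S.Δ : ℤ) - 2) + s := by
      have hle : (S.I 2 w).card ≤ (S.I 2 w ∪ S.I 4 w).card :=
        Finset.card_le_card Finset.subset_union_left
      by_cases hc : 2 ≤ S.m w ∨ (S.I 2 w).card = 1
      · have hs1 := hs1 hc
        have : 2 ≤ (S.I 2 w \ H).card + (S.I 2 w ∪ S.I 4 w).card := by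
          by_contra hcon
          have hc1 : (S.I 2 w ∪ S.I 4 w).card = 1 := by omega
          have hc0 : (S.I 2 w \ H).card = 0 := by omega
          obtain ⟨x, hx⟩ := Finset.card_eq_one.1 hc1
          have hI4x : S.I 4 w = {x} := by
            apply (Finset.Nonempty.subset_singleton_iff hI4).1
            rw [← hx]; exact Finset.subset_union_right
          have hI2x : S.I 2 w = {x} := by
            apply (Finset.Nonempty.subset_singleton_iff hIne).1
            rw [← hx]; exact Finset.subset_union_left
          have hxH : x ∈ H := by
            have := Finset.sdiff_eq_empty_iff_subset.1 (Finset.card_eq_zero.1 hc0)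
            apply this
            rw [hI2x]; simp
          obtain ⟨i, hi⟩ := hHmem x hxH
          have h1 := (S.hard_to_W hi hw).2.2.1
          have h2 := (S.hL3 4 w x 3 hr4 hI4x (by omega)).1
          omega
        omega
      · push Not at hc
        have := hH1 (by omega)
        omega
    have h3 : 3 * ((S.Δ : ℤ) - 2) ≤ ((S.Δ : ℤ) - 2) * (S.r w - 1) := by
      nlinarith
    push_cast
    linarith
  · have hX : (S.A p w ∩ S.B q w).card = 0 := by
      rw [Finset.card_eq_zero, Finset.eq_empty_iff_forall_notMem]
      intro x hx
      obtain ⟨h1, h2⟩ := Finset.mem_inter.1 hx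
      exact hr4 (S.double h h1 h2).1
    by_cases hr3 : S.r w = 3
    · rw [hr3]
      by_cases hc : 2 ≤ S.m w ∨ (S.I 2 w).card = 1
      · have hs1 := hs1 hc
        push_cast
        omega
      · push Not at hc
        have := hH1 (by omega)
        push_cast
        omega
    · have hr2 : S.r w = 2 := by omega
      have hH0 : H.card = 0 := by
        rw [Finset.card_eq_zero, Finset.eq_empty_iff_forall_notMem]
        intro x hx
        obtain ⟨i, hi⟩ := hHmem x hx
        have := (S.hard_to_W hi hw).2.2.2
        omega
      rw [hr2]
      by_cases hc : 2 ≤ S.m w ∨ (S.I 2 w).card = 1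
      · have hs1 := hs1 hc
        push_cast
        omega
      · push Not at hc
        push_cast
        omega

/-- Senders to a vertex of type Z are covered by just one unit. -/
lemma B_Z (h : S.Recv p q) {x z : V} {j : ι} (hj : 2 ≤ S.ρ j z) (hx : x ∈ S.B q z) :
    (∀ i, 2 ≤ S.ρ i z → i = j) ∧ x ∈ S.N z ∧ S.ρ j z + 1 ≤ S.r z ∧
    ((x = S.u j ∧ S.HardAt x j z ∧ S.ρ j z + 2 ≤ S.r z) ∨
     (x ≠ S.u j ∧ S.ρ j x = S.ρ j z / 2 ∧
      2 * (S.ρ j z / 2 + 1) ≤ S.r z ∧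
      ((S.ρ j z / 2 = 1 ∧ S.c 4 z < S.c 2 x) ∨ S.r x = S.ρ j z / 2 + 1))) := by
  have hxN := S.B_sub h z hx
  obtain ⟨hD, hq⟩ := S.mem_B.1 hx
  have hxj := S.cov_nbr hxN hj
  rcases hD with hD | hD
  · have hu : ∀ i, 2 ≤ S.ρ i z → i = j := fun i hi =>
      S.uniq_of_m hD.2.1 (S.cov_nbr hxN hi) hxj
    have hI := h.qW x hD
    rw [hq] at hI
    have hρx := hD.1.2 j
    have ha := S.hadj j x z hxN
    have hP : S.P x = 0 := by
      by_contra hP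
      have hP1 := S.W_P hD.1
      obtain ⟨i, hi, hi2⟩ := S.P_le (v := x) (by omega)
      have : i = j := S.uniq_of_m hD.2.1 (by omega) hxj
      subst this
      have := S.hle i z
      rw [hi] at this
      omega
    have hL3 := S.hL3 2 x z 2 hD.1.1 hI (by omega)
    norm_num at hL3
    have hxu : x ≠ S.u j := by
      intro hxu
      have := S.hcen j
      rw [← hxu] at this
      omega
    refine ⟨hu, hxN, by omega, Or.inr ⟨hxu, by omega, by omega, Or.inl ⟨by omega, by omega⟩⟩⟩
  · obtain ⟨i, hi⟩ := h.qH x hD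
    rw [hq] at hi
    have hij : j = i := hi.2.1 j hxj
    subst hij
    have hu : ∀ i, 2 ≤ S.ρ i z → i = j := fun i hi' =>
      hi.2.1 i (S.cov_nbr hxN hi')
    have ha := S.hadj j x z hxN
    by_cases hxu : x = S.u j
    · have hi' := hi
      rw [hxu] at hi'
      have hc := S.hard_center hi'
      have hzu : z ≠ S.u j := by
        intro hzu
        rw [hxu, ← hzu] at hxN
        exact S.hirr z hxN
      obtain ⟨y, hy, hy2⟩ := S.hpar j z hzu (by omega)
      have := S.hle j y
      exact ⟨hu, hxN, by omega, Or.inl ⟨hxu, hi, by omega⟩⟩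
    · have h5 := hi.2.2.2.2.resolve_left hxu
      have hP : S.P x = 0 := by
        by_contra hP
        obtain ⟨i', hi1, hi2⟩ := S.P_le (v := x) (by omega)
        have := hi.2.1 i' (by omega)
        subst this
        exact hxu hi1.symm
      have hr := hi.2.2.1
      have hL3 := S.hL3 _ x z (S.r x) le_rfl hi.2.2.2.1 (by omega)
      exact ⟨hu, hxN, by omega, Or.inr ⟨hxu, by omega, by omega, Or.inr (by omega)⟩⟩

end PData

namespace PData

variable {V ι : Type*} [Fintype V] [DecidableEq V] [Fintype ι] (S : PData V ι)
variable {p q : V → V}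

open Classical in
/-- Local inequality at a vertex of type Z. -/
lemma local_Z (h : S.Recv p q) {z : V} {j : ι} (hj : 2 ≤ S.ρ j z) :
    (((S.A p z).card + (S.B q z).card : ℕ) : ℤ) ≤ ((S.Δ : ℤ) - 2) * S.ce z + S.m z - 1 +
      (if S.K z then 1 else 0) + (if S.D z then 1 else 0) := by
  have hΔ := S.hΔ
  have hN := S.hN z
  have hB := S.B_sub h z
  have hm1 : 1 ≤ S.m z := S.m_pos (i := j) (by omega)
  have hA0 : (S.A p z).card = 0 := by
    rw [Finset.card_eq_zero, Finset.eq_empty_iff_forall_notMem]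
    intro x hx
    have h1 := S.cov_nbr (S.A_sub h z hx) hj
    have := (S.mem_A.1 hx).1 j
    omega
  have hD0 : (0 : ℤ) ≤ if S.D z then (1 : ℤ) else 0 := by split_ifs <;> simp
  have hK0 : (if S.K z then (1 : ℤ) else 0) = 0 := by
    rw [if_neg]
    intro hK
    have := hK j
    omega
  rw [hA0, hK0]
  have hce0 := S.ce_nonneg z
  rcases Finset.eq_empty_or_nonempty (S.B q z) with hBe | ⟨x0, hx0⟩
  · rw [hBe]
    simp only [Finset.card_empty]
    push_cast
    have : 0 ≤ ((S.Δ : ℤ) - 2) * S.ce z := mul_nonneg (by omega) hce0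
    omega
  obtain ⟨huniq, -, hr1, -⟩ := S.B_Z h hj hx0
  have hce := S.ce_Z hj huniq
  by_cases hnu : ∀ x ∈ S.B q z, x = S.u j
  · have hc : (S.B q z).card ≤ 1 := by
      rw [Finset.card_le_one]
      intro a ha b hb
      rw [hnu a ha, hnu b hb]
    have : (1 : ℤ) ≤ ((S.Δ : ℤ) - 2) * S.ce z := by
      rw [hce]
      nlinarith
    push_cast
    omega
  push Not at hnu
  obtain ⟨x, hx, hxu⟩ := hnu
  set ρ := S.ρ j z with hρ
  have hR : 2 * (ρ / 2 + 1) ≤ S.r z := by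
    rcases (S.B_Z h hj hx).2.2.2 with h1 | h1
    · exact absurd h1.1 hxu
    · exact h1.2.2.1
  set R := 2 * (ρ / 2 + 1) with hRdef
  have hPz : S.P z < R := by
    by_contra hP
    obtain ⟨i, hi, hi2⟩ := S.P_le (v := z) (by omega)
    have := huniq i (by omega)
    subst this
    omega
  have hIne : (S.I R z).Nonempty := S.hI R z hR hPz
  have hIN : S.I R z ⊆ S.N z := fun x hx => S.hIN _ _ _ hR hx
  -- in-neighbours other than the centre are not senders
  have hIB : ∀ v ∈ S.I R z, v ≠ S.u j → v ∉ S.B q z := by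
    intro v hv hvu hvB
    have h1 := (S.hL R z v (ρ / 2) hR hv (by omega)).1
    rcases (S.B_Z h hj hvB).2.2.2 with h2 | ⟨-, h2, h3, h4⟩
    · exact hvu h2.1
    · rcases h4 with ⟨h4, h5⟩ | h4
      · have hR4 : R = 4 := by omega
        have h6 := (S.hL R z v 0 hR hv (by omega)).2
        rw [hR4] at h6
        norm_num at h6
        omega
      · omega
  by_cases huB : S.u j ∈ S.B q z
  · -- the centre sends to z
    have hb := (S.B_Z h hj huB).2.2.2
    rcases hb with ⟨-, hH, hr2⟩ | ⟨hb, -⟩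
    swap
    · exact absurd rfl hb
    have hzu : z ≠ S.u j := by
      intro hzu
      have := hB huB
      rw [← hzu] at this
      exact S.hirr z this
    have hle : (S.B q z).card ≤ S.Δ := (Finset.card_le_card hB).trans hN
    have hmul : 2 * ((S.Δ : ℤ) - 2) ≤ ((S.Δ : ℤ) - 2) * S.ce z := by
      rw [hce]; nlinarith
    by_cases hm2 : 2 ≤ S.m z
    · push_cast
      omega
    · have hP0 : S.P z = 0 := by
        by_contra hP
        obtain ⟨i, hi, hi2⟩ := S.P_le (v := z) (by omega)
        have : i = j := S.uniq_of_m (by omega) (by omega : 1 ≤ S.ρ i z) (by omega)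
        subst this
        exact hzu hi.symm
      have hex : ∃ v ∈ S.I R z, v ≠ S.u j := by
        by_contra hcon
        push Not at hcon
        have hI1 : S.I R z = {S.u j} := by
          apply (Finset.Nonempty.subset_singleton_iff hIne).1
          intro v hv
          simpa using hcon v hv
        have h1 := S.hL3 R z (S.u j) R hR hI1 (by omega)
        have h2 := hH.2.2.1
        have h3 := S.hcen j
        obtain ⟨y, hy, hy2⟩ := S.hpar j z hzu (by omega)
        have h4 := S.hle j y
        have h4' := S.hadj j z (S.u j) (S.hard_nbr hH)
        have h5 : S.r (S.u j) = 2 * R := by omega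
        have h6 := (S.hL _ _ z (R - 2) le_rfl (S.hard_mem hH) (by omega)).2
        rw [h5] at h6
        have h7 : 2 + (R - 2) = R := by omega
        rw [h7] at h6
        omega
      obtain ⟨v, hv, hvu⟩ := hex
      have hvB := hIB v hv hvu
      have hlt : (S.B q z).card < (S.N z).card :=
        Finset.card_lt_card ⟨hB, fun hsub => hvB (hsub (hIN hv))⟩
      push_cast
      omega
  · have hIB' : ∀ v ∈ S.I R z, v ∉ S.B q z := by
      intro v hv hvB
      by_cases hvu : v = S.u j
      · rw [hvu] at hvB; exact huB hvB
      · exact hIB v hv hvu hvB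
    have hBI : (S.B q z).card + (S.I R z).card ≤ S.Δ := by
      have := two_disj (A := ∅) (by simp) hB hN (S.I R z) hIN
        (fun x hx => ⟨by simp, hIB' x hx⟩)
      simpa using this
    have hI1 : 1 ≤ (S.I R z).card := Finset.card_pos.2 hIne
    by_cases hr2 : ρ + 2 ≤ S.r z
    · have hmul : 2 * ((S.Δ : ℤ) - 2) ≤ ((S.Δ : ℤ) - 2) * S.ce z := by
        rw [hce]; nlinarith
      push_cast
      omega
    have hce1 : S.ce z = 1 := by rw [hce]; omega
    rw [hce1]
    by_cases hm2 : 2 ≤ S.m z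
    · push_cast
      omega
    by_cases hcB : (S.B q z).card + 2 ≤ S.Δ
    · push_cast
      omega
    have hD : S.D z := by
      right
      obtain ⟨v, hv⟩ := Finset.card_eq_one.1 (by omega : (S.I R z).card = 1)
      refine ⟨j, v, hj, ?_, by omega, ?_, ?_⟩
      · intro i hi
        exact S.uniq_of_m (by omega) hi (by omega)
      · have : S.r z = R := by omega
        rw [this, hv]
      · by_cases hzu : z = S.u j
        · exact Or.inl hzu
        right
        obtain ⟨y, hy, hy2⟩ := S.hpar j z hzu (by omega)
        have hyB : y ∉ S.B q z := by
          intro hyB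
          rcases (S.B_Z h hj hyB).2.2.2 with h2 | ⟨-, h2, -⟩
          · rw [h2.1] at hyB; exact huB hyB
          · omega
        have hyv : y = v := by
          by_contra hne
          have h2 := two_disj (A := ∅) (by simp) hB hN {y, v} (by
            intro a ha
            rcases Finset.mem_insert.1 ha with rfl | ha
            · exact hy
            · rw [Finset.mem_singleton.1 ha]; apply hIN; rw [hv]; simp) (by
            intro a ha
            refine ⟨by simp, ?_⟩
            rcases Finset.mem_insert.1 ha with rfl | ha
            · exact hyB
            · rw [Finset.mem_singleton.1 ha]; apply hIB'; rw [hv]; simp)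
          rw [Finset.card_pair hne] at h2
          simp only [Finset.empty_union] at h2
          omega
        rw [← hyv]; exact hy2
    rw [if_pos hD]
    push_cast
    omega

open Classical in
lemma local_all (h : S.Recv p q) (v : V) :
    (((S.A p v).card + (S.B q v).card : ℕ) : ℤ) ≤ ((S.Δ : ℤ) - 2) * S.ce v + S.m v - 1 +
      (if S.K v then 1 else 0) + (if S.D v then 1 else 0) := by
  by_cases hZ : ∃ j, 2 ≤ S.ρ j v
  · obtain ⟨j, hj⟩ := hZ
    exact S.local_Z h hj
  push Not at hZ
  have hρ : ∀ i, S.ρ i v ≤ 1 := fun i => by have := hZ i; omega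
  by_cases hr : 2 ≤ S.r v
  · exact S.local_W h ⟨hr, hρ⟩
  have hA0 : (S.A p v).card = 0 := by
    rw [Finset.card_eq_zero, Finset.eq_empty_iff_forall_notMem]
    intro x hx
    exact hr (S.A_r h hx)
  have hB0 : (S.B q v).card = 0 := by
    rw [Finset.card_eq_zero, Finset.eq_empty_iff_forall_notMem]
    intro x hx
    obtain ⟨hD, hq⟩ := S.mem_B.1 hx
    rcases hD with hD | hD
    · exact hr (S.I2 hD.1.1 (by rw [h.qW x hD, hq]; simp)).1
    · obtain ⟨i, hi⟩ := h.qH x hD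
      rw [hq] at hi
      have h2 := hi.1
      have h3 := hi.2.2.1
      have := (S.hL _ _ v 0 le_rfl (S.hard_mem hi) (by omega)).1
      omega
  rw [hA0, hB0]
  have hΔ := S.hΔ
  have h0 : 0 ≤ ((S.Δ : ℤ) - 2) * S.ce v := mul_nonneg (by omega) (S.ce_nonneg v)
  have hD0 : (0 : ℤ) ≤ if S.D v then (1 : ℤ) else 0 := by split_ifs <;> simp
  have hmu : (if S.K v then (1 : ℤ) else 0) + S.m v ≥ 1 := by
    split_ifs with hK
    · omega
    · unfold K at hK
      push Not at hK
      obtain ⟨i, hi⟩ := hK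
      have := S.m_pos (i := i) (v := v) (by omega)
      omega
  push_cast
  linarith

lemma sum_fib (Q : V → Prop) [DecidablePred Q] (f : V → V) (F : V → Finset V)
    (hF : ∀ v x, x ∈ F v ↔ Q x ∧ f x = v) :
    ∑ v, ((F v).card : ℤ) = ∑ v, if Q v then 1 else 0 := by
  have h1 : ∀ v, F v = (univ.filter Q).filter (fun x => f x = v) := by
    intro v; ext x; simp [hF]
  have h2 := Finset.card_eq_sum_card_fiberwise (s := univ.filter Q) (t := univ) (f := f)
    (by intro x _; simp)
  rw [← Nat.cast_sum]
  simp only [h1]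
  rw [← h2]
  simp

theorem main : (Fintype.card V : ℤ) - ∑ v, (S.m v : ℤ) ≤ ((S.Δ : ℤ) - 2) * ∑ v, S.ce v := by
  classical
  obtain ⟨p, q, h⟩ := S.exists_recv
  have hs := Finset.sum_le_sum (fun v (_ : v ∈ (univ : Finset V)) => S.local_all h v)
  have hA := sum_fib S.K p (S.A p) (fun v x => S.mem_A)
  have hB := sum_fib S.D q (S.B q) (fun v x => S.mem_B)
  push_cast at hs
  simp only [Finset.sum_add_distrib, Finset.sum_sub_distrib, ← Finset.mul_sum] at hs
  simp only [Finset.sum_const, Finset.card_univ, nsmul_eq_mul, mul_one] at hs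
  rw [hA, hB] at hs
  linarith

end PData

section Assembly

variable {V : Type*} [Fintype V] [DecidableEq V]

/-- Minimal flow cost. -/
noncomputable def fcost (G : SimpleGraph V) (p : V → ℕ) (k : ℕ) (t : V) : ℕ :=
  sInf {n | ∃ f, Bal G p k t f ∧ fsize f = n}

lemma fcost_le {G : SimpleGraph V} {p : V → ℕ} {k : ℕ} {t : V} {f : V → V → ℕ}
    (h : Bal G p k t f) : fcost G p k t ≤ fsize f := Nat.sInf_le ⟨f, h, rfl⟩

lemma exists_min {G : SimpleGraph V} {p : V → ℕ} :
    ∃ F : ℕ → V → V → V → ℕ, ∀ k t, k ≤ reach G p t →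
      Bal G p k t (F k t) ∧ fsize (F k t) = fcost G p k t := by
  have : ∀ k t, ∃ f : V → V → ℕ, k ≤ reach G p t →
      Bal G p k t f ∧ fsize f = fcost G p k t := by
    intro k t
    by_cases h : k ≤ reach G p t
    · obtain ⟨f, hf⟩ := le_reach_bal.1 h
      obtain ⟨g, hg⟩ := Nat.sInf_mem (s := {n | ∃ f, Bal G p k t f ∧ fsize f = n}) ⟨_, f, hf, rfl⟩
      exact ⟨g, fun _ => hg⟩
    · exact ⟨fun _ _ => 0, fun h' => absurd h' h⟩
  choose F hF using this
  exact ⟨F, hF⟩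

lemma TE_zero (G : SimpleGraph V) : TE G (0 : V → ℕ) = 0 := by
  unfold TE
  apply Finset.sum_eq_zero
  intro v _
  have := reach_le_total G (0 : V → ℕ) v
  simp at this
  simp [exc, this]

lemma CE_telescope (G : SimpleGraph V) (t : ℕ) (U : Fin t → V → ℕ) :
    ∑ i, CE G (∑ k ∈ Finset.univ.filter (· < i), U k) (U i) =
      (TE G (∑ i, U i) : ℤ) - ∑ i, (TE G (U i) : ℤ) := by
  let T : ℕ → V → ℕ := fun n => ∑ k ∈ Finset.univ.filter (fun k : Fin t => k.val < n), U k
  have hT : ∀ i : Fin t, (∑ k ∈ Finset.univ.filter (· < i), U k) = T i.val := fun i => rfl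
  have hT1 : ∀ i : Fin t, T i.val + U i = T (i.val + 1) := by
    intro i
    have : Finset.univ.filter (fun k : Fin t => k.val < i.val + 1) =
        insert i (Finset.univ.filter (fun k : Fin t => k.val < i.val)) := by
      ext k
      simp [Fin.ext_iff]
      omega
    simp only [T]
    rw [this, Finset.sum_insert (by simp), add_comm]
  have hT0 : T 0 = 0 := by simp [T]
  have hTt : T t = ∑ i, U i := by simp [T]
  have h1 : ∀ i : Fin t, CE G (∑ k ∈ Finset.univ.filter (· < i), U k) (U i) =
      ((TE G (T (i.val + 1)) : ℤ) - TE G (T i.val)) - TE G (U i) := by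
    intro i
    rw [hT, CE, hT1]
  rw [Finset.sum_congr rfl (fun i _ => h1 i), Finset.sum_sub_distrib,
    Fin.sum_univ_eq_sum_range (fun n => (TE G (T (n + 1)) : ℤ) - TE G (T n)) t,
    Finset.sum_range_sub (fun n => (TE G (T n) : ℤ)), hT0, hTt, TE_zero]
  simp

end Assembly

/-- For a solvable `P` on a graph with `Δ ≥ 3`, decomposed into disjoint
units `U_1 ≤ … ≤ U_t`, `∑ CE(∑_{k<i} U_k, U_i) ≥ (|V| − ∑ cov(U_i)) / (Δ−2)`. -/
theorem stmt12 {V : Type*} [Fintype V] [DecidableEq V] (G : SimpleGraph V)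
    [DecidableRel G.Adj] (hΔ : 3 ≤ G.maxDegree)
    (P : V → ℕ) (hP : Solvable G P)
    (t : ℕ) (U : Fin t → V → ℕ) (u : Fin t → V)
    (hunit : ∀ i, U i = fun w => if w = u i then P (u i) else 0)
    (hpos : ∀ i, 0 < P (u i)) (huinj : Function.Injective u)
    (hsum : ∀ v, P v = ∑ i, U i v)
    (hmono : ∀ i j : Fin t, i ≤ j → ∑ v, U i v ≤ ∑ v, U j v) :
    ((Fintype.card V : ℚ) - ∑ i, (cov G (U i) : ℚ)) / ((G.maxDegree : ℚ) - 2)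
      ≤ ∑ i, (CE G (∑ k ∈ Finset.univ.filter (· < i), U k) (U i) : ℚ) := by
  classical
  have hPs : P = ∑ i, U i := by
    funext v
    rw [hsum v, Finset.sum_apply]
  have hU : ∀ i, U i = unitD (u i) (P (u i)) := fun i => hunit i
  obtain ⟨F, hF⟩ := exists_min (G := G) (p := P)
  have key : ∀ k t x j a, k ≤ reach G P t → F k t x t ≠ 0 → j ≤ F k t x t → j + 2 * a ≤ k →
      2 * j + a ≤ reach G P x ∧ fcost G P (2 * j + a) x + j ≤ fcost G P k t + a := by
    intro k t x j a hk hx hj hka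
    obtain ⟨f', hf', hs⟩ := (hF k t hk).1.modify hx j a hj hka
    refine ⟨le_reach_bal.2 ⟨f', hf'⟩, ?_⟩
    have := fcost_le hf'
    rw [← (hF k t hk).2]
    omega
  let S : PData V (Fin t) :=
    { N := fun v => G.neighborFinset v
      Δ := G.maxDegree
      r := fun v => reach G P v
      P := P
      ρ := fun i v => reach G (U i) v
      u := u
      c := fcost G P
      I := fun k t => Finset.univ.filter (fun x => F k t x t ≠ 0)
      hΔ := hΔ
      hN := fun v => G.degree_le_maxDegree v
      hsymm := by
        intro x y h
        rw [SimpleGraph.mem_neighborFinset] at h ⊢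
        exact h.symm
      hirr := by
        intro x h
        rw [SimpleGraph.mem_neighborFinset] at h
        exact h.ne rfl
      h1 := fun v => le_reach_iff.2 (hP v)
      hsup := by
        intro v
        have := reach_sum G U v Finset.univ
        rwa [← hPs] at this
      hPu := by
        intro v hv
        by_contra hc
        push Not at hc
        rw [hsum v, Finset.sum_eq_zero] at hv
        · omega
        · intro i _
          rw [hunit i]
          simp only
          rw [if_neg (fun h => hc i h.symm)]
      hcen := by
        intro i
        simp only [hU i]
        exact unit_reach_self G _ _
      hadj := by
        intro i x z h
        rw [SimpleGraph.mem_neighborFinset] at h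
        exact reach_adj h
      hpar := by
        intro i v hv h1
        simp only [hU i] at h1 ⊢
        obtain ⟨z, hz, hz2⟩ := unit_parent hv h1
        exact ⟨z, by rw [SimpleGraph.mem_neighborFinset]; exact hz, hz2⟩
      hle := by
        intro i v
        have := reach_le_total G (U i) v
        rw [hU i] at this ⊢
        simpa [unitD] using this
      hI := by
        intro k t hk hPk
        have h2 := (hF k t hk).1.2 t
        simp only [if_true] at h2
        by_contra hc
        rw [Finset.not_nonempty_iff_eq_empty] at hc
        have h0 : ∑ x, F k t x t = 0 := by
          apply Finset.sum_eq_zero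
          intro x _
          by_contra hx
          have : x ∈ Finset.univ.filter (fun x => F k t x t ≠ 0) := by simpa using hx
          rw [hc] at this
          simp at this
        omega
      hIN := by
        intro k t x hk hx
        rw [SimpleGraph.mem_neighborFinset]
        exact ((hF k t hk).1.1 x t (by simpa using hx)).symm
      hL := by
        intro k t x a hk hx ha
        have hx' : F k t x t ≠ 0 := by simpa using hx
        exact key k t x 1 a hk hx' (by omega) (by omega)
      hL3 := by
        intro k t x j hk hx hj
        have hx' : F k t x t ≠ 0 := by
          have : x ∈ Finset.univ.filter (fun x => F k t x t ≠ 0) := by rw [hx]; simp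
          simpa using this
        have h2 := (hF k t hk).1.2 t
        simp only [if_true] at h2
        have h0 : ∑ y, F k t y t = F k t x t := by
          apply Finset.sum_eq_single x
          · intro y _ hy
            by_contra hy0
            have : y ∈ Finset.univ.filter (fun x => F k t x t ≠ 0) := by simpa using hy0
            rw [hx] at this
            exact hy (by simpa using this)
          · simp
        have := key k t x j 0 hk hx' (by omega) (by omega)
        simpa using this }
  have hmain := S.main
  have hm : ∑ v, (S.m v : ℤ) = ∑ i, (cov G (U i) : ℤ) := by
    have h1 : ∀ v, (S.m v : ℤ) = ∑ i, if 1 ≤ reach G (U i) v then (1 : ℤ) else 0 := by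
      intro v
      simp only [PData.m, S]
      rw [Finset.card_filter]
      push_cast
      exact Finset.sum_congr rfl (fun i _ => by congr)
    have h2 : ∀ i, (cov G (U i) : ℤ) = ∑ v, if 1 ≤ reach G (U i) v then (1 : ℤ) else 0 := by
      intro i
      have : {v | Reachable' G (U i) v} =
          ((Finset.univ.filter (fun v => 1 ≤ reach G (U i) v) : Finset V) : Set V) := by
        ext v
        simp only [Set.mem_setOf_eq, Finset.coe_filter, Finset.mem_univ, true_and]
        exact le_reach_iff.symm
      rw [cov, this, Set.ncard_coe_finset, Finset.card_filter]
      push_cast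
      rfl
    rw [Finset.sum_congr rfl (fun v _ => h1 v), Finset.sum_congr rfl (fun i _ => h2 i),
      Finset.sum_comm]
  have hc : ∑ v, S.ce v = (TE G P : ℤ) - ∑ i, (TE G (U i) : ℤ) := by
    simp only [PData.ce, S, TE, exc]
    rw [Finset.sum_sub_distrib, Finset.sum_comm]
    push_cast
    congr 1
    apply Finset.sum_congr rfl
    intro v _
    have : 1 ≤ reach G P v := le_reach_iff.2 (hP v)
    omega
  have htel := CE_telescope G t U
  rw [← hPs] at htel
  rw [hm, hc, ← htel] at hmain
  have hΔ' : (0 : ℚ) < (G.maxDegree : ℚ) - 2 := by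
    have : (3 : ℚ) ≤ G.maxDegree := by exact_mod_cast hΔ
    linarith
  rw [div_le_iff₀ hΔ', mul_comm]
  have hSΔ : S.Δ = G.maxDegree := rfl
  rw [hSΔ] at hmain
  exact_mod_cast hmain
end
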